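/- Let K be a field of characteristic zero and D ⊆ Δ⁺ a basic subset. The field of invariants K(V_D^∘)^N of the coadjoint action of N = UT(n,K) on the field of rational functions on the basic cell V_D^∘ is a purely transcendental extension of K of transcendence degree |C(D)|; that is, it is generated over K by |C(D)| algebraically independent elements. Moreover, a generating system {F_ξ : ξ ∈ C(D)} can be chosen so that for each ξ = (i,j) ∈ D, F_ξ is the image in K(V_D^∘) of the minor P^{w_D}_{ij}(X). -/

import Mathlib

/-- A positive root `(i,j)`: `n ≥ i > j ≥ 1`. -/
def IsPosRoot (n : ℕ) (γ : ℕ × ℕ) : Prop := 1 ≤ γ.2 ∧ γ.2 < γ.1 ∧ γ.1 ≤ n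

/-- `γ` is the sum of the roots `α` and `β` (in either order):
`(i,j) + (j,k) = (i,k)`. -/
def RootSum (α β γ : ℕ × ℕ) : Prop :=
  (α.2 = β.1 ∧ γ = (α.1, β.2)) ∨ (β.2 = α.1 ∧ γ = (β.1, α.2))

/-- A basic subset: a set of positive roots with at most one root in each
row and at most one root in each column. -/
def IsBasic (n : ℕ) (D : Set (ℕ × ℕ)) : Prop :=
  (∀ γ ∈ D, IsPosRoot n γ) ∧
  (∀ α ∈ D, ∀ β ∈ D, α.1 = β.1 → α = β) ∧
  (∀ α ∈ D, ∀ β ∈ D, α.2 = β.2 → α = β)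

/-- A positive root `α` is `D`-singular if `α + β ∈ D` for some positive root `β`. -/
def IsSingular (n : ℕ) (D : Set (ℕ × ℕ)) (α : ℕ × ℕ) : Prop :=
  IsPosRoot n α ∧ ∃ β γ, IsPosRoot n β ∧ RootSum α β γ ∧ γ ∈ D

/-- `M(D) = R(D) \ D`, where `R(D)` is the set of `D`-regular positive roots. -/
def MD (n : ℕ) (D : Set (ℕ × ℕ)) : Set (ℕ × ℕ) :=
  {γ | IsPosRoot n γ ∧ ¬ IsSingular n D γ ∧ γ ∉ D}
/-- The list `[w_D(1), …, w_D(j)]`, defined recursively: `w_D(j)` is the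
greatest `i ∈ {1,…,n}` with `(i,j) ∉ M(D)` and `i ∉ {w_D(1),…,w_D(j-1)}`. -/
noncomputable def wDVals (n : ℕ) (D : Set (ℕ × ℕ)) : ℕ → List ℕ
  | 0 => []
  | j + 1 =>
    let prev := wDVals n D j
    prev ++ [sSup {i | 1 ≤ i ∧ i ≤ n ∧ (i, j + 1) ∉ MD n D ∧ i ∉ prev}]

/-- The permutation `w_D` associated with a basic subset `D` (as a map `ℕ → ℕ`,
meaningful on `{1,…,n}`). -/
noncomputable def wD (n : ℕ) (D : Set (ℕ × ℕ)) (j : ℕ) : ℕ :=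
  ((wDVals n D j).getLast?).getD 0
open scoped Classical

/-- Marks used in the diagram of a basic subset. -/
inductive Mark : Type
  | otimes : Mark
  | plus : Mark
  | minus : Mark
  | bullet : Mark
deriving DecidableEq

/-- A marking state of the diagram: a partial assignment of marks to places. -/
abbrev MState : Type := ℕ × ℕ → Option Mark

/-- Step 0 of the diagram construction: every root of `M(D)` is marked `•`. -/
noncomputable def initMark (n : ℕ) (D : Set (ℕ × ℕ)) : MState :=
  fun γ => if γ ∈ MD n D then some Mark.bullet else none

/-- One step of the diagram construction: mark `ξ` with `⊗`, and for every
decomposition `ξ = α + β` with `col α = col ξ`, `row β = row ξ` and both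
`α`, `β` unmarked, mark `α` with `+` and `β` with `−`. -/
noncomputable def markStep (s : MState) (ξ : ℕ × ℕ) : MState :=
  fun γ =>
    if γ = ξ then some Mark.otimes
    else if γ.2 = ξ.2 ∧ ξ.2 < γ.1 ∧ γ.1 < ξ.1 ∧ s γ = none ∧ s (ξ.1, γ.1) = none then
      some Mark.plus
    else if γ.1 = ξ.1 ∧ ξ.2 < γ.2 ∧ γ.2 < ξ.1 ∧ s γ = none ∧ s (γ.2, ξ.2) = none then
      some Mark.minus
    else s γ

/-- The list of all positive roots in decreasing order with respect to `≻`
(`(k,m) ≻ (i,j)` iff `m < j`, or `m = j` and `k > i`). -/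
def rootList (n : ℕ) : List (ℕ × ℕ) :=
  (List.range n).flatMap (fun j0 =>
    (List.range n).filterMap (fun k =>
      if j0 + 1 < n - k then some (n - k, j0 + 1) else none))

/-- Run the diagram construction along a list of places, recording at each
step `i` the pair (`ξ_i`, state after step `i`). -/
noncomputable def diagRun (s : MState) : List (ℕ × ℕ) → List ((ℕ × ℕ) × MState)
  | [] => []
  | ξ :: rest =>
    if s ξ = none then (ξ, markStep s ξ) :: diagRun (markStep s ξ) rest
    else diagRun s rest

/-- The full run of the diagram construction for a basic subset `D`. -/
noncomputable def diagSeq (n : ℕ) (D : Set (ℕ × ℕ)) : List ((ℕ × ℕ) × MState) :=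
  diagRun (initMark n D) (rootList n)

/-- `c`, the number of steps (= number of `⊗` marks) of the diagram. -/
noncomputable def numSteps (n : ℕ) (D : Set (ℕ × ℕ)) : ℕ := (diagSeq n D).length

/-- `ξ_i`, the root marked `⊗` at step `i` (for `1 ≤ i ≤ c`). -/
noncomputable def xiRoot (n : ℕ) (D : Set (ℕ × ℕ)) (i : ℕ) : ℕ × ℕ :=
  (((diagSeq n D).getD (i - 1) ((0, 0), initMark n D))).1

/-- The state of the diagram after step `i` (for `0 ≤ i ≤ c`); the state
"before step `i`" is `stateAfter n D (i-1)`. -/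
noncomputable def stateAfter (n : ℕ) (D : Set (ℕ × ℕ)) : ℕ → MState
  | 0 => initMark n D
  | i + 1 => (((diagSeq n D).getD i ((0, 0), initMark n D))).2

/-- `C(D)`: the set of roots marked `⊗` on the diagram. -/
noncomputable def CD (n : ℕ) (D : Set (ℕ × ℕ)) : Set (ℕ × ℕ) :=
  {γ | γ ∈ (diagSeq n D).map Prod.fst}

/-- `A_γ`: the set of roots of `C(D)` in the same row as `γ`, strictly to the
left of `γ`. -/
noncomputable def AD (n : ℕ) (D : Set (ℕ × ℕ)) (γ : ℕ × ℕ) : Set (ℕ × ℕ) :=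
  {γ' | γ' ∈ CD n D ∧ γ'.1 = γ.1 ∧ γ'.2 < γ.2}
open scoped Classical

/-- The variable set `{x_γ : γ ∈ Δ⁺}`: positive roots of `Δ⁺`. -/
abbrev PRoot (n : ℕ) : Type := {γ : ℕ × ℕ // IsPosRoot n γ}

/-- A point `v : Δ⁺ → K` of `𝔫₋` realized as a strictly lower triangular
matrix (`1`-based roots, `0`-based matrix indices). -/
noncomputable def matOf (n : ℕ) (K : Type) [Field K] (v : PRoot n → K) :
    Matrix (Fin n) (Fin n) K :=
  fun a b =>
    if h : IsPosRoot n ((a : ℕ) + 1, (b : ℕ) + 1) then v ⟨((a : ℕ) + 1, (b : ℕ) + 1), h⟩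
    else 0

/-- The point of `𝔫₋` given by the strictly lower triangular entries of a
matrix. -/
noncomputable def vecOf (n : ℕ) (K : Type) [Field K] (A : Matrix (Fin n) (Fin n) K)
    (γ : PRoot n) : K :=
  A ⟨γ.1.1 - 1, by obtain ⟨h1, h2, h3⟩ := γ.2; omega⟩
    ⟨γ.1.2 - 1, by obtain ⟨h1, h2, h3⟩ := γ.2; omega⟩

/-- `π`: the strictly lower triangular part of a matrix. -/
def lowerPart (n : ℕ) (K : Type) [Field K] (A : Matrix (Fin n) (Fin n) K) :
    Matrix (Fin n) (Fin n) K :=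
  fun a b => if (b : ℕ) < (a : ℕ) then A a b else 0

/-- Membership in `N = UT(n,K)`: upper triangular with units on the diagonal. -/
def IsUni (n : ℕ) (K : Type) [Field K] (g : Matrix (Fin n) (Fin n) K) : Prop :=
  (∀ i : Fin n, g i i = 1) ∧ ∀ i j : Fin n, j < i → g i j = 0

/-- The element `X_{D,φ} = Σ_{ξ ∈ D} φ(ξ) E_ξ` of `𝔫₋`. -/
noncomputable def XDphi (n : ℕ) (K : Type) [Field K] (D : Set (ℕ × ℕ)) (φ : ℕ × ℕ → K) :
    Matrix (Fin n) (Fin n) K :=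
  fun a b => if ((a : ℕ) + 1, (b : ℕ) + 1) ∈ D then φ ((a : ℕ) + 1, (b : ℕ) + 1) else 0

/-- The basic variety `V_{D,φ} = {π(g X_{D,φ} h) : g, h ∈ N}`, as a set of
points of `𝔫₋`. -/
noncomputable def VDvar (n : ℕ) (K : Type) [Field K] (D : Set (ℕ × ℕ)) (φ : ℕ × ℕ → K) :
    Set (PRoot n → K) :=
  {v | ∃ g h : Matrix (Fin n) (Fin n) K, IsUni n K g ∧ IsUni n K h ∧
    v = vecOf n K (lowerPart n K (g * XDphi n K D φ * h))}

/-- The basic cell `V_D^∘ = ⋃_φ V_{D,φ}`, over all `φ : D → K ∖ {0}`. -/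
noncomputable def VDcell (n : ℕ) (K : Type) [Field K] (D : Set (ℕ × ℕ)) :
    Set (PRoot n → K) :=
  {v | ∃ φ : ℕ × ℕ → K, (∀ γ ∈ D, φ γ ≠ 0) ∧ v ∈ VDvar n K D φ}

/-- The vanishing ideal `I(S)` of a set of points `S`. -/
noncomputable def vanishing (σ K : Type) [Field K] (S : Set (σ → K)) :
    Ideal (MvPolynomial σ K) where
  carrier := {f | ∀ v ∈ S, MvPolynomial.eval v f = 0}
  add_mem' := by
    intro a b ha hb v hv
    simp [map_add, ha v hv, hb v hv]
  zero_mem' := by intro v hv; simp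
  smul_mem' := by
    intro c f hf v hv
    simp [smul_eq_mul, hf v hv]
/-- The coadjoint action of `g ∈ N` on a point of `𝔫₋`: `X ↦ π(g X g⁻¹)`. -/
noncomputable def coadjPt (n : ℕ) (K : Type) [Field K]
    (g : Matrix (Fin n) (Fin n) K) (v : PRoot n → K) : PRoot n → K :=
  vecOf n K (lowerPart n K (g * matOf n K v * g⁻¹))

/-- The minor `P^w_{ij}(A)` for `w : ℕ → ℕ` and `1`-based indices `i, j`:
rows `I = w(J') ∪ {i}`, columns `J = J' ∪ {j}`, where
`J' = {b < j : w(b) > i}`, each listed in increasing order. -/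
noncomputable def minorW (n : ℕ) (R : Type) [CommRing R] (w : ℕ → ℕ)
    (A : Matrix (Fin n) (Fin n) R) (i j : ℕ) : R :=
  let J' : Finset (Fin n) := Finset.univ.filter (fun b => (b : ℕ) + 1 < j ∧ i < w ((b : ℕ) + 1))
  let JJ : Finset (Fin n) := J' ∪ Finset.univ.filter (fun b => (b : ℕ) + 1 = j)
  let II : Finset (Fin n) := Finset.univ.filter
    (fun a => (a : ℕ) + 1 = i ∨ ∃ b ∈ J', w ((b : ℕ) + 1) = (a : ℕ) + 1)
  if h : II.card = JJ.card then
    Matrix.det (Matrix.of fun a b : Fin JJ.card =>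
      A ((II.orderIsoOfFin h) a).val ((JJ.orderIsoOfFin rfl) b).val)
  else 0

/-- The generic matrix of `𝔫₋`, whose strictly lower triangular entries are
the variables `x_γ`. -/
noncomputable def genMat (n : ℕ) (K : Type) [Field K] :
    Matrix (Fin n) (Fin n) (MvPolynomial (PRoot n) K) :=
  fun a b =>
    if h : IsPosRoot n ((a : ℕ) + 1, (b : ℕ) + 1) then
      MvPolynomial.X ⟨((a : ℕ) + 1, (b : ℕ) + 1), h⟩
    else 0

/-- The field of rational functions `K(S)` on an (irreducible) subset
`S ⊆ 𝔫₋`: the fraction field of `K[x_γ]/I(S)`. -/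
noncomputable abbrev RatFld (n : ℕ) (K : Type) [Field K] (S : Set (PRoot n → K)) : Type :=
  FractionRing (MvPolynomial (PRoot n) K ⧸ vanishing (PRoot n) K S)

/-- `F ∈ K(S)` is an invariant of the coadjoint action of `N` on `S`:
writing `F = f/h` with `h ∉ I(S)`, for every `g ∈ N` the rational functions
`F ∘ (coadjoint action of g)` and `F` agree on `S`. -/
noncomputable def IsInvariantRat (n : ℕ) (K : Type) [Field K]
    (S : Set (PRoot n → K)) (F : RatFld n K S) : Prop :=
  ∃ f h : MvPolynomial (PRoot n) K,
    h ∉ vanishing (PRoot n) K S ∧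
    algebraMap (MvPolynomial (PRoot n) K ⧸ vanishing (PRoot n) K S) (RatFld n K S)
        (Ideal.Quotient.mk (vanishing (PRoot n) K S) h) * F =
      algebraMap (MvPolynomial (PRoot n) K ⧸ vanishing (PRoot n) K S) (RatFld n K S)
        (Ideal.Quotient.mk (vanishing (PRoot n) K S) f) ∧
    ∀ g : Matrix (Fin n) (Fin n) K, IsUni n K g → ∀ v ∈ S,
      MvPolynomial.eval (coadjPt n K g v) f * MvPolynomial.eval v h =
        MvPolynomial.eval v f * MvPolynomial.eval (coadjPt n K g v) h

/-! ### Record steps: the combinatorics of one column -/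

/-- The rows of column `c` whose values lie in the window `(τ c, T]`. -/
def InWindow (τ : ℕ → ℕ) (c T k : ℕ) : Prop := c < k ∧ τ c < τ k ∧ τ k ≤ T

/-- The greatest value of `τ` at `c` and at the rows of the window below row `k`. -/
noncomputable def recordBound (n : ℕ) (τ : ℕ → ℕ) (c T k : ℕ) : ℕ :=
  (insert c ((Finset.Ioc k n).filter (InWindow τ c T))).sup τ

/-- Row `k` is a record of the window: its value exceeds those of all window rows below it. -/
def IsRecord (n : ℕ) (τ : ℕ → ℕ) (c T k : ℕ) : Prop :=
  InWindow τ c T k ∧ recordBound n τ c T k < τ k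

/-- The values after processing column `c`: each record takes the value of the preceding record. -/
noncomputable def stepTau (n : ℕ) (τ : ℕ → ℕ) (c T k : ℕ) : ℕ :=
  if IsRecord n τ c T k then recordBound n τ c T k else τ k

section Record

variable {n : ℕ} {τ : ℕ → ℕ} {c T : ℕ}

lemma le_recordBound_left (k : ℕ) : τ c ≤ recordBound n τ c T k :=
  Finset.le_sup (f := τ) (Finset.mem_insert_self _ _)

lemma le_recordBound {k b : ℕ} (hkb : k < b) (hbn : b ≤ n) (hb : InWindow τ c T b) :
    τ b ≤ recordBound n τ c T k :=
  Finset.le_sup (f := τ) (by simp [hkb, hbn, hb])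

lemma recordBound_eq (k : ℕ) : recordBound n τ c T k = τ c ∨
    ∃ b, k < b ∧ b ≤ n ∧ InWindow τ c T b ∧ recordBound n τ c T k = τ b := by
  obtain ⟨b, hb, h⟩ := Finset.exists_mem_eq_sup
    (insert c ((Finset.Ioc k n).filter (InWindow τ c T))) (Finset.insert_nonempty _ _) τ
  simp only [Finset.mem_insert, Finset.mem_filter, Finset.mem_Ioc] at hb
  rcases hb with rfl | ⟨⟨h1, h2⟩, h3⟩
  · exact Or.inl h
  · exact Or.inr ⟨b, h1, h2, h3, h⟩

lemma recordBound_lt_iff {k m : ℕ} : recordBound n τ c T k < m ↔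
    τ c < m ∧ ∀ b, k < b → b ≤ n → InWindow τ c T b → τ b < m := by
  refine ⟨fun h => ⟨(le_recordBound_left k).trans_lt h,
    fun b h1 h2 h3 => (le_recordBound h1 h2 h3).trans_lt h⟩, fun ⟨h1, h2⟩ => ?_⟩
  rcases recordBound_eq (n := n) (τ := τ) (c := c) (T := T) k with h | ⟨b, h3, h4, h5, h⟩
  · omega
  · have := h2 b h3 h4 h5
    omega

lemma IsRecord.lt {a b : ℕ} (ha : IsRecord n τ c T a) (hab : a < b) (hbn : b ≤ n)
    (hb : InWindow τ c T b) : τ b < τ a :=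
  (le_recordBound hab hbn hb).trans_lt ha.2

lemma stepTau_lt_stepTau_iff (hτ : Set.InjOn τ (Set.Icc c n)) {a b : ℕ} (hcb : c < b)
    (hba : b < a) (han : a ≤ n) : stepTau n τ c T b < stepTau n τ c T a ↔
      τ b < τ a ∧ ¬ (IsRecord n τ c T a ∧ InWindow τ c T b ∧ recordBound n τ c T a < τ b) := by
  have hne : ∀ d, c ≤ d → d ≤ n → d ≠ b → τ d ≠ τ b := fun d h1 h2 h3 h4 =>
    h3 (hτ ⟨h1, h2⟩ ⟨hcb.le, by omega⟩ h4)
  have hne' : τ c ≠ τ a := fun h => by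
    have := hτ ⟨le_refl c, by omega⟩ ⟨by omega, han⟩ h
    omega
  have hcb' := hne c le_rfl (by omega) (by omega)
  have la := le_recordBound_left (n := n) (τ := τ) (c := c) (T := T) a
  have lb := le_recordBound_left (n := n) (τ := τ) (c := c) (T := T) b
  have lab := fun h => le_recordBound (n := n) (τ := τ) (c := c) (T := T) hba han h
  have hpa : recordBound n τ c T a ≠ τ b := by
    rcases recordBound_eq (n := n) (τ := τ) (c := c) (T := T) a with h | ⟨d, h1, h2, h3, h⟩
    · omega
    · rw [h]
      exact hne d (by omega) h2 (by omega)
  unfold stepTau IsRecord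
  unfold InWindow at *
  split_ifs <;> omega

lemma stepTau_injOn (hτ : Set.InjOn τ (Set.Icc c n)) :
    Set.InjOn (stepTau n τ c T) (Set.Icc (c + 1) n) := by
  have key : ∀ a b, c < b → b < a → a ≤ n → stepTau n τ c T a ≠ stepTau n τ c T b := by
    intro a b hcb hba han
    have hab : τ a ≠ τ b := fun h => by
      have := hτ ⟨by omega, han⟩ ⟨hcb.le, by omega⟩ h
      omega
    have aux : ∀ d e, c < d → d ≤ n → e ≠ d → ¬ IsRecord n τ c T d → IsRecord n τ c T e →
        recordBound n τ c T e ≠ τ d := by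
      intro d e hcd hdn hed hd he h
      rcases recordBound_eq (n := n) (τ := τ) (c := c) (T := T) e with h' | ⟨f, h1, h2, h3, h'⟩
      · have := hτ ⟨le_refl c, by omega⟩ ⟨hcd.le, hdn⟩ (h' ▸ h)
        omega
      · have hfd := hτ ⟨by have := h3.1; omega, h2⟩ ⟨hcd.le, hdn⟩ (h' ▸ h)
        subst hfd
        refine hd ⟨h3, recordBound_lt_iff.2 ⟨h3.2.1, fun b h4 h5 h6 => ?_⟩⟩
        have h7 := le_recordBound (n := n) (k := e) (by omega) h5 h6
        have h8 : τ b ≠ τ f := fun h9 => by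
          have := hτ ⟨by have := h6.1; omega, h5⟩ ⟨hcd.le, hdn⟩ h9
          omega
        omega
    unfold stepTau
    split_ifs with h1 h2 h2
    · have := h2.2
      have := le_recordBound hba han h1.1
      have := h1.2
      omega
    · exact aux b a hcb (by omega) (by omega) h2 h1
    · exact (aux a b (by omega) han (by omega) h1 h2).symm
    · exact hab
  intro a ha b hb hab
  simp only [Set.mem_Icc] at ha hb
  by_contra hne
  rcases lt_or_gt_of_ne hne with h | h
  · exact key b a (by omega) h hb.2 hab.symm
  · exact key a b (by omega) h ha.2 hab

lemma exists_record_above (hτ : Set.InjOn τ (Set.Icc c n)) {k : ℕ} (hk : InWindow τ c T k)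
    (hkn : k ≤ n) (hk' : ¬ IsRecord n τ c T k) :
    ∃ a, k < a ∧ a ≤ n ∧ IsRecord n τ c T a ∧ recordBound n τ c T a < τ k ∧ τ k < τ a := by
  have hne : ∀ d, c ≤ d → d ≤ n → d ≠ k → τ d ≠ τ k := fun d h1 h2 h3 h4 =>
    h3 (hτ ⟨h1, h2⟩ ⟨hk.1.le, hkn⟩ h4)
  let s := (Finset.Ioc k n).filter fun b => InWindow τ c T b ∧ τ k < τ b
  have hs : s.Nonempty := by
    by_contra hs
    rw [Finset.not_nonempty_iff_eq_empty, Finset.filter_eq_empty_iff] at hs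
    refine hk' ⟨hk, recordBound_lt_iff.2 ⟨hk.2.1, fun b h1 h2 h3 => ?_⟩⟩
    have h4 := hs (Finset.mem_Ioc.2 ⟨h1, h2⟩)
    have := hne b (by have := hk.1; omega) h2 (by omega)
    have : ¬ τ k < τ b := fun h => h4 ⟨h3, h⟩
    omega
  have hmem := s.max'_mem hs
  set a := s.max' hs
  simp only [s, Finset.mem_filter, Finset.mem_Ioc] at hmem
  obtain ⟨⟨h1, h2⟩, h3, h4⟩ := hmem
  have h5 : recordBound n τ c T a < τ k := by
    refine recordBound_lt_iff.2 ⟨hk.2.1, fun b h6 h7 h8 => ?_⟩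
    by_contra h9
    have := hne b (by have := hk.1; omega) h7 (by omega)
    have : b ≤ a := s.le_max' b (by
      simp only [s, Finset.mem_filter, Finset.mem_Ioc]
      exact ⟨⟨by omega, h7⟩, h8, by omega⟩)
    omega
  exact ⟨a, h1, h2, ⟨h3, h5.trans h4⟩, h5, h4⟩

lemma record_above_unique {k a b : ℕ} (han : a ≤ n) (hbn : b ≤ n)
    (ha : IsRecord n τ c T a) (ha1 : recordBound n τ c T a < τ k) (ha2 : τ k < τ a)
    (hb : IsRecord n τ c T b) (hb1 : recordBound n τ c T b < τ k) (hb2 : τ k < τ b) : a = b := by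
  rcases lt_trichotomy a b with h | h | h
  · have := le_recordBound h hbn hb.1
    omega
  · exact h
  · have := le_recordBound h han ha.1
    omega

end Record

/-! ### The diagram of a basic subset in terms of record steps -/

lemma mem_MD_iff {n : ℕ} {D : Set (ℕ × ℕ)} (hD : IsBasic n D) {k c : ℕ} :
    (k, c) ∈ MD n D ↔ IsPosRoot n (k, c) ∧ (∀ m ≤ c, (k, m) ∉ D) ∧ ∀ l, k ≤ l → (l, c) ∉ D := by
  constructor
  · rintro ⟨h1, h2, h3⟩
    refine ⟨h1, fun m hm hmD => ?_, fun l hl hlD => ?_⟩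
    · rcases hm.eq_or_lt with rfl | hm
      · exact h3 hmD
      · exact h2 ⟨h1, (c, m), (k, m), ⟨(hD.1 _ hmD).1, hm, h1.2.1.le.trans h1.2.2⟩,
          Or.inl ⟨rfl, rfl⟩, hmD⟩
    · rcases hl.eq_or_lt with rfl | hl
      · exact h3 hlD
      · exact h2 ⟨h1, (l, k), (l, c), ⟨h1.1.trans h1.2.1.le, hl, (hD.1 _ hlD).2.2⟩,
          Or.inr ⟨rfl, rfl⟩, hlD⟩
  · rintro ⟨h1, h2, h3⟩
    refine ⟨h1, ?_, h2 c le_rfl⟩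
    rintro ⟨-, ⟨b1, b2⟩, γ, hβ, h | h, hγ⟩
    · obtain ⟨h4, rfl⟩ := h
      simp only at h4
      subst h4
      exact h2 b2 hβ.2.1.le hγ
    · obtain ⟨h4, rfl⟩ := h
      simp only at h4
      subst h4
      exact h3 b1 hβ.2.1.le hγ

/-- The row of the root of `D` in column `c`, or `c` itself when there is none. -/
noncomputable def topRow (D : Set (ℕ × ℕ)) (c : ℕ) : ℕ :=
  if h : ∃ l, (l, c) ∈ D then h.choose else c

/-- The values describing the diagram just before column `c` is processed. -/
noncomputable def tauD (n : ℕ) (D : Set (ℕ × ℕ)) : ℕ → ℕ → ℕ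
  | 0 => id
  | c + 1 => stepTau n (tauD n D c) c (topRow D c)

section Diagram

variable {n : ℕ} {D : Set (ℕ × ℕ)}

lemma topRow_eq (hD : IsBasic n D) {l c : ℕ} (h : (l, c) ∈ D) : topRow D c = l := by
  have h' : ∃ l, (l, c) ∈ D := ⟨l, h⟩
  rw [topRow, dif_pos h']
  exact congrArg Prod.fst (hD.2.2 _ h'.choose_spec _ h rfl)

lemma topRow_eq_self {c : ℕ} (h : ∀ l, (l, c) ∉ D) : topRow D c = c := by
  rw [topRow, dif_neg (by simpa using h)]

lemma le_topRow (hD : IsBasic n D) (c : ℕ) : c ≤ topRow D c := by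
  by_cases h : ∃ l, (l, c) ∈ D
  · obtain ⟨l, h⟩ := h
    rw [topRow_eq hD h]
    exact (hD.1 _ h).2.1.le
  · push Not at h
    rw [topRow_eq_self h]

lemma topRow_mem {c : ℕ} (h : topRow D c ≠ c) : (topRow D c, c) ∈ D := by
  rw [topRow] at h ⊢
  split_ifs at h ⊢ with h'
  · exact h'.choose_spec
  · exact absurd rfl h

lemma tauD_injOn (c : ℕ) : Set.InjOn (tauD n D c) (Set.Icc c n) := by
  induction c with
  | zero => exact fun a _ b _ h => h
  | succ c ih => exact stepTau_injOn ih

/-- Rows that already met `D` have small values, and the other rows are untouched. -/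
lemma tauD_spec (hD : IsBasic n D) (c : ℕ) : ∀ k, c ≤ k → k ≤ n →
    ((∃ m < c, (k, m) ∈ D) → tauD n D c k < c) ∧
    ((∀ m < c, (k, m) ∉ D) → tauD n D c k = k ∧
      (IsRecord n (tauD n D c) c (topRow D c) k ↔ (k, c) ∈ D)) ∧
    ((k, c) ∈ D → recordBound n (tauD n D c) c (topRow D c) k ≤ c) := by
  induction c with
  | zero =>
    intro k hk hkn
    have h0 : ∀ l, (l, 0) ∉ D := fun l h => by
      have := (hD.1 _ h).1
      simp at this
    refine ⟨by simp, fun _ => ⟨rfl, ?_⟩, fun h => absurd h (h0 k)⟩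
    rw [topRow_eq_self h0]
    simp only [h0, iff_false]
    rintro ⟨⟨h1, h2, h3⟩, -⟩
    omega
  | succ c ih =>
    have step : ∀ k, c + 1 ≤ k → k ≤ n →
        ((∃ m < c + 1, (k, m) ∈ D) → tauD n D (c + 1) k < c + 1) ∧
        ((∀ m < c + 1, (k, m) ∉ D) → tauD n D (c + 1) k = k) := by
      intro k hk hkn
      obtain ⟨i1, i2, i3⟩ := ih k (by omega) hkn
      constructor
      · rintro ⟨m, hm, hmD⟩
        rcases (Nat.lt_succ_iff.1 hm).eq_or_lt with rfl | hm
        · have hf : ∀ m' < m, (k, m') ∉ D := fun m' h1 h2 => by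
            have := congrArg Prod.snd (hD.2.1 _ h2 _ hmD rfl)
            simp only at this
            omega
          rw [tauD, stepTau, if_pos ((i2 hf).2.2 hmD)]
          have := i3 hmD
          omega
        · have := i1 ⟨m, hm, hmD⟩
          rw [tauD, stepTau]
          split_ifs with h
          · have := h.2
            omega
          · omega
      · intro h
        have hf := i2 fun m hm => h m (by omega)
        rw [tauD, stepTau, if_neg, hf.1]
        rw [hf.2]
        exact h c (by omega)
    intro k hk hkn
    refine ⟨(step k hk hkn).1, fun hf => ?_, ?_⟩
    · have hk' := (step k hk hkn).2 hf
      refine ⟨hk', ?_⟩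
      have hc : tauD n D (c + 1) (c + 1) ≤ c + 1 := by
        by_cases h : ∃ m < c + 1, (c + 1, m) ∈ D
        · exact ((step _ le_rfl (by omega)).1 h).le
        · push Not at h
          exact ((step _ le_rfl (by omega)).2 h).le
      constructor
      · rintro ⟨⟨h1, h2, h3⟩, h4⟩
        rw [hk'] at h2 h3 h4
        have hT : topRow D (c + 1) ≠ c + 1 := by omega
        have hTD := topRow_mem hT
        rcases h3.eq_or_lt with h5 | h5
        · rwa [h5]
        · exfalso
          have hTn := (hD.1 _ hTD).2.2
          simp only at hTn
          have hT' : tauD n D (c + 1) (topRow D (c + 1)) = topRow D (c + 1) := by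
            refine (step _ (by omega) hTn).2 fun m hm hmD => ?_
            have := congrArg Prod.snd (hD.2.1 _ hmD _ hTD rfl)
            simp only at this
            omega
          have := le_recordBound (n := n) (τ := tauD n D (c + 1)) (c := c + 1)
            (T := topRow D (c + 1)) h5 hTn ⟨by omega, by omega, by omega⟩
          omega
      · intro h
        have hck := (hD.1 _ h).2.1
        simp only at hck
        have hT := topRow_eq hD h
        refine ⟨⟨hck, by omega, by omega⟩, recordBound_lt_iff.2 ⟨by omega, fun b h1 h2 h3 => ?_⟩⟩
        have h4 := h3.2.2
        have : tauD n D (c + 1) b ≠ tauD n D (c + 1) k := fun h5 => by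
          have := tauD_injOn (n := n) (D := D) (c + 1) ⟨by omega, h2⟩ ⟨hk, hkn⟩ h5
          omega
        omega
    · intro h
      have hc : tauD n D (c + 1) (c + 1) ≤ c + 1 := by
        by_cases h : ∃ m < c + 1, (c + 1, m) ∈ D
        · exact ((step _ le_rfl (by omega)).1 h).le
        · push Not at h
          exact ((step _ le_rfl (by omega)).2 h).le
      have hT := topRow_eq hD h
      rw [← Nat.lt_succ_iff]
      refine recordBound_lt_iff.2 ⟨by omega, fun b h1 h2 h3 => ?_⟩
      have h4 := h3.2.2
      by_cases hb : ∃ m < c + 1, (b, m) ∈ D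
      · have := (step b (by omega) h2).1 hb
        omega
      · push Not at hb
        have := (step b (by omega) h2).2 hb
        omega

lemma tauD_lt (hD : IsBasic n D) {c k : ℕ} (hk : c ≤ k) (hkn : k ≤ n)
    (h : ∃ m < c, (k, m) ∈ D) : tauD n D c k < c :=
  (tauD_spec hD c k hk hkn).1 h

lemma tauD_eq (hD : IsBasic n D) {c k : ℕ} (hk : c ≤ k) (hkn : k ≤ n)
    (h : ∀ m < c, (k, m) ∉ D) : tauD n D c k = k :=
  ((tauD_spec hD c k hk hkn).2.1 h).1

lemma tauD_le (hD : IsBasic n D) {c k : ℕ} (hk : c ≤ k) (hkn : k ≤ n) : tauD n D c k ≤ k := by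
  by_cases h : ∃ m < c, (k, m) ∈ D
  · exact (tauD_lt hD hk hkn h).le.trans hk
  · push Not at h
    exact (tauD_eq hD hk hkn h).le

lemma isRecord_of_mem (hD : IsBasic n D) {c k : ℕ} (h : (k, c) ∈ D) :
    IsRecord n (tauD n D c) c (topRow D c) k := by
  have hk := hD.1 _ h
  refine (((tauD_spec hD c k hk.2.1.le hk.2.2).2.1 fun m hm hmD => ?_).2).2 h
  have := congrArg Prod.snd (hD.2.1 _ hmD _ h rfl)
  simp only at this
  omega

lemma exists_mem_of_isRecord (hD : IsBasic n D) {c k : ℕ} (hkn : k ≤ n)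
    (h : IsRecord n (tauD n D c) c (topRow D c) k) : ∃ m ≤ c, (k, m) ∈ D := by
  by_contra! hm
  exact hm c le_rfl
    (((tauD_spec hD c k h.1.1.le hkn).2.1 fun m h1 => hm m h1.le).2.1 h)

lemma mem_MD_iff_lt_tauD (hD : IsBasic n D) {c k : ℕ} (hc : 1 ≤ c) (hck : c < k) (hkn : k ≤ n) :
    (k, c) ∈ MD n D ↔ topRow D c < tauD n D c k := by
  rw [mem_MD_iff hD]
  have hT := le_topRow hD c
  constructor
  · rintro ⟨-, h2, h3⟩
    rw [tauD_eq hD hck.le hkn fun m hm => h2 m hm.le]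
    by_cases h : topRow D c = c
    · omega
    · by_contra h4
      exact h3 _ (not_lt.1 h4) (topRow_mem h)
  · intro h
    have hf : ∀ m < c, (k, m) ∉ D := fun m hm hmD => by
      have := tauD_lt hD hck.le hkn ⟨m, hm, hmD⟩
      omega
    rw [tauD_eq hD hck.le hkn hf] at h
    refine ⟨⟨hc, hck, hkn⟩, fun m hm => ?_, fun l hl hlD => ?_⟩
    · rcases hm.eq_or_lt with rfl | hm
      · intro h'
        rw [topRow_eq hD h'] at h
        omega
      · exact hf m hm
    · rw [topRow_eq hD hlD] at h
      omega

/-- The state reached by the diagram construction along a list of places. -/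
noncomputable def runState (s : MState) : List (ℕ × ℕ) → MState
  | [] => s
  | ξ :: rest => runState (if s ξ = none then markStep s ξ else s) rest

lemma runState_append (s : MState) (l₁ l₂ : List (ℕ × ℕ)) :
    runState s (l₁ ++ l₂) = runState (runState s l₁) l₂ := by
  induction l₁ generalizing s with
  | nil => rfl
  | cons ξ l ih => simp [runState, ih]

lemma diagRun_append (s : MState) (l₁ l₂ : List (ℕ × ℕ)) :
    diagRun s (l₁ ++ l₂) = diagRun s l₁ ++ diagRun (runState s l₁) l₂ := by
  induction l₁ generalizing s with
  | nil => rfl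
  | cons ξ l ih =>
    by_cases h : s ξ = none <;> simp [runState, diagRun, ih, h]

/-- The unmarked places when column `c` has been processed for all rows greater than `i`. -/
def ColumnState (n : ℕ) (D : Set (ℕ × ℕ)) (c i : ℕ) (s : MState) : Prop :=
  (∀ a, c < a → a ≤ i → (s (a, c) = none ↔ InWindow (tauD n D c) c (topRow D c) a ∧
    recordBound n (tauD n D c) c (topRow D c) i < tauD n D c a)) ∧
  ∀ a b, c < b → b < a → a ≤ n → (s (a, b) = none ↔ (a, b) ∉ MD n D ∧
    tauD n D c b < tauD n D c a ∧ ¬ (i < a ∧ IsRecord n (tauD n D c) c (topRow D c) a ∧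
      InWindow (tauD n D c) c (topRow D c) b ∧
      recordBound n (tauD n D c) c (topRow D c) a < tauD n D c b))

lemma ColumnState.unmarked_iff {c i : ℕ} {s : MState} (h : ColumnState n D c i s) (hci : c < i) :
    s (i, c) = none ↔ IsRecord n (tauD n D c) c (topRow D c) i :=
  h.1 i hci le_rfl

lemma recordBound_pred {τ : ℕ → ℕ} {c T i m : ℕ} (hi : 0 < i) (hin : i ≤ n) :
    recordBound n τ c T (i - 1) < m ↔
      recordBound n τ c T i < m ∧ (InWindow τ c T i → τ i < m) := by
  rw [recordBound_lt_iff, recordBound_lt_iff]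
  constructor
  · rintro ⟨h1, h2⟩
    exact ⟨⟨h1, fun b h3 => h2 b (by omega)⟩, h2 i (by omega) hin⟩
  · rintro ⟨⟨h1, h2⟩, h3⟩
    refine ⟨h1, fun b h4 h5 h6 => ?_⟩
    rcases Nat.lt_or_ge i b with h | h
    · exact h2 b h h5 h6
    · obtain rfl : b = i := by omega
      exact h3 h6

lemma ColumnState.step (hD : IsBasic n D) {c i : ℕ} {s : MState} (h : ColumnState n D c i s)
    (hci : c < i) (hin : i ≤ n) :
    ColumnState n D c (i - 1) (if s (i, c) = none then markStep s (i, c) else s) := by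
  by_cases hr : IsRecord n (tauD n D c) c (topRow D c) i
  · rw [if_pos ((h.unmarked_iff hci).2 hr)]
    obtain ⟨m, hmc, hmD⟩ := exists_mem_of_isRecord hD hin hr
    have hM : ∀ a, c < a → (i, a) ∉ MD n D := fun a ha h' =>
      ((mem_MD_iff hD).1 h').2.1 m (by omega) hmD
    refine ⟨fun a hca hai => ?_, fun a b hcb hba han => ?_⟩
    · have h1 : (a, c) ≠ (i, c) := by simp; omega
      have h2 := h.2 i a hca (by omega) hin
      have h3 := h.1 a hca (by omega)
      have h4 := recordBound_pred (τ := tauD n D c) (c := c) (T := topRow D c)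
        (m := tauD n D c a) (by omega) hin
      have h5 : tauD n D c a ≠ tauD n D c i := fun h6 => by
        have := tauD_injOn (n := n) (D := D) c ⟨by omega, by omega⟩ ⟨by omega, hin⟩ h6
        omega
      have h6 := hM a hca
      have h7 := hr.1
      simp only [lt_irrefl, false_and, not_false_eq_true, and_true, h6, true_and] at h2
      rw [h4]
      simp only [markStep, h1, if_false, hca, show a < i by omega, true_and, h2, h7,
        forall_true_left]
      by_cases h8 : s (a, c) = none
      · rw [h8]
        simp only [true_and]
        have h9 := h3.1 h8
        by_cases h10 : tauD n D c a < tauD n D c i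
        · simp only [h10, if_true]
          simp only [reduceCtorEq, false_iff]
          omega
        · simp only [h10, if_false, show a ≠ i by omega, false_and, true_iff]
          exact ⟨h9.1, h9.2, by omega⟩
      · simp only [h8, false_and, if_false, show a ≠ i by omega, false_iff]
        exact fun h9 => h8 (h3.2 ⟨h9.1, h9.2.1⟩)
    · have h1 : (a, b) ≠ (i, c) := by simp; omega
      have h2 := h.2 a b hcb hba han
      simp only [markStep, h1, if_false, show b ≠ c by omega, false_and]
      by_cases hai : a = i
      · subst hai
        have h3 := h.1 b hcb (by omega)
        simp only [lt_irrefl, false_and, not_false_eq_true, and_true] at h2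
        simp only [hcb, hba, true_and, hr, show a - 1 < a by omega]
        rw [← h3, ← and_assoc, ← h2]
        by_cases h4 : s (a, b) = none <;> by_cases h5 : s (b, c) = none <;> simp [h4, h5]
      · simp only [hai, false_and, if_false, h2]
        rw [show (i - 1 < a) ↔ (i < a) by omega]
  · rw [if_neg (fun h' => hr ((h.unmarked_iff hci).1 h'))]
    refine ⟨fun a hca hai => ?_, fun a b hcb hba han => ?_⟩
    · rw [h.1 a hca (by omega), recordBound_pred (by omega) hin]
      refine and_congr_right fun _ => (and_iff_left_of_imp fun h1 h2 => ?_).symm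
      have : ¬ recordBound n (tauD n D c) c (topRow D c) i < tauD n D c i := fun h3 => hr ⟨h2, h3⟩
      omega
    · rw [h.2 a b hcb hba han]
      by_cases hai : a = i
      · subst hai
        simp [hr]
      · rw [show (i - 1 < a) ↔ (i < a) by omega]

/-- The unmarked places before column `c` is processed. -/
def StartState (n : ℕ) (D : Set (ℕ × ℕ)) (c : ℕ) (s : MState) : Prop :=
  ∀ a b, c ≤ b → b < a → a ≤ n →
    (s (a, b) = none ↔ (a, b) ∉ MD n D ∧ tauD n D c b < tauD n D c a)

lemma StartState.columnState (hD : IsBasic n D) {c : ℕ} {s : MState} (hc : 1 ≤ c)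
    (h : StartState n D c s) : ColumnState n D c n s := by
  refine ⟨fun a hca han => ?_, fun a b hcb hba han => ?_⟩
  · rw [h a c le_rfl hca han, mem_MD_iff_lt_tauD hD hc hca han, recordBound_lt_iff, InWindow]
    refine ⟨fun ⟨h1, h2⟩ => ⟨⟨hca, h2, by omega⟩, h2, fun b h3 h4 => by omega⟩,
      fun h1 => ⟨?_, h1.2.1⟩⟩
    omega
  · rw [h a b hcb.le hba han]
    simp [show ¬ n < a by omega]

lemma ColumnState.startState {c : ℕ} {s : MState} (h : ColumnState n D c c s) :
    StartState n D (c + 1) s := by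
  intro a b hcb hba han
  rw [h.2 a b hcb hba han, tauD, stepTau_lt_stepTau_iff (tauD_injOn c) hcb hba han]
  simp [show c < a by omega]

/-- The places of column `c` in the first `m` rows from the bottom. -/
def columnList (n c m : ℕ) : List (ℕ × ℕ) :=
  (List.range m).filterMap fun k => if c < n - k then some (n - k, c) else none

lemma columnState_runState (hD : IsBasic n D) {c : ℕ} {s : MState} (hc : 1 ≤ c) (hcn : c ≤ n)
    (h : StartState n D c s) (m : ℕ) :
    ColumnState n D c (max (n - m) c) (runState s (columnList n c m)) ∧
    ∀ γ, γ ∈ (diagRun s (columnList n c m)).map Prod.fst ↔ γ.2 = c ∧ n < γ.1 + m ∧ γ.1 ≤ n ∧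
      IsRecord n (tauD n D c) c (topRow D c) γ.1 := by
  induction m with
  | zero =>
    refine ⟨by simpa [columnList, runState, hcn] using h.columnState hD hc, fun γ => ?_⟩
    simp only [columnList, List.range_zero, List.filterMap_nil, diagRun, List.map_nil,
      List.not_mem_nil, false_iff]
    omega
  | succ m ih =>
    obtain ⟨ih1, ih2⟩ := ih
    by_cases hm : c < n - m
    · have hl : columnList n c (m + 1) = columnList n c m ++ [(n - m, c)] := by
        simp [columnList, List.range_succ, hm]
      rw [show max (n - m) c = n - m by omega] at ih1
      rw [hl, runState_append, diagRun_append, show max (n - (m + 1)) c = n - m - 1 by omega]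
      refine ⟨ih1.step hD hm (by omega), fun γ => ?_⟩
      rw [List.map_append, List.mem_append, ih2]
      have h1 := ih1.unmarked_iff hm
      have h2 : γ ∈ (diagRun (runState s (columnList n c m)) [(n - m, c)]).map Prod.fst ↔
          γ = (n - m, c) ∧ IsRecord n (tauD n D c) c (topRow D c) (n - m) := by
        simp only [diagRun, h1]
        split_ifs with h3 <;> simp [h3]
      rw [h2]
      obtain ⟨a, b⟩ := γ
      simp only [Prod.mk.injEq]
      constructor
      · rintro (h3 | ⟨⟨rfl, rfl⟩, h3⟩)
        · exact ⟨h3.1, by omega, h3.2.2⟩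
        · exact ⟨rfl, by omega, by omega, h3⟩
      · rintro ⟨rfl, h3, h4, h5⟩
        by_cases h6 : a = n - m
        · subst h6
          exact Or.inr ⟨⟨rfl, rfl⟩, h5⟩
        · exact Or.inl ⟨rfl, by omega, h4, h5⟩
    · have hl : columnList n c (m + 1) = columnList n c m := by
        simp [columnList, List.range_succ, hm]
      rw [hl, show max (n - (m + 1)) c = max (n - m) c by omega]
      refine ⟨ih1, fun γ => ?_⟩
      rw [ih2]
      refine and_congr_right fun _ => ⟨fun h1 => ⟨by omega, h1.2⟩, fun h1 => ⟨?_, h1.2⟩⟩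
      have := h1.2.2.1.1
      omega

lemma startState_initMark (hD : IsBasic n D) : StartState n D 1 (initMark n D) := by
  intro a b hb hba han
  have h0 : ∀ l, (l, 0) ∉ D := fun l h => by
    have := (hD.1 _ h).1
    simp at this
  have h1 : ∀ k, tauD n D 1 k = k := fun k => by
    rw [tauD, stepTau, if_neg]
    · rfl
    · rw [topRow_eq_self h0]
      rintro ⟨⟨h1, h2, h3⟩, -⟩
      omega
  simp [initMark, h1, hba]

lemma startState_runState (hD : IsBasic n D) (c : ℕ) (hcn : c ≤ n) :
    StartState n D (c + 1) (runState (initMark n D)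
      ((List.range c).flatMap fun j => columnList n (j + 1) n)) ∧
    ∀ γ, γ ∈ (diagRun (initMark n D)
      ((List.range c).flatMap fun j => columnList n (j + 1) n)).map Prod.fst ↔
      1 ≤ γ.2 ∧ γ.2 ≤ c ∧ γ.1 ≤ n ∧
        IsRecord n (tauD n D γ.2) γ.2 (topRow D γ.2) γ.1 := by
  induction c with
  | zero =>
    refine ⟨startState_initMark hD, fun γ => ?_⟩
    simp only [List.range_zero, List.flatMap_nil, diagRun, List.map_nil, List.not_mem_nil,
      false_iff]
    omega
  | succ c ih =>
    obtain ⟨ih1, ih2⟩ := ih (by omega)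
    obtain ⟨h1, h2⟩ := columnState_runState hD (by omega) hcn ih1 n
    rw [show max (n - n) (c + 1) = c + 1 by omega] at h1
    rw [List.range_succ, List.flatMap_append, List.flatMap_singleton, runState_append,
      diagRun_append]
    refine ⟨h1.startState, fun γ => ?_⟩
    rw [List.map_append, List.mem_append, ih2, h2]
    constructor
    · rintro (h | ⟨h3, h4, h5, h6⟩)
      · exact ⟨h.1, by omega, h.2.2⟩
      · rw [h3]
        exact ⟨by omega, by omega, h5, h6⟩
    · rintro ⟨h3, h4, h5, h6⟩
      by_cases h7 : γ.2 = c + 1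
      · refine Or.inr ⟨h7, ?_, h5, h7 ▸ h6⟩
        have := h6.1.1
        omega
      · exact Or.inl ⟨h3, by omega, h5, h6⟩

lemma mem_CD_iff (hD : IsBasic n D) {k c : ℕ} :
    (k, c) ∈ CD n D ↔ 1 ≤ c ∧ k ≤ n ∧ IsRecord n (tauD n D c) c (topRow D c) k := by
  have h := (startState_runState hD n le_rfl).2 (k, c)
  have hl : rootList n = (List.range n).flatMap fun j => columnList n (j + 1) n := rfl
  rw [CD, Set.mem_ofPred_eq, diagSeq, hl, h]
  refine and_congr_right fun _ => ⟨fun h1 => h1.2, fun h1 => ⟨?_, h1⟩⟩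
  have := h1.2.1.1
  simp only
  omega

end Diagram

/-! ### Radicals of alternating forms -/

section Radical

variable {L V : Type} [Field L] [AddCommGroup V] [Module L V]

/-- The radical of the restriction of `B` to the subspace `W`. -/
def radOn (B : V →ₗ[L] V →ₗ[L] L) (W : Submodule L V) : Submodule L V where
  carrier := {u | u ∈ W ∧ ∀ v ∈ W, B u v = 0}
  add_mem' := fun ha hb => ⟨W.add_mem ha.1 hb.1, fun v hv => by simp [ha.2 v hv, hb.2 v hv]⟩
  zero_mem' := ⟨W.zero_mem, by simp⟩
  smul_mem' := fun r x hx => ⟨W.smul_mem r hx.1, fun v hv => by simp [hx.2 v hv]⟩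

/-- The elements of `G` orthogonal to `A`. -/
def orthIn (B : V →ₗ[L] V →ₗ[L] L) (A G : Submodule L V) : Submodule L V where
  carrier := {g | g ∈ G ∧ ∀ a ∈ A, B a g = 0}
  add_mem' := fun ha hb => ⟨G.add_mem ha.1 hb.1, fun v hv => by simp [ha.2 v hv, hb.2 v hv]⟩
  zero_mem' := ⟨G.zero_mem, by simp⟩
  smul_mem' := fun r x hx => ⟨G.smul_mem r hx.1, fun v hv => by simp [hx.2 v hv]⟩

lemma mem_radOn {B : V →ₗ[L] V →ₗ[L] L} {W : Submodule L V} {u : V} :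
    u ∈ radOn B W ↔ u ∈ W ∧ ∀ v ∈ W, B u v = 0 := Iff.rfl

/-- Adjoining an isotropic subspace changes the dimension of the radical in a controlled way. -/
lemma finrank_radOn_sup [FiniteDimensional L V] (B : V →ₗ[L] V →ₗ[L] L) (hB : B.IsAlt)
    {A G : Submodule L V} (hA : ∀ a ∈ A, ∀ a' ∈ A, B a a' = 0) (hAG : Disjoint A G) :
    Module.finrank L (radOn B (A ⊔ G)) + Module.finrank L G =
      Module.finrank L (radOn B (orthIn B A G)) + Module.finrank L A +
        Module.finrank L (orthIn B A G) := by
  set R := radOn B (orthIn B A G) with hR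
  have hRG : ∀ r ∈ R, r ∈ G := fun r hr => hr.1.1
  have hRA : ∀ r ∈ R, ∀ a ∈ A, B a r = 0 := fun r hr => hr.1.2
  let ψ : A →ₗ[L] Module.Dual L G := B.domRestrict₁₂ A G
  let θ : (A × R) →ₗ[L] Module.Dual L G := ψ.coprod (B.domRestrict₁₂ R G)
  have hθ : ∀ (a : A) (r : R) (g : G), θ (a, r) g = B a g + B r g := fun a r g => rfl
  have hψ : ∀ (a : A) (g : G), ψ a g = B a g := fun a g => rfl
  have hco : (LinearMap.range ψ).dualCoannihilator = (orthIn B A G).comap G.subtype := by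
    ext g
    rw [Submodule.mem_dualCoannihilator]
    constructor
    · intro h
      exact ⟨g.2, fun a ha => h (ψ ⟨a, ha⟩) ⟨_, rfl⟩⟩
    · rintro h _ ⟨a, rfl⟩
      exact h.2 a a.2
  have hdim : Module.finrank L (LinearMap.range ψ) + Module.finrank L (orthIn B A G) =
      Module.finrank L G := by
    rw [← Subspace.finrank_add_finrank_dualCoannihilator_eq (LinearMap.range ψ), hco,
      (Submodule.comapSubtypeEquivOfLe (show orthIn B A G ≤ G from fun _ h => h.1)).finrank_eq]
  have hrange : LinearMap.range θ = LinearMap.range ψ := by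
    apply le_antisymm
    · rintro _ ⟨⟨a, r⟩, rfl⟩
      rw [LinearMap.coprod_apply]
      refine Submodule.add_mem _ ⟨a, rfl⟩ ?_
      rw [← Subspace.dualCoannihilator_dualAnnihilator_eq (W := LinearMap.range ψ),
        Submodule.mem_dualAnnihilator]
      intro g hg
      rw [hco] at hg
      exact r.2.2 g hg
    · rintro _ ⟨a, rfl⟩
      exact ⟨(a, 0), by simp [θ]⟩
  let σ : (A × R) →ₗ[L] V := A.subtype.coprod R.subtype
  have hσ : Function.Injective σ := by
    rw [← LinearMap.ker_eq_bot, LinearMap.ker_eq_bot']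
    rintro ⟨a, r⟩ h
    have h1 : (a : V) + r = 0 := h
    have h2 : (a : V) ∈ G := by
      rw [eq_neg_of_add_eq_zero_left h1]
      exact G.neg_mem (hRG r r.2)
    have h3 : (a : V) = 0 := Submodule.disjoint_def.1 hAG a a.2 h2
    rw [h3, zero_add] at h1
    ext <;> simp [h3, h1]
  have hrad : radOn B (A ⊔ G) = (LinearMap.ker θ).map σ := by
    ext u
    rw [Submodule.mem_map, mem_radOn]
    constructor
    · rintro ⟨hu, h⟩
      obtain ⟨a, ha, g, hg, rfl⟩ := Submodule.mem_sup.1 hu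
      have hg1 : g ∈ orthIn B A G := by
        refine ⟨hg, fun a' ha' => ?_⟩
        have := h a' (Submodule.mem_sup_left ha')
        rw [map_add, LinearMap.add_apply, hA a ha a' ha', zero_add] at this
        rw [← hB.neg, this, neg_zero]
      have hg2 : g ∈ R := by
        refine ⟨hg1, fun v hv => ?_⟩
        have := h v (Submodule.mem_sup_right hv.1)
        rwa [map_add, LinearMap.add_apply, hv.2 a ha, zero_add] at this
      refine ⟨(⟨a, ha⟩, ⟨g, hg2⟩), ?_, rfl⟩
      rw [LinearMap.mem_ker]
      ext v
      rw [hθ]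
      simpa using h v (Submodule.mem_sup_right v.2)
    · rintro ⟨⟨a, r⟩, h, rfl⟩
      rw [LinearMap.mem_ker] at h
      have hs : σ (a, r) = (a : V) + r := rfl
      rw [hs]
      refine ⟨Submodule.add_mem_sup a.2 (hRG r r.2), fun v hv => ?_⟩
      obtain ⟨a', ha', g', hg', rfl⟩ := Submodule.mem_sup.1 hv
      have h1 := LinearMap.congr_fun h ⟨g', hg'⟩
      rw [hθ] at h1
      have h2 : B r a' = 0 := by rw [← hB.neg, hRA r r.2 a' ha', neg_zero]
      simp only [map_add, LinearMap.add_apply, hA a a.2 a' ha', h2, add_zero, zero_add]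
      simpa using h1
  have hker := LinearMap.finrank_range_add_finrank_ker θ
  rw [hrange, Module.finrank_prod] at hker
  rw [hrad, ← (Submodule.equivMapOfInjective σ hσ (LinearMap.ker θ)).finrank_eq]
  omega

/-- Radicals are transported by isometries. -/
lemma finrank_radOn_map {B B' : V →ₗ[L] V →ₗ[L] L} (e : V ≃ₗ[L] V)
    (h : ∀ u v, B' (e u) (e v) = B u v) (W : Submodule L V) :
    Module.finrank L (radOn B' (W.map (e : V →ₗ[L] V))) = Module.finrank L (radOn B W) := by
  have : radOn B' (W.map (e : V →ₗ[L] V)) = (radOn B W).map (e : V →ₗ[L] V) := by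
    ext u
    constructor
    · rintro ⟨⟨w, hw, rfl⟩, h2⟩
      exact ⟨w, ⟨hw, fun v hv => by rw [← h]; exact h2 _ ⟨v, hv, rfl⟩⟩, rfl⟩
    · rintro ⟨w, ⟨hw, h2⟩, rfl⟩
      refine ⟨⟨w, hw, rfl⟩, ?_⟩
      rintro _ ⟨v, hv, rfl⟩
      exact (h w v).trans (h2 v hv)
  rw [this]
  exact (e.submoduleMap _).finrank_eq.symm

end Radical

/-! ### The commutator form on upper triangular matrices -/

section CommForm

variable {n : ℕ} {L : Type} [Field L]

/-- The form `(u, v) ↦ tr (X (uv - vu))`. -/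
noncomputable def commForm (X : Matrix (Fin n) (Fin n) L) :
    Matrix (Fin n) (Fin n) L →ₗ[L] Matrix (Fin n) (Fin n) L →ₗ[L] L :=
  LinearMap.mk₂ L (fun u v => (X * (u * v - v * u)).trace)
    (fun u u' v => by rw [← Matrix.trace_add]; congr 1; noncomm_ring)
    (fun r u v => by simp [← smul_sub, Matrix.trace_smul])
    (fun u v v' => by rw [← Matrix.trace_add]; congr 1; noncomm_ring)
    (fun r u v => by simp [← smul_sub, Matrix.trace_smul])

lemma commForm_apply (X u v : Matrix (Fin n) (Fin n) L) :
    commForm X u v = (X * (u * v - v * u)).trace := rfl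

lemma commForm_isAlt (X : Matrix (Fin n) (Fin n) L) : (commForm X).IsAlt := fun u => by
  simp [commForm_apply]

/-- The matrices supported at the places `(b, a)` with `S a b`. -/
def supported (L : Type) [Field L] (S : Fin n → Fin n → Prop) :
    Submodule L (Matrix (Fin n) (Fin n) L) where
  carrier := {u | ∀ b a, u b a ≠ 0 → S a b}
  add_mem' := fun {u v} hu hv b a h => by
    by_cases hub : u b a = 0
    · exact hv b a fun h' => h (by simp [hub, h'])
    · exact hu b a hub
  zero_mem' := fun b a h => absurd rfl h
  smul_mem' := fun r u hu b a h => hu b a fun h' => h (by simp [h'])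

lemma finrank_supported (S : Fin n → Fin n → Prop) :
    Module.finrank L (supported L S) =
      (Finset.univ.filter fun p : Fin n × Fin n => S p.1 p.2).card := by
  let e : supported L S ≃ₗ[L] ({p : Fin n × Fin n // S p.1 p.2} → L) :=
    { toFun := fun u p => u.1 p.1.2 p.1.1
      map_add' := fun _ _ => rfl
      map_smul' := fun _ _ => rfl
      invFun := fun f => ⟨fun b a => if h : S a b then f ⟨(a, b), h⟩ else 0, fun b a h => by
        by_contra h'
        exact h (dif_neg h')⟩
      left_inv := fun u => by
        ext b a
        change (if h : S a b then u.1 b a else 0) = u.1 b a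
        split_ifs with h
        · rfl
        · by_contra h'
          exact h (u.2 b a (Ne.symm h'))
      right_inv := fun f => by
        ext ⟨p, hp⟩
        exact dif_pos hp }
  rw [e.finrank_eq, Module.finrank_fintype_fun_eq_card, Fintype.card_subtype]

/-- Conjugation by an invertible matrix as a linear equivalence. -/
noncomputable def conjEquiv (g : Matrix (Fin n) (Fin n) L) (hg : IsUnit g.det) :
    Matrix (Fin n) (Fin n) L ≃ₗ[L] Matrix (Fin n) (Fin n) L where
  toFun u := g * u * g⁻¹
  invFun u := g⁻¹ * u * g
  map_add' u v := by noncomm_ring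
  map_smul' r u := by simp
  left_inv u := by
    simp only [Matrix.mul_assoc, Matrix.nonsing_inv_mul_cancel_left _ _ hg,
      Matrix.nonsing_inv_mul g hg,
      mul_one]
  right_inv u := by
    simp only [Matrix.mul_assoc, Matrix.mul_nonsing_inv_cancel_left _ _ hg,
      Matrix.mul_nonsing_inv g hg,
      mul_one]

lemma commForm_conj (g X u v : Matrix (Fin n) (Fin n) L) (hg : IsUnit g.det) :
    commForm X (g * u * g⁻¹) (g * v * g⁻¹) = commForm (g⁻¹ * X * g) u v := by
  rw [commForm_apply, commForm_apply]
  have h : ∀ u v : Matrix (Fin n) (Fin n) L, g * u * g⁻¹ * (g * v * g⁻¹) = g * (u * v) * g⁻¹ := by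
    intro u v
    simp only [Matrix.mul_assoc, Matrix.nonsing_inv_mul_cancel_left _ _ hg]
  rw [h, h, ← sub_mul, ← mul_sub, ← mul_assoc, ← mul_assoc, Matrix.trace_mul_comm]
  simp only [mul_assoc]

lemma finrank_radOn_conj (g X : Matrix (Fin n) (Fin n) L) (hg : IsUnit g.det)
    (W : Submodule L (Matrix (Fin n) (Fin n) L)) :
    Module.finrank L (radOn (commForm X) (W.map (conjEquiv g hg : _ →ₗ[L] _))) =
      Module.finrank L (radOn (commForm (g⁻¹ * X * g)) W) :=
  finrank_radOn_map (conjEquiv g hg) (fun u v => commForm_conj g X u v hg) W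

end CommForm

/-! ### One column of the radical computation -/

section Stage

variable {n : ℕ} {L : Type} [Field L]

lemma isUnit_det_of_upper {g : Matrix (Fin n) (Fin n) L} (hg : g.BlockTriangular id)
    (hd : ∀ i, g i i ≠ 0) : IsUnit g.det := by
  rw [Matrix.det_of_isUpperTriangular hg, isUnit_iff_ne_zero]
  exact Finset.prod_ne_zero_iff.2 fun i _ => hd i

lemma upper_inv {g : Matrix (Fin n) (Fin n) L} (hg : g.BlockTriangular id) (hu : IsUnit g.det) :
    g⁻¹.BlockTriangular id := by
  have := Matrix.invertibleOfIsUnitDet g hu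
  exact Matrix.blockTriangular_inv_of_blockTriangular hg

/-- The increasing pairs of values in the columns from `c` on. -/
def IncPair (τ : ℕ → ℕ) (c : ℕ) (a b : Fin n) : Prop :=
  c ≤ (b : ℕ) + 1 ∧ b < a ∧ τ (b + 1) < τ (a + 1)

variable (τ : ℕ → ℕ) (c : Fin n) (T : ℕ) (y : Fin n → L)

/-- The part of the vector `y` at the window rows with values greater than `s`. -/
noncomputable def windowVec (s : ℕ) (k : Fin n) : L :=
  if InWindow τ (c + 1) T (k + 1) ∧ s < τ (k + 1) then y k else 0

/-- The change of basis attached to column `c`: records are replaced by tails of `y`. -/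
noncomputable def recordMat : Matrix (Fin n) (Fin n) L := fun k a =>
  if IsRecord n τ (c + 1) T (a + 1) then
    windowVec τ c T y (recordBound n τ (c + 1) T (a + 1)) k
  else if k = a then 1 else 0

variable {τ c T y}

lemma recordMat_upper : (recordMat τ c T y).BlockTriangular id := by
  intro k a hak
  simp only [id] at hak
  unfold recordMat windowVec
  split_ifs with h1 h2 h3
  · exact absurd (le_recordBound (n := n) (k := a + 1) (by omega) (by omega) h2.1) (by omega)
  · rfl
  · exact absurd h3 (by omega)
  · rfl

lemma recordMat_diag (hy : ∀ k : Fin n, IsRecord n τ (c + 1) T (k + 1) → y k ≠ 0) (a : Fin n) :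
    recordMat τ c T y a a ≠ 0 := by
  unfold recordMat windowVec
  split_ifs with h1 h2 h2
  · exact hy a h1
  · exact absurd ⟨h1.1, h1.2⟩ h2
  · exact one_ne_zero
  · exact absurd rfl h2

lemma recordMat_isUnit (hy : ∀ k : Fin n, IsRecord n τ (c + 1) T (k + 1) → y k ≠ 0) :
    IsUnit (recordMat τ c T y).det :=
  isUnit_det_of_upper recordMat_upper (recordMat_diag hy)

lemma exists_windowVec_eq {s : ℕ}
    (hs : s = τ (c + 1) ∨ ∃ a : Fin n, IsRecord n τ (c + 1) T (a + 1) ∧ s = τ (a + 1)) :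
    windowVec τ c T y s = 0 ∨ ∃ b : Fin n, IsRecord n τ (c + 1) T (b + 1) ∧
      recordBound n τ (c + 1) T (b + 1) = s ∧ s < τ (b + 1) := by
  let F : Finset (Fin n) := Finset.univ.filter fun k =>
    InWindow τ (c + 1) T (k + 1) ∧ s < τ (k + 1)
  by_cases hF : F.Nonempty
  · right
    have hmem := F.max'_mem hF
    set b := F.max' hF with hb
    simp only [F, Finset.mem_filter, Finset.mem_univ, true_and] at hmem
    have hlt : ∀ d : ℕ, (b : ℕ) + 1 < d → d ≤ n → InWindow τ (c + 1) T d → τ d ≤ s := by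
      intro d h1 h2 h3
      by_contra h4
      obtain ⟨e, rfl⟩ : ∃ e, d = e + 1 := ⟨d - 1, by omega⟩
      have : (⟨e, by omega⟩ : Fin n) ≤ b := F.le_max' _ (by
        simp only [F, Finset.mem_filter, Finset.mem_univ, true_and]
        exact ⟨h3, by omega⟩)
      rw [Fin.le_def] at this
      simp only at this
      omega
    have hle : recordBound n τ (c + 1) T (b + 1) = s := by
      apply le_antisymm
      · rw [← Nat.lt_succ_iff]
        refine recordBound_lt_iff.2 ⟨?_, fun d h1 h2 h3 => Nat.lt_succ_iff.2 (hlt d h1 h2 h3)⟩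
        rcases hs with rfl | ⟨a, ha, rfl⟩
        · exact Nat.lt_succ_self _
        · exact ha.1.2.1.trans (Nat.lt_succ_self _)
      · rcases hs with rfl | ⟨a, ha, rfl⟩
        · exact le_recordBound_left _
        · refine le_recordBound ?_ a.2 ha.1
          by_contra h
          rcases eq_or_lt_of_le (not_lt.1 h) with h' | h'
          · rw [h'] at hmem
            omega
          · have := ha.lt h' b.2 hmem.1
            omega
    exact ⟨b, ⟨hmem.1, by omega⟩, hle, hmem.2⟩
  · left
    ext k
    simp only [windowVec, Pi.zero_apply, ite_eq_right_iff]
    intro h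
    exact absurd ⟨k, by simpa [F] using h⟩ hF

/-- Images of the new basis vectors under transported matrices. -/
lemma support_mul_recordMat (hτ : Set.InjOn τ (Set.Icc (c + 1) n))
    (hy : ∀ k : Fin n, IsRecord n τ (c + 1) T (k + 1) → y k ≠ 0)
    {w : Matrix (Fin n) (Fin n) L}
    (hw : w ∈ supported L (IncPair (stepTau n τ (c + 1) T) (c + 2))) (k a : Fin n)
    (h : (recordMat τ c T y * w) k a ≠ 0) :
    c < k ∧ k < a ∧ τ (k + 1) < stepTau n τ (c + 1) T (a + 1) := by
  have hsupp : ∀ k a, (recordMat τ c T y * w) k a ≠ 0 → c < k ∧ k < a := by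
    intro k a h
    rw [Matrix.mul_apply] at h
    obtain ⟨b, -, hb⟩ := Finset.exists_ne_zero_of_sum_ne_zero h
    have h1 := hw b a (right_ne_zero_of_mul hb)
    have h2 := left_ne_zero_of_mul hb
    obtain ⟨h3, h4, -⟩ := h1
    have hkb : k ≤ b := by
      by_contra hlt
      exact h2 (recordMat_upper (not_le.1 hlt))
    refine ⟨?_, by omega⟩
    unfold recordMat windowVec at h2
    split_ifs at h2 with h5 h6 h7
    · have := h6.1.1
      omega
    · exact absurd rfl h2
    · omega
    · exact absurd rfl h2
  set lam : L := ∑ b : Fin n, if IsRecord n τ (c + 1) T (b + 1) then w b a else 0 with hlam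
  have hval : ∀ k : Fin n, stepTau n τ (c + 1) T (a + 1) ≤ τ (k + 1) →
      (recordMat τ c T y * w) k a = if InWindow τ (c + 1) T (k + 1) then lam * y k else 0 := by
    intro k hk
    have hsum : ∀ b : Fin n, recordMat τ c T y k b * w b a =
        if InWindow τ (c + 1) T (k + 1) then
          (if IsRecord n τ (c + 1) T (b + 1) then w b a else 0) * y k else 0 := by
      intro b
      by_cases hb : w b a = 0
      · simp [hb]
      · have h1 := (hw b a hb).2.2
        unfold recordMat windowVec
        by_cases h2 : IsRecord n τ (c + 1) T (b + 1)
        · rw [stepTau, if_pos h2] at h1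
          have h3 : recordBound n τ (c + 1) T (b + 1) < τ (k + 1) := by omega
          simp only [h2, h3, and_true, if_true]
          split_ifs
          · ring
          · ring
        · have h3 : k ≠ b := by
            rintro rfl
            rw [stepTau, if_neg h2] at h1
            omega
          simp [h2, h3]
    rw [Matrix.mul_apply, Finset.sum_congr rfl fun b _ => hsum b]
    split_ifs with hk'
    · rw [hlam, Finset.sum_mul]
    · simp
  have hc := hsupp k a h
  refine ⟨hc.1, hc.2, ?_⟩
  by_contra hge
  rw [not_lt] at hge
  have hv := hval k hge
  rw [hv] at h
  split_ifs at h with hk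
  swap
  · exact h rfl
  have hl0 : lam ≠ 0 := left_ne_zero_of_mul h
  have key : ∀ b : Fin n, stepTau n τ (c + 1) T (a + 1) ≤ τ (b + 1) →
      IsRecord n τ (c + 1) T (b + 1) → a ≤ b → False := by
    intro b h1 h2 h3
    have h4 := hval b h1
    rw [if_pos h2.1] at h4
    have h5 := hsupp b a (h4 ▸ mul_ne_zero hl0 (hy b h2))
    omega
  by_cases hr : IsRecord n τ (c + 1) T (a + 1)
  · refine key a ?_ hr le_rfl
    rw [stepTau, if_pos hr]
    exact hr.2.le
  · rw [stepTau, if_neg hr] at hge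
    by_cases hq : InWindow τ (c + 1) T (a + 1)
    · obtain ⟨b, h1, h2, h3, h4, h5⟩ := exists_record_above hτ hq a.2 hr
      obtain ⟨e, rfl⟩ : ∃ e, b = e + 1 := ⟨b - 1, by omega⟩
      refine key ⟨e, by omega⟩ ?_ h3 (by rw [Fin.le_def]; simp only; omega)
      rw [stepTau, if_neg hr]
      exact h5.le
    · have hac : τ (a + 1) ≤ τ (c + 1) := by
        by_contra h1
        refine hq ⟨by omega, by omega, ?_⟩
        have := hk.2.2
        omega
      apply hl0
      rw [hlam]
      refine Finset.sum_eq_zero fun b _ => ?_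
      split_ifs with hb
      · by_contra h1
        have h2 := (hw b a h1).2.2
        rw [stepTau, if_pos hb, stepTau, if_neg hr] at h2
        have := le_recordBound_left (n := n) (τ := τ) (c := c + 1) (T := T) (b + 1)
        omega
      · rfl

/-- The matrices with `(u y)_k = 0` in the rows whose value exceeds that of `c`. -/
def annihilating (τ : ℕ → ℕ) (c : Fin n) (y : Fin n → L) :
    Submodule L (Matrix (Fin n) (Fin n) L) where
  carrier := {u | u ∈ supported L (IncPair τ (c + 2)) ∧
    ∀ k : Fin n, c < k → τ (c + 1) < τ (k + 1) → u.mulVec y k = 0}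
  add_mem' := fun ha hb => ⟨Submodule.add_mem _ ha.1 hb.1, fun k h1 h2 => by
    simp [Matrix.add_mulVec, ha.2 k h1 h2, hb.2 k h1 h2]⟩
  zero_mem' := ⟨Submodule.zero_mem _, by simp⟩
  smul_mem' := fun r u hu => ⟨Submodule.smul_mem _ _ hu.1, fun k h1 h2 => by
    simp [Matrix.smul_mulVec, hu.2 k h1 h2]⟩

lemma map_conj_le_annihilating (hτ : Set.InjOn τ (Set.Icc (c + 1) n))
    (hy : ∀ k : Fin n, IsRecord n τ (c + 1) T (k + 1) → y k ≠ 0)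
    (hy0 : ∀ k : Fin n, c < k → T < τ (k + 1) → y k = 0) :
    (supported (n := n) L (IncPair (stepTau n τ (c + 1) T) (c + 2))).map
      (conjEquiv (recordMat τ c T y) (recordMat_isUnit hy) : _ →ₗ[L] _) ≤
      annihilating τ c y := by
  rintro _ ⟨w, hw, rfl⟩
  set g := recordMat τ c T y with hg
  have hgu : IsUnit g.det := recordMat_isUnit hy
  change g * w * g⁻¹ ∈ _
  set u := g * w * g⁻¹ with hu
  have hug : u * g = g * w := by
    rw [hu, Matrix.mul_assoc, Matrix.nonsing_inv_mul g hgu, mul_one]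
  have hcol : ∀ a : Fin n, u.mulVec (fun k => g k a) = fun k => (g * w) k a := by
    intro a
    rw [← hug]
    rfl
  have hS : ∀ a : Fin n, ∀ k, u.mulVec (fun k => g k a) k ≠ 0 →
      c < k ∧ k < a ∧ τ (k + 1) < stepTau n τ (c + 1) T (a + 1) := by
    intro a k h
    rw [hcol] at h
    exact support_mul_recordMat hτ hy hw k a h
  have hwin : ∀ b : Fin n, IsRecord n τ (c + 1) T (b + 1) →
      (fun k => g k b) = windowVec τ c T y (recordBound n τ (c + 1) T (b + 1)) := by
    intro b hb
    ext k
    rw [hg, recordMat, if_pos hb]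
  have hunit : ∀ a : Fin n, u.mulVec (Pi.single a 1) = fun k => u k a := by
    intro a
    ext k
    simp
  have hnon : ∀ a : Fin n, ¬ IsRecord n τ (c + 1) T (a + 1) → ∀ k, u k a ≠ 0 →
      c < k ∧ k < a ∧ τ (k + 1) < τ (a + 1) := by
    intro a ha k hk
    have h1 : (fun k => g k a) = Pi.single a 1 := by
      ext k
      rw [hg, recordMat, if_neg ha, Pi.single_apply]
    have h2 := hS a k (by rw [h1, hunit]; exact hk)
    rwa [stepTau, if_neg ha] at h2
  have hwindow : ∀ s, (s = τ (c + 1) ∨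
      ∃ a : Fin n, IsRecord n τ (c + 1) T (a + 1) ∧ s = τ (a + 1)) →
      ∀ k, u.mulVec (windowVec τ c T y s) k ≠ 0 → c < k ∧ τ (k + 1) < s ∧
        ∃ b : Fin n, IsRecord n τ (c + 1) T (b + 1) ∧ s < τ (b + 1) ∧ k < b := by
    intro s hs k hk
    rcases exists_windowVec_eq (y := y) hs with h | ⟨b, h1, h2, h3⟩
    · rw [h, Matrix.mulVec_zero] at hk
      exact absurd rfl hk
    · have h4 := hS b k (by rw [hwin b h1, h2]; exact hk)
      rw [stepTau, if_pos h1, h2] at h4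
      exact ⟨h4.1, h4.2.2, b, h1, h3, h4.2.1⟩
  have hall : ∀ a k, u k a ≠ 0 → c < k ∧ k < a ∧ τ (k + 1) < τ (a + 1) := by
    intro a k hk
    by_cases ha : IsRecord n τ (c + 1) T (a + 1)
    swap
    · exact hnon a ha k hk
    set rest : Fin n → L := fun m => if InWindow τ (c + 1) T (m + 1) ∧
      recordBound n τ (c + 1) T (a + 1) < τ (m + 1) ∧ τ (m + 1) < τ (a + 1) then y m else 0
      with hrest
    have hdec : windowVec τ c T y (recordBound n τ (c + 1) T (a + 1)) =
        y a • Pi.single a 1 + windowVec τ c T y (τ (a + 1)) + rest := by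
      ext m
      simp only [Pi.add_apply, Pi.smul_apply, Pi.single_apply, smul_eq_mul, mul_ite, mul_one,
        mul_zero, windowVec, hrest]
      by_cases hma : m = a
      · subst hma
        simp [ha.1, ha.2]
      · by_cases hm : InWindow τ (c + 1) T (m + 1)
        · have h1 : τ (m + 1) ≠ τ (a + 1) := fun h => by
            have := hτ ⟨by have := hm.1; omega, m.2⟩ ⟨by have := ha.1.1; omega, a.2⟩ h
            omega
          have h2 := ha.2
          simp only [hm, hma, true_and, if_false, zero_add]
          rcases lt_or_gt_of_ne h1 with h3 | h3
          · simp [h3, not_lt.2 h3.le]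
          · simp [h3, not_lt.2 h3.le, h2.trans h3]
        · simp [hm, hma]
    have hrestk : ∀ m, u.mulVec rest m ≠ 0 → c < m ∧ m < a ∧ τ (m + 1) < τ (a + 1) := by
      intro m hm
      simp only [Matrix.mulVec, dotProduct] at hm
      obtain ⟨d, -, hd⟩ := Finset.exists_ne_zero_of_sum_ne_zero hm
      have h1 := right_ne_zero_of_mul hd
      simp only [hrest, ne_eq, ite_eq_right_iff, not_forall] at h1
      obtain ⟨⟨h2, h3, h4⟩, -⟩ := h1
      have hda : d < a := by
        by_contra h5
        rcases eq_or_lt_of_le (not_lt.1 h5) with h6 | h6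
        · rw [h6] at h4
          exact lt_irrefl _ h4
        · have : τ (d + 1) ≤ recordBound n τ (c + 1) T (a + 1) :=
            le_recordBound (by omega) d.2 h2
          omega
      have h5 : ¬ IsRecord n τ (c + 1) T (d + 1) := fun h6 => by
        have : τ (a + 1) < τ (d + 1) := h6.lt (by omega) a.2 ha.1
        omega
      have h6 := hnon d h5 m (left_ne_zero_of_mul hd)
      exact ⟨h6.1, by omega, by omega⟩
    have hA := hS a
    rw [hwin a ha, hdec, Matrix.mulVec_add, Matrix.mulVec_add, Matrix.mulVec_smul, hunit] at hA
    have hsum := hA k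
    simp only [Pi.add_apply, Pi.smul_apply, smul_eq_mul] at hsum
    rw [stepTau, if_pos ha] at hsum
    have h2 := ha.2
    by_cases h3 : u.mulVec rest k = 0
    · by_cases h4 : u.mulVec (windowVec τ c T y (τ (a + 1))) k = 0
      · rw [h3, h4, add_zero, add_zero] at hsum
        have := hsum (mul_ne_zero (hy a ha) hk)
        exact ⟨this.1, this.2.1, by omega⟩
      · obtain ⟨h5, h6, b, h7, h8, h9⟩ := hwindow _ (Or.inr ⟨a, ha, rfl⟩) k h4
        refine ⟨h5, ?_, h6⟩
        have : b < a := by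
          by_contra h10
          rcases eq_or_lt_of_le (not_lt.1 h10) with h11 | h11
          · rw [h11] at h8
            exact lt_irrefl _ h8
          · have : τ (b + 1) < τ (a + 1) := ha.lt (by omega) b.2 h7.1
            omega
        omega
    · exact hrestk k h3
  refine ⟨fun k a hk => ?_, fun k hck hk => ?_⟩
  · have h1 := hall a k hk
    exact ⟨by omega, h1.2.1, h1.2.2⟩
  · have hdec : u.mulVec y k = u.mulVec (windowVec τ c T y (τ (c + 1))) k := by
      simp only [Matrix.mulVec, dotProduct]
      refine Finset.sum_congr rfl fun m _ => ?_
      by_cases hm : u k m = 0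
      · simp [hm]
      · have h1 := hall m k hm
        rw [windowVec]
        split_ifs with h2
        · rfl
        · rw [hy0 m (by omega), mul_zero]
          by_contra h3
          exact h2 ⟨⟨by omega, by omega, by omega⟩, by omega⟩
    rw [hdec]
    by_contra h
    have := (hwindow _ (Or.inl rfl) k h).2.1
    omega

/-- The window rows that are not records. -/
noncomputable def nonRecords (n : ℕ) (τ : ℕ → ℕ) (c : Fin n) (T : ℕ) : Finset (Fin n) :=
  Finset.univ.filter fun k =>
    InWindow τ (c + 1) T (k + 1) ∧ ¬ IsRecord n τ (c + 1) T (k + 1)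

lemma exists_record_above_fin (hτ : Set.InjOn τ (Set.Icc (c + 1) n)) {k : Fin n}
    (hk : k ∈ nonRecords n τ c T) : ∃ a : Fin n, k < a ∧ IsRecord n τ (c + 1) T (a + 1) ∧
      recordBound n τ (c + 1) T (a + 1) < τ (k + 1) ∧ τ (k + 1) < τ (a + 1) := by
  simp only [nonRecords, Finset.mem_filter, Finset.mem_univ, true_and] at hk
  obtain ⟨b, h1, h2, h3, h4, h5⟩ := exists_record_above hτ hk.1 k.2 hk.2
  obtain ⟨e, rfl⟩ : ∃ e, b = e + 1 := ⟨b - 1, by omega⟩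
  exact ⟨⟨e, by omega⟩, by rw [Fin.lt_def]; simp only; omega, h3, h4, h5⟩

lemma card_incPair_step (hτ : Set.InjOn τ (Set.Icc (c + 1) n)) :
    (Finset.univ.filter fun p : Fin n × Fin n =>
      IncPair (stepTau n τ (c + 1) T) (c + 2) p.1 p.2).card + (nonRecords n τ c T).card =
    (Finset.univ.filter fun p : Fin n × Fin n => IncPair τ (c + 2) p.1 p.2).card := by
  have hiff : ∀ a b : Fin n, IncPair (stepTau n τ (c + 1) T) (c + 2) a b ↔
      IncPair τ (c + 2) a b ∧ ¬ (IsRecord n τ (c + 1) T (a + 1) ∧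
        InWindow τ (c + 1) T (b + 1) ∧ recordBound n τ (c + 1) T (a + 1) < τ (b + 1)) := by
    intro a b
    unfold IncPair
    constructor
    · rintro ⟨h1, h2, h3⟩
      rw [stepTau_lt_stepTau_iff hτ (by omega) (by omega) a.2] at h3
      exact ⟨⟨h1, h2, h3.1⟩, h3.2⟩
    · rintro ⟨⟨h1, h2, h3⟩, h4⟩
      refine ⟨h1, h2, ?_⟩
      rw [stepTau_lt_stepTau_iff hτ (by omega) (by omega) a.2]
      exact ⟨h3, h4⟩
  have hcard : (Finset.univ.filter fun p : Fin n × Fin n => IncPair τ (c + 2) p.1 p.2 ∧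
      (IsRecord n τ (c + 1) T (p.1 + 1) ∧ InWindow τ (c + 1) T (p.2 + 1) ∧
        recordBound n τ (c + 1) T (p.1 + 1) < τ (p.2 + 1))).card = (nonRecords n τ c T).card := by
    refine Finset.card_bij (fun p _ => p.2) ?_ ?_ ?_
    · rintro ⟨a, b⟩ h
      simp only [Finset.mem_filter, Finset.mem_univ, true_and, nonRecords] at h ⊢
      obtain ⟨⟨h1, h2, h3⟩, h4, h5, h6⟩ := h
      refine ⟨h5, fun h7 => ?_⟩
      have : τ (a + 1) < τ (b + 1) := h7.lt (by omega) a.2 h4.1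
      omega
    · rintro ⟨a, b⟩ h ⟨a', b'⟩ h' rfl
      simp only [Finset.mem_filter, Finset.mem_univ, true_and] at h h'
      have := record_above_unique a.2 a'.2 h.2.1 h.2.2.2 h.1.2.2 h'.2.1 h'.2.2.2 h'.1.2.2
      have : a = a' := by omega
      rw [this]
    · intro k hk
      obtain ⟨a, h1, h2, h3, h4⟩ := exists_record_above_fin hτ hk
      simp only [nonRecords, Finset.mem_filter, Finset.mem_univ, true_and] at hk
      refine ⟨(a, k), ?_, rfl⟩
      simp only [Finset.mem_filter, Finset.mem_univ, true_and]
      have := hk.1.1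
      exact ⟨⟨by omega, h1, h4⟩, h2, hk.1, h3⟩
  rw [← hcard, ← Finset.card_filter_add_card_filter_not (s := Finset.univ.filter
    fun p : Fin n × Fin n => IncPair τ (c + 2) p.1 p.2)
    (fun p => ¬ (IsRecord n τ (c + 1) T (p.1 + 1) ∧
      InWindow τ (c + 1) T (p.2 + 1) ∧ recordBound n τ (c + 1) T (p.1 + 1) < τ (p.2 + 1))),
    Finset.filter_filter, Finset.filter_filter]
  simp only [hiff, not_not]

lemma finrank_annihilating_le (hτ : Set.InjOn τ (Set.Icc (c + 1) n))
    (hy : ∀ k : Fin n, IsRecord n τ (c + 1) T (k + 1) → y k ≠ 0) :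
    Module.finrank L (annihilating τ c y) + (nonRecords n τ c T).card ≤
      (Finset.univ.filter fun p : Fin n × Fin n => IncPair τ (c + 2) p.1 p.2).card := by
  let f : supported (n := n) L (IncPair τ (c + 2)) →ₗ[L] (nonRecords n τ c T → L) :=
    { toFun := fun u k => u.1.mulVec y k
      map_add' := fun u v => by
        ext k
        simp [Matrix.add_mulVec]
      map_smul' := fun r u => by
        ext k
        simp [Matrix.smul_mulVec] }
  have hf : LinearMap.range f = ⊤ := by
    rw [LinearMap.range_eq_top]
    intro v
    choose! a ha using fun k : Fin n => exists_record_above_fin (k := k) (T := T) hτ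
    refine ⟨⟨fun k m => if h : k ∈ nonRecords n τ c T ∧ m = a k then v ⟨k, h.1⟩ / y (a k) else 0,
      fun k m h => ?_⟩, ?_⟩
    · dsimp only at h
      split_ifs at h with h'
      · obtain ⟨h1, rfl⟩ := h'
        have h2 := ha k h1
        simp only [nonRecords, Finset.mem_filter, Finset.mem_univ, true_and] at h1
        have := h1.1.1
        exact ⟨by omega, h2.1, h2.2.2.2⟩
      · exact absurd rfl h
    · ext ⟨k, hk⟩
      change ∑ m, (if h : k ∈ nonRecords n τ c T ∧ m = a k then v ⟨k, h.1⟩ / y (a k) else 0) *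
        y m = _
      rw [Finset.sum_eq_single (a k)]
      · simp [hk, div_mul_cancel₀ _ (hy _ (ha k hk).2.1)]
      · intro m _ hm
        simp [hm]
      · simp
  have hker : annihilating τ c y ≤ (LinearMap.ker f).map (Submodule.subtype _) := by
    intro u hu
    refine ⟨⟨u, hu.1⟩, ?_, rfl⟩
    rw [SetLike.mem_coe, LinearMap.mem_ker]
    ext ⟨k, hk⟩
    simp only [nonRecords, Finset.mem_filter, Finset.mem_univ, true_and] at hk
    exact hu.2 k (by have := hk.1.1; omega) hk.1.2.1
  have h1 := Submodule.finrank_mono hker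
  rw [(Submodule.equivMapOfInjective _ (Submodule.injective_subtype _) _).finrank_eq.symm] at h1
  have h2 := LinearMap.finrank_range_add_finrank_ker f
  rw [hf, finrank_top, finrank_supported, Module.finrank_fintype_fun_eq_card,
    Fintype.card_coe] at h2
  omega

lemma map_conj_eq_annihilating (hτ : Set.InjOn τ (Set.Icc (c + 1) n))
    (hy : ∀ k : Fin n, IsRecord n τ (c + 1) T (k + 1) → y k ≠ 0)
    (hy0 : ∀ k : Fin n, c < k → T < τ (k + 1) → y k = 0) :
    (supported (n := n) L (IncPair (stepTau n τ (c + 1) T) (c + 2))).map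
      (conjEquiv (recordMat τ c T y) (recordMat_isUnit hy) : _ →ₗ[L] _) = annihilating τ c y := by
  apply Submodule.eq_of_le_of_finrank_le (map_conj_le_annihilating hτ hy hy0)
  rw [← ((conjEquiv (recordMat τ c T y) (recordMat_isUnit hy)).submoduleMap _).finrank_eq,
    finrank_supported]
  have h1 := finrank_annihilating_le hτ hy
  have h2 := card_incPair_step (T := T) hτ
  omega

lemma orthIn_eq_annihilating (X : Matrix (Fin n) (Fin n) L) :
    orthIn (commForm X) (supported L fun a b => b = c ∧ c < a ∧ τ (c + 1) < τ (a + 1))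
      (supported L (IncPair τ (c + 2))) = annihilating τ c fun k => X k c := by
  have key : ∀ u ∈ supported (n := n) L fun a b => b = c ∧ c < a ∧ τ (c + 1) < τ (a + 1),
      ∀ v ∈ supported (n := n) L (IncPair τ (c + 2)),
      commForm X u v = ∑ k, u c k * v.mulVec (fun k => X k c) k := by
    intro u hu v hv
    have h1 : v * u = 0 := by
      ext a b
      rw [Matrix.mul_apply, Matrix.zero_apply]
      refine Finset.sum_eq_zero fun m _ => ?_
      by_contra h
      have h2 := hv a m (left_ne_zero_of_mul h)
      have h3 := hu m b (right_ne_zero_of_mul h)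
      have h4 := h2.1
      have h5 := h2.2.1
      have := h3.1
      omega
    rw [commForm_apply, h1, sub_zero, Matrix.trace_mul_comm, mul_assoc, Matrix.trace]
    rw [Finset.sum_eq_single c]
    · rfl
    · intro b _ hb
      rw [Matrix.diag_apply, Matrix.mul_apply]
      refine Finset.sum_eq_zero fun m _ => ?_
      by_contra h
      exact hb (hu b m (left_ne_zero_of_mul h)).1
    · simp
  ext v
  constructor
  · rintro ⟨hv, h⟩
    refine ⟨hv, fun k hck hk => ?_⟩
    have hu : Matrix.single c k (1 : L) ∈
        supported L fun a b => b = c ∧ c < a ∧ τ (c + 1) < τ (a + 1) := by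
      intro b a hba
      rw [Matrix.single_apply] at hba
      simp only [ne_eq, ite_eq_right_iff, not_forall] at hba
      obtain ⟨⟨rfl, rfl⟩, -⟩ := hba
      exact ⟨rfl, hck, hk⟩
    have h1 := h _ hu
    rw [key _ hu v hv, Finset.sum_eq_single k] at h1
    · simpa using h1
    · intro b _ hb
      simp [Ne.symm hb]
    · simp
  · rintro ⟨hv, h⟩
    refine ⟨hv, fun u hu => ?_⟩
    rw [key u hu v hv]
    refine Finset.sum_eq_zero fun k _ => ?_
    by_cases hk : u c k = 0
    · simp [hk]
    · have := hu c k hk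
      rw [h k this.2.1 this.2.2, mul_zero]

/-- Passing from column `c` to the next column. -/
lemma finrank_radOn_step (X : Matrix (Fin n) (Fin n) L) (hτ : Set.InjOn τ (Set.Icc (c + 1) n))
    (hT : τ (c + 1) ≤ T)
    (hy : ∀ k : Fin n, IsRecord n τ (c + 1) T (k + 1) → X k c ≠ 0)
    (hy0 : ∀ k : Fin n, c < k → T < τ (k + 1) → X k c = 0) :
    Module.finrank L (radOn (commForm X) (supported L (IncPair τ (c + 1)))) =
      Module.finrank L (radOn (commForm ((recordMat τ c T fun k => X k c)⁻¹ * X *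
        recordMat τ c T fun k => X k c))
        (supported L (IncPair (stepTau n τ (c + 1) T) (c + 2)))) +
      (Finset.univ.filter fun k : Fin n => IsRecord n τ (c + 1) T (k + 1)).card +
      (Finset.univ.filter fun k : Fin n => c < k ∧ T < τ (k + 1)).card := by
  set A := supported (n := n) L fun a b => b = c ∧ c < a ∧ τ (c + 1) < τ (a + 1) with hA
  have hsup : supported L (IncPair τ (c + 1)) = A ⊔ supported (n := n) L (IncPair τ (c + 2)) := by
    apply le_antisymm
    · intro u hu
      rw [Submodule.mem_sup]
      refine ⟨fun b a => if b = c then u b a else 0, ?_,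
        fun b a => if b = c then 0 else u b a, ?_, ?_⟩
      · intro b a h
        simp only [ne_eq, ite_eq_right_iff, not_forall] at h
        obtain ⟨rfl, h⟩ := h
        have := hu b a h
        exact ⟨rfl, this.2⟩
      · intro b a h
        simp only [ne_eq, ite_eq_left_iff, not_forall] at h
        obtain ⟨hb, h⟩ := h
        have := hu b a h
        have h1 := this.1
        exact ⟨by omega, this.2⟩
      · ext b a
        change (if b = c then u b a else 0) + (if b = c then 0 else u b a) = u b a
        split_ifs <;> simp
    · refine sup_le (fun u hu b a h => ?_) (fun u hu b a h => ?_)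
      · obtain ⟨rfl, h⟩ := hu b a h
        exact ⟨le_rfl, h⟩
      · have := hu b a h
        have h1 := this.1
        exact ⟨by omega, this.2⟩
  have hdisj : Disjoint A (supported (n := n) L (IncPair τ (c + 2))) := by
    rw [Submodule.disjoint_def]
    intro u hu hu'
    ext b a
    by_contra h
    have h1 := (hu b a h).1
    have h2 := (hu' b a h).1
    omega
  have hiso : ∀ u ∈ A, ∀ v ∈ A, commForm X u v = 0 := by
    have hz : ∀ u ∈ A, ∀ v ∈ A, u * v = 0 := by
      intro u hu v hv
      ext a b
      rw [Matrix.mul_apply, Matrix.zero_apply]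
      refine Finset.sum_eq_zero fun m _ => ?_
      by_contra h
      have h2 := hu a m (left_ne_zero_of_mul h)
      have h3 := hv m b (right_ne_zero_of_mul h)
      have := h3.1
      have := h2.2.1
      omega
    intro u hu v hv
    rw [commForm_apply, hz u hu v hv, hz v hv u hu]
    simp
  have hmain := finrank_radOn_sup (commForm X) (commForm_isAlt X) hiso hdisj
  rw [hA, orthIn_eq_annihilating, ← map_conj_eq_annihilating hτ hy hy0, finrank_radOn_conj,
    ← ((conjEquiv _ (recordMat_isUnit hy)).submoduleMap _).finrank_eq,
    finrank_supported (IncPair τ (c + 2)),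
    finrank_supported (IncPair (stepTau n τ (c + 1) T) (c + 2)), ← hA, ← hsup] at hmain
  have hcard := card_incPair_step (T := T) hτ
  have hAcard : Module.finrank L A =
      (Finset.univ.filter fun k : Fin n => IsRecord n τ (c + 1) T (k + 1)).card +
      (nonRecords n τ c T).card +
      (Finset.univ.filter fun k : Fin n => c < k ∧ T < τ (k + 1)).card := by
    have h1 : Module.finrank L A =
        (Finset.univ.filter fun k : Fin n => c < k ∧ τ (c + 1) < τ (k + 1)).card := by
      refine (finrank_supported _).trans (Finset.card_bij (fun p _ => p.1) ?_ ?_ ?_)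
      · intro p hp
        simp only [Finset.mem_filter, Finset.mem_univ, true_and] at hp ⊢
        exact hp.2
      · rintro ⟨a, b⟩ h ⟨a', b'⟩ h' h2
        simp only [Finset.mem_filter, Finset.mem_univ, true_and] at h h' h2
        rw [h2, h.1, h'.1]
      · intro k hk
        simp only [Finset.mem_filter, Finset.mem_univ, true_and] at hk
        exact ⟨(k, c), by simpa using hk, rfl⟩
    rw [h1, nonRecords, ← Finset.card_union_of_disjoint, ← Finset.card_union_of_disjoint]
    · congr 1
      ext k
      simp only [Finset.mem_filter, Finset.mem_univ, true_and, Finset.mem_union]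
      constructor
      · rintro ⟨h2, h3⟩
        by_cases h4 : T < τ (k + 1)
        · exact Or.inr ⟨h2, h4⟩
        · by_cases h5 : IsRecord n τ (c + 1) T (k + 1)
          · exact Or.inl (Or.inl h5)
          · exact Or.inl (Or.inr ⟨⟨by omega, h3, by omega⟩, h5⟩)
      · rintro ((h | h) | h)
        · exact ⟨by have := h.1.1; omega, h.1.2.1⟩
        · exact ⟨by have := h.1.1; omega, h.1.2.1⟩
        · exact ⟨h.1, by omega⟩
    · rw [Finset.disjoint_left]
      intro k hk hk'
      simp only [Finset.mem_filter, Finset.mem_univ, true_and, Finset.mem_union] at hk hk'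
      have : τ (k + 1) ≤ T := by
        rcases hk with h | h
        · exact h.1.2.2
        · exact h.1.2.2
      omega
    · rw [Finset.disjoint_left]
      intro k hk hk'
      simp only [Finset.mem_filter, Finset.mem_univ, true_and] at hk hk'
      exact hk'.2 hk
  omega

end Stage

/-! ### Minors of matrices in a basic cell -/

section CellMinors

variable {n : ℕ} {L : Type} [Field L] {D : Set (ℕ × ℕ)}

/-- `X` agrees below the diagonal with `g X_{D,φ} h` for invertible upper triangular `g`, `h`. -/
def InCell (D : Set (ℕ × ℕ)) (X : Matrix (Fin n) (Fin n) L) : Prop :=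
  ∃ (φ : ℕ × ℕ → L) (g h : Matrix (Fin n) (Fin n) L), (∀ γ ∈ D, φ γ ≠ 0) ∧
    g.BlockTriangular id ∧ h.BlockTriangular id ∧ (∀ a, g a a ≠ 0) ∧ (∀ a, h a a ≠ 0) ∧
    (X - g * XDphi n L D φ * h).BlockTriangular id

lemma upper_conj {g k Y : Matrix (Fin n) (Fin n) L} (hg : g.BlockTriangular id)
    (hk : k.BlockTriangular id) (hY : Y.BlockTriangular id) :
    (g * Y * k).BlockTriangular id := (hg.mul hY).mul hk

lemma upper_mul_diag {g k : Matrix (Fin n) (Fin n) L} (hg : g.BlockTriangular id)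
    (hk : k.BlockTriangular id) (a : Fin n) : (g * k) a a = g a a * k a a := by
  rw [Matrix.mul_apply]
  refine Finset.sum_eq_single a (fun b _ hb => ?_) (by simp)
  rcases lt_or_gt_of_ne hb with h | h
  · rw [hg (show id b < id a from h), zero_mul]
  · rw [hk (show id a < id b from h), mul_zero]

lemma upper_inv_diag {g : Matrix (Fin n) (Fin n) L} (hg : g.BlockTriangular id)
    (hd : ∀ i, g i i ≠ 0) (a : Fin n) : g⁻¹ a a = (g a a)⁻¹ := by
  have hu := isUnit_det_of_upper hg hd
  have h := upper_mul_diag hg (upper_inv hg hu) a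
  rw [Matrix.mul_nonsing_inv g hu, Matrix.one_apply_eq] at h
  exact (eq_inv_of_mul_eq_one_right h.symm)

lemma InCell.conj {X g : Matrix (Fin n) (Fin n) L} (hX : InCell D X) (hg : g.BlockTriangular id)
    (hd : ∀ i, g i i ≠ 0) : InCell D (g⁻¹ * X * g) := by
  obtain ⟨φ, g₁, h₁, hφ, hg₁, hh₁, hd₁, hd₂, hX⟩ := hX
  have hu := isUnit_det_of_upper hg hd
  have hi := upper_inv hg hu
  refine ⟨φ, g⁻¹ * g₁, h₁ * g, hφ, hi.mul hg₁, hh₁.mul hg, fun a => ?_, fun a => ?_, ?_⟩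
  · rw [upper_mul_diag hi hg₁, upper_inv_diag hg hd]
    exact mul_ne_zero (inv_ne_zero (hd a)) (hd₁ a)
  · rw [upper_mul_diag hh₁ hg]
    exact mul_ne_zero (hd₂ a) (hd a)
  · have := upper_conj hi hg hX
    convert this using 1
    noncomm_ring

lemma det_submatrix_of_upper {ι : Type} [Fintype ι] [hι : DecidableEq ι]
    {g : Matrix (Fin n) (Fin n) L} (hg : g.BlockTriangular id) {r : ι → Fin n}
    (hr : Function.Injective r) :
    (g.submatrix r r).det = ∏ t, g (r t) (r t) := by
  let _ : LinearOrder ι := LinearOrder.lift' r hr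
  exact @Matrix.det_of_isUpperTriangular ι L (g.submatrix r r) _ hι _ _ fun i j h => hg h

/-- A minor of `g X_{D,φ} h` whose rows and columns are matched by `D` is a product. -/
lemma det_submatrix_of_cell {ι : Type} [Fintype ι] [DecidableEq ι]
    {X g h : Matrix (Fin n) (Fin n) L}
    {φ : ℕ × ℕ → L} (hg : g.BlockTriangular id) (hh : h.BlockTriangular id)
    (hX : (X - g * XDphi n L D φ * h).BlockTriangular id) {r c : ι → Fin n}
    (hr : Function.Injective r) (hc : Function.Injective c) (hrc : ∀ p q, c q < r p)
    (hD : ∀ a b : Fin n, ((a : ℕ) + 1, (b : ℕ) + 1) ∈ D → (∃ p, r p ≤ a) → (∃ q, b ≤ c q) →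
      ∃ t, r t = a ∧ c t = b) :
    (X.submatrix r c).det =
      ∏ t, g (r t) (r t) * XDphi n L D φ (r t) (c t) * h (c t) (c t) := by
  have hfac : X.submatrix r c = g.submatrix r r *
      Matrix.diagonal (fun t => XDphi n L D φ (r t) (c t)) * h.submatrix c c := by
    ext p q
    have h1 : X (r p) (c q) = (g * XDphi n L D φ * h) (r p) (c q) :=
      sub_eq_zero.1 (hX (show id (c q) < id (r p) from hrc p q))
    rw [Matrix.submatrix_apply, h1, Matrix.mul_apply, Matrix.mul_apply]
    simp only [Matrix.mul_diagonal, Matrix.submatrix_apply]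
    have h2 : ∑ j, (g * XDphi n L D φ) (r p) j * h j (c q) =
        ∑ x : Fin n × Fin n, g (r p) x.1 * XDphi n L D φ x.1 x.2 * h x.2 (c q) := by
      rw [Fintype.sum_prod_type_right]
      refine Finset.sum_congr rfl fun j _ => ?_
      rw [Matrix.mul_apply, Finset.sum_mul]
    rw [h2]
    symm
    refine Fintype.sum_of_injective (fun t => (r t, c t)) (fun t t' ht => hr (Prod.ext_iff.1 ht).1)
      _ _ (fun x hx => ?_) (fun t => rfl)
    by_contra h0
    have hgx := left_ne_zero_of_mul (left_ne_zero_of_mul h0)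
    have hDx := right_ne_zero_of_mul (left_ne_zero_of_mul h0)
    have hhx := right_ne_zero_of_mul h0
    have e1 : r p ≤ x.1 := not_lt.1 fun hlt => hgx (hg hlt)
    have e2 : x.2 ≤ c q := not_lt.1 fun hlt => hhx (hh hlt)
    have e3 : ((x.1 : ℕ) + 1, (x.2 : ℕ) + 1) ∈ D := by
      by_contra h3
      exact hDx (by simp [XDphi, h3])
    obtain ⟨t, ht1, ht2⟩ := hD _ _ e3 ⟨p, e1⟩ ⟨q, e2⟩
    exact hx ⟨t, by simp [ht1, ht2]⟩
  rw [hfac, Matrix.det_mul, Matrix.det_mul, det_submatrix_of_upper hg hr,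
    det_submatrix_of_upper hh hc, Matrix.det_diagonal, Finset.prod_mul_distrib,
    Finset.prod_mul_distrib]

/-- The roots of `D` in rows below `i` and columns to the left of `j`. -/
abbrev SouthWest (D : Set (ℕ × ℕ)) (i j : Fin n) : Type :=
  {p : Fin n × Fin n // ((p.1 : ℕ) + 1, (p.2 : ℕ) + 1) ∈ D ∧ i < p.1 ∧ p.2 < j}

/-- The submatrix on the rows and columns of `SouthWest D i j`. -/
def swBlock (D : Set (ℕ × ℕ)) (X : Matrix (Fin n) (Fin n) L) (i j : Fin n) :
    Matrix (SouthWest D i j) (SouthWest D i j) L :=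
  X.submatrix (fun p => p.1.1) (fun p => p.1.2)

/-- The submatrix `swBlock D X i j` bordered by row `i` and column `j`. -/
def borderedBlock (D : Set (ℕ × ℕ)) (X : Matrix (Fin n) (Fin n) L) (i j : Fin n) :
    Matrix (SouthWest D i j ⊕ Unit) (SouthWest D i j ⊕ Unit) L :=
  X.submatrix (Sum.elim (fun p => p.1.1) fun _ => i) (Sum.elim (fun p => p.1.2) fun _ => j)

/-- The value of the entry `(i, j)` that makes the bordered minor vanish. -/
noncomputable def schurEntry (D : Set (ℕ × ℕ)) (X : Matrix (Fin n) (Fin n) L) (i j : Fin n) : L :=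
  ∑ q, (∑ p : SouthWest D i j, X i p.1.2 * (swBlock D X i j)⁻¹ p q) * X q.1.1 j

/-- `(i, j)` has no root of `D` strictly to the left or strictly below. -/
def NoHook (D : Set (ℕ × ℕ)) (i j : Fin n) : Prop :=
  (∀ m < j, ((i : ℕ) + 1, (m : ℕ) + 1) ∉ D) ∧ ∀ l > i, ((l : ℕ) + 1, (j : ℕ) + 1) ∉ D

lemma southWest_row_injective (hD : IsBasic n D) (i j : Fin n) :
    Function.Injective fun p : SouthWest D i j => p.1.1 := by
  rintro ⟨⟨a, b⟩, h⟩ ⟨⟨a', b'⟩, h'⟩ (e : a = a')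
  subst e
  have := hD.2.1 _ h.1 _ h'.1 rfl
  simp only [Prod.mk.injEq, true_and] at this
  simp only [Subtype.mk.injEq, Prod.mk.injEq, true_and]
  omega

lemma southWest_col_injective (hD : IsBasic n D) (i j : Fin n) :
    Function.Injective fun p : SouthWest D i j => p.1.2 := by
  rintro ⟨⟨a, b⟩, h⟩ ⟨⟨a', b'⟩, h'⟩ (e : b = b')
  subst e
  have := hD.2.2 _ h.1 _ h'.1 rfl
  simp only [Prod.mk.injEq, and_true] at this
  simp only [Subtype.mk.injEq, Prod.mk.injEq, and_true]
  omega

lemma det_swBlock (hD : IsBasic n D) {X g h : Matrix (Fin n) (Fin n) L}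
    {φ : ℕ × ℕ → L} (hg : g.BlockTriangular id) (hh : h.BlockTriangular id)
    (hX : (X - g * XDphi n L D φ * h).BlockTriangular id) {i j : Fin n} (hij : j < i) :
    (swBlock D X i j).det = ∏ p : SouthWest D i j,
      g p.1.1 p.1.1 * XDphi n L D φ p.1.1 p.1.2 * h p.1.2 p.1.2 := by
  refine det_submatrix_of_cell hg hh hX (southWest_row_injective hD i j)
    (southWest_col_injective hD i j) (fun p q => ?_) ?_
  · exact (q.2.2.2.trans hij).trans p.2.2.1
  · rintro a b hab ⟨p, hp⟩ ⟨q, hq⟩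
    exact ⟨⟨(a, b), hab, p.2.2.1.trans_le hp, hq.trans_lt q.2.2.2⟩, rfl, rfl⟩

lemma det_borderedBlock (hD : IsBasic n D) {X g h : Matrix (Fin n) (Fin n) L}
    {φ : ℕ × ℕ → L} (hg : g.BlockTriangular id) (hh : h.BlockTriangular id)
    (hX : (X - g * XDphi n L D φ * h).BlockTriangular id) {i j : Fin n} (hij : j < i)
    (hreg : NoHook D i j) :
    (borderedBlock D X i j).det = (∏ p : SouthWest D i j,
      g p.1.1 p.1.1 * XDphi n L D φ p.1.1 p.1.2 * h p.1.2 p.1.2) *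
        (g i i * XDphi n L D φ i j * h j j) := by
  have key := det_submatrix_of_cell (r := Sum.elim (fun p : SouthWest D i j => p.1.1) fun _ => i)
    (c := Sum.elim (fun p : SouthWest D i j => p.1.2) fun _ : Unit => j) hg hh hX ?_ ?_ ?_ ?_
  · rw [borderedBlock, key, Fintype.prod_sum_type]
    simp
  · refine (southWest_row_injective hD i j).sumElim (fun _ _ _ => rfl) fun p _ => ?_
    exact p.2.2.1.ne'
  · refine (southWest_col_injective hD i j).sumElim (fun _ _ _ => rfl) fun p _ => ?_
    exact p.2.2.2.ne
  · rintro (p | p) (q | q)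
    · exact (q.2.2.2.trans hij).trans p.2.2.1
    · exact hij.trans p.2.2.1
    · exact q.2.2.2.trans hij
    · exact hij
  · rintro a b hab ⟨p, hp⟩ ⟨q, hq⟩
    have h1 : i ≤ a := by
      rcases p with p | p
      · exact p.2.2.1.le.trans hp
      · exact hp
    have h2 : b ≤ j := by
      rcases q with q | q
      · exact hq.trans q.2.2.2.le
      · exact hq
    rcases h1.lt_or_eq with h3 | h3
    · rcases h2.lt_or_eq with h4 | h4
      · exact ⟨Sum.inl ⟨(a, b), hab, h3, h4⟩, rfl, rfl⟩
      · subst h4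
        exact absurd hab (hreg.2 a h3)
    · rcases h2.lt_or_eq with h4 | h4
      · subst h3
        exact absurd hab (hreg.1 b h4)
      · exact ⟨Sum.inr (), h3, h4.symm⟩

lemma det_borderedBlock_eq {X : Matrix (Fin n) (Fin n) L} {i j : Fin n}
    (h : (swBlock D X i j).det ≠ 0) :
    (borderedBlock D X i j).det = (swBlock D X i j).det * (X i j - schurEntry D X i j) := by
  have := Matrix.invertibleOfIsUnitDet _ (isUnit_iff_ne_zero.2 h)
  rw [← Matrix.fromBlocks_toBlocks (borderedBlock D X i j)]
  have h1 : (borderedBlock D X i j).toBlocks₁₁ = swBlock D X i j := rfl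
  rw [h1, Matrix.det_fromBlocks₁₁, Matrix.det_unique (n := Unit), Matrix.sub_apply,
    Matrix.mul_apply, Matrix.invOf_eq_nonsing_inv]
  rfl

lemma InCell.det_swBlock_ne_zero (hD : IsBasic n D) {X : Matrix (Fin n) (Fin n) L}
    (hX : InCell D X) {i j : Fin n} (hij : j < i) : (swBlock D X i j).det ≠ 0 := by
  obtain ⟨φ, g, h, hφ, hg, hh, hd₁, hd₂, hX⟩ := hX
  rw [det_swBlock hD hg hh hX hij]
  refine Finset.prod_ne_zero_iff.2 fun p _ => mul_ne_zero (mul_ne_zero (hd₁ _) ?_) (hd₂ _)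
  simpa [XDphi, p.2.1] using hφ _ p.2.1

lemma InCell.eq_schurEntry (hD : IsBasic n D) {X : Matrix (Fin n) (Fin n) L}
    (hX : InCell D X) {i j : Fin n} (hij : j < i) (hreg : NoHook D i j)
    (hnot : ((i : ℕ) + 1, (j : ℕ) + 1) ∉ D) : X i j = schurEntry D X i j := by
  have h0 := hX.det_swBlock_ne_zero hD hij
  obtain ⟨φ, g, h, hφ, hg, hh, hd₁, hd₂, hX⟩ := hX
  have h1 := det_borderedBlock hD hg hh hX hij hreg
  have h2 : XDphi n L D φ i j = 0 := by simp [XDphi, hnot]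
  rw [h2, det_borderedBlock_eq h0, mul_zero, zero_mul, mul_zero] at h1
  exact sub_eq_zero.1 ((mul_eq_zero.1 h1).resolve_left h0)

lemma InCell.ne_schurEntry (hD : IsBasic n D) {X : Matrix (Fin n) (Fin n) L}
    (hX : InCell D X) {i j : Fin n} (hij : j < i) (hreg : NoHook D i j)
    (hmem : ((i : ℕ) + 1, (j : ℕ) + 1) ∈ D) : X i j ≠ schurEntry D X i j := by
  have h0 := hX.det_swBlock_ne_zero hD hij
  obtain ⟨φ, g, h, hφ, hg, hh, hd₁, hd₂, hX⟩ := hX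
  have h1 := det_borderedBlock hD hg hh hX hij hreg
  rw [det_borderedBlock_eq h0, ← det_swBlock hD hg hh hX hij] at h1
  have h2 := mul_left_cancel₀ h0 h1
  rw [← sub_ne_zero, h2]
  refine mul_ne_zero (mul_ne_zero (hd₁ _) ?_) (hd₂ _)
  simpa [XDphi, hmem] using hφ _ hmem

/-- `schurEntry D X i j` only involves entries weakly below and to the left of `(i, j)`. -/
lemma schurEntry_congr {X Y : Matrix (Fin n) (Fin n) L} {i j : Fin n}
    (h : ∀ a b, i ≤ a → b ≤ j → (a, b) ≠ (i, j) → X a b = Y a b) :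
    schurEntry D X i j = schurEntry D Y i j := by
  have h1 : swBlock D X i j = swBlock D Y i j := by
    ext p q
    refine h _ _ p.2.2.1.le q.2.2.2.le fun e => ?_
    exact p.2.2.1.ne' (Prod.ext_iff.1 e).1
  rw [schurEntry, schurEntry, h1]
  refine Finset.sum_congr rfl fun q _ => ?_
  rw [h q.1.1 j q.2.2.1.le le_rfl fun e => q.2.2.1.ne' (Prod.ext_iff.1 e).1]
  congr 1
  refine Finset.sum_congr rfl fun p _ => ?_
  rw [h i p.1.2 le_rfl p.2.2.2.le fun e => p.2.2.2.ne (Prod.ext_iff.1 e).2]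

lemma schurEntry_eq_zero {X : Matrix (Fin n) (Fin n) L} {i j : Fin n}
    (h : ∀ b < j, X i b = 0) : schurEntry D X i j = 0 := by
  refine Finset.sum_eq_zero fun q _ => ?_
  rw [Finset.sum_eq_zero fun p _ => by rw [h _ p.2.2.2, zero_mul], zero_mul]

lemma det_mem_of_forall {K ι : Type} [Field K] [Algebra K L] [Fintype ι] [DecidableEq ι]
    (E : IntermediateField K L)
    {A : Matrix ι ι L} (hA : ∀ p q, A p q ∈ E) : A.det ∈ E := by
  have h : A = (algebraMap E L).mapMatrix (Matrix.of fun p q => (⟨A p q, hA p q⟩ : E)) := by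
    ext p q
    rfl
  rw [h, ← RingHom.map_det]
  exact SetLike.coe_mem _

lemma inv_mem_of_forall {K ι : Type} [Field K] [Algebra K L] [Fintype ι] [DecidableEq ι]
    (E : IntermediateField K L)
    {A : Matrix ι ι L} (hA : ∀ p q, A p q ∈ E) (p q : ι) : A⁻¹ p q ∈ E := by
  have h : A = (algebraMap E L).mapMatrix (Matrix.of fun p q => (⟨A p q, hA p q⟩ : E)) := by
    ext p q
    rfl
  rw [Matrix.inv_def, Matrix.smul_apply, smul_eq_mul, Ring.inverse_eq_inv']
  refine E.mul_mem (E.inv_mem (det_mem_of_forall E hA)) ?_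
  rw [h, ← RingHom.map_adjugate]
  exact SetLike.coe_mem _

lemma schurEntry_mem {K : Type} [Field K] [Algebra K L] (E : IntermediateField K L)
    {X : Matrix (Fin n) (Fin n) L} {i j : Fin n}
    (h : ∀ a b, i ≤ a → b ≤ j → (a, b) ≠ (i, j) → X a b ∈ E) : schurEntry D X i j ∈ E := by
  refine sum_mem fun q _ => E.mul_mem (sum_mem fun p _ => E.mul_mem ?_ ?_) ?_
  · exact h _ _ le_rfl p.2.2.2.le fun e => p.2.2.2.ne (Prod.ext_iff.1 e).2
  · refine inv_mem_of_forall E (fun p q => ?_) p q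
    exact h _ _ p.2.2.1.le q.2.2.2.le fun e => p.2.2.1.ne' (Prod.ext_iff.1 e).1
  · exact h _ _ q.2.2.1.le le_rfl fun e => q.2.2.1.ne' (Prod.ext_iff.1 e).1

end CellMinors

/-! ### The permutation `w_D` and its minors -/

section MinorW

variable {n : ℕ} {L : Type} [Field L] {D : Set (ℕ × ℕ)}

lemma wD_succ (n : ℕ) (D : Set (ℕ × ℕ)) (j : ℕ) :
    wD n D (j + 1) = sSup {i | 1 ≤ i ∧ i ≤ n ∧ (i, j + 1) ∉ MD n D ∧ i ∉ wDVals n D j} := by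
  simp [wD, wDVals]

lemma mem_wDVals {i j : ℕ} : i ∈ wDVals n D j ↔ ∃ m, 1 ≤ m ∧ m ≤ j ∧ wD n D m = i := by
  induction j with
  | zero =>
    simp only [wDVals, List.not_mem_nil, false_iff, not_exists]
    omega
  | succ j ih =>
    have h : wDVals n D (j + 1) = wDVals n D j ++ [wD n D (j + 1)] := by
      rw [wD_succ]
      rfl
    rw [h, List.mem_append, ih, List.mem_singleton]
    constructor
    · rintro (⟨m, h1, h2, h3⟩ | h1)
      · exact ⟨m, h1, by omega, h3⟩
      · exact ⟨j + 1, by omega, le_rfl, h1.symm⟩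
    · rintro ⟨m, h1, h2, h3⟩
      rcases h2.lt_or_eq with h4 | h4
      · exact Or.inl ⟨m, h1, by omega, h3⟩
      · subst h4
        exact Or.inr h3.symm

/-- `w_D` sends the column of a root of `D` to its row, and does not raise any other column. -/
lemma wD_spec (hD : IsBasic n D) (b : ℕ) (hb : 1 ≤ b) :
    (∀ l, (l, b) ∈ D → wD n D b = l) ∧ ((∀ l, (l, b) ∉ D) → wD n D b ≤ b) := by
  induction b using Nat.strong_induction_on with
  | _ b ih =>
  obtain ⟨j, rfl⟩ : ∃ j, b = j + 1 := ⟨b - 1, by omega⟩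
  have hprev : ∀ i m, m ≤ j → (i, m) ∈ D → i ∈ wDVals n D j := by
    intro i m hm him
    have h1 := (hD.1 _ him).1
    exact mem_wDVals.2 ⟨m, h1, hm, (ih m (by omega) h1).1 i him⟩
  have hup : ∀ i, j + 1 < i → i ≤ n → (i, j + 1) ∉ MD n D → i ∉ wDVals n D j →
      ∃ l, i ≤ l ∧ (l, j + 1) ∈ D := by
    intro i h1 h2 h3 h4
    rw [mem_MD_iff hD] at h3
    by_contra! h5
    refine h3 ⟨⟨by simp, h1, h2⟩, fun m hm him => ?_, fun l hl => h5 l hl⟩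
    rcases hm.lt_or_eq with h6 | h6
    · exact h4 (hprev i m (by omega) him)
    · subst h6
      exact h5 i le_rfl him
  rw [wD_succ]
  constructor
  · intro l hl
    have hpos := hD.1 _ hl
    refine IsGreatest.csSup_eq ⟨⟨?_, hpos.2.2, ?_, ?_⟩, ?_⟩
    · have := hpos.2.1
      simp only at this
      omega
    · exact fun h => h.2.2 hl
    · intro h
      obtain ⟨m, h1, h2, h3⟩ := mem_wDVals.1 h
      by_cases h4 : ∃ l', (l', m) ∈ D
      · obtain ⟨l', h4⟩ := h4
        have h5 := (ih m (by omega) h1).1 l' h4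
        rw [h3] at h5
        subst h5
        have := hD.2.1 _ hl _ h4 rfl
        simp only [Prod.mk.injEq, true_and] at this
        omega
      · push Not at h4
        have h5 := (ih m (by omega) h1).2 h4
        have := hpos.2.1
        simp only at this
        omega
    · rintro i ⟨h1, h2, h3, h4⟩
      by_contra! h5
      have := hpos.2.1
      simp only at this
      obtain ⟨l', h6, h7⟩ := hup i (by omega) h2 h3 h4
      have := hD.2.2 _ hl _ h7 rfl
      simp only [Prod.mk.injEq, and_true] at this
      omega
  · intro hno
    refine csSup_le' ?_
    rintro i ⟨h1, h2, h3, h4⟩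
    by_contra! h5
    obtain ⟨l', h6, h7⟩ := hup i (by omega) h2 h3 h4
    exact hno _ h7

lemma det_orderIso_eq {ι R : Type} [Fintype ι] [DecidableEq ι] [CommRing R]
    (A : Matrix (Fin n) (Fin n) R)
    {r c : ι → Fin n} (hr : Function.Injective r) (hc : Function.Injective c)
    {I J : Finset (Fin n)} (hI : ∀ a, a ∈ I ↔ ∃ t, r t = a) (hJ : ∀ a, a ∈ J ↔ ∃ t, c t = a)
    (h : I.card = J.card) :
    ∃ ε : R, (ε = 1 ∨ ε = -1) ∧ Matrix.det (Matrix.of fun a b : Fin J.card =>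
      A ((I.orderIsoOfFin h) a).val ((J.orderIsoOfFin rfl) b).val) =
        ε * (A.submatrix r c).det := by
  let er : ι ≃ I := Equiv.ofBijective (fun t => ⟨r t, (hI _).2 ⟨t, rfl⟩⟩)
    ⟨fun t t' e => hr (Subtype.ext_iff.1 e), fun a => by
      obtain ⟨t, ht⟩ := (hI _).1 a.2
      exact ⟨t, Subtype.ext ht⟩⟩
  let ec : ι ≃ J := Equiv.ofBijective (fun t => ⟨c t, (hJ _).2 ⟨t, rfl⟩⟩)
    ⟨fun t t' e => hc (Subtype.ext_iff.1 e), fun a => by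
      obtain ⟨t, ht⟩ := (hJ _).1 a.2
      exact ⟨t, Subtype.ext ht⟩⟩
  let e₁ : Fin J.card ≃ ι := (I.orderIsoOfFin h).toEquiv.trans er.symm
  let e₂ : Fin J.card ≃ ι := (J.orderIsoOfFin rfl).toEquiv.trans ec.symm
  have h₁ : ∀ a, r (e₁ a) = ((I.orderIsoOfFin h) a).val := fun a =>
    congrArg Subtype.val (er.apply_symm_apply (I.orderIsoOfFin h a))
  have h₂ : ∀ a, c (e₂ a) = ((J.orderIsoOfFin rfl) a).val := fun a =>
    congrArg Subtype.val (ec.apply_symm_apply (J.orderIsoOfFin rfl a))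
  refine ⟨((Equiv.Perm.sign (e₂.trans e₁.symm) : ℤ) : R), ?_, ?_⟩
  · rcases Int.units_eq_one_or (Equiv.Perm.sign (e₂.trans e₁.symm)) with h | h <;> simp [h]
  · rw [← Matrix.det_submatrix_equiv_self e₁ (A.submatrix r c), ← Matrix.det_permute']
    congr 1
    ext a b
    simp [h₁, h₂]

/-- For a root of `D` the minor `P^{w_D}` is, up to sign, the bordered minor. -/
lemma minorW_eq (hD : IsBasic n D) (X : Matrix (Fin n) (Fin n) L) {i j : Fin n}
    (hij : ((i : ℕ) + 1, (j : ℕ) + 1) ∈ D) :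
    ∃ ε : L, (ε = 1 ∨ ε = -1) ∧
      minorW n L (wD n D) X (i + 1) (j + 1) = ε * (borderedBlock D X i j).det := by
  have hlt : j < i := by
    have := (hD.1 _ hij).2.1
    simp only at this
    omega
  let r : SouthWest D i j ⊕ Unit → Fin n := Sum.elim (fun p => p.1.1) fun _ => i
  let c : SouthWest D i j ⊕ Unit → Fin n := Sum.elim (fun p => p.1.2) fun _ => j
  have hr : Function.Injective r :=
    (southWest_row_injective hD i j).sumElim (fun _ _ _ => rfl) fun p _ => p.2.2.1.ne'
  have hc : Function.Injective c :=
    (southWest_col_injective hD i j).sumElim (fun _ _ _ => rfl) fun p _ => p.2.2.2.ne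
  set J' : Finset (Fin n) :=
    Finset.univ.filter (fun b => (b : ℕ) + 1 < j + 1 ∧ i + 1 < wD n D ((b : ℕ) + 1)) with hJ'
  have hmem : ∀ b, b ∈ J' → ∃ l : Fin n, ((l : ℕ) + 1, (b : ℕ) + 1) ∈ D ∧ i < l ∧ b < j ∧
      wD n D ((b : ℕ) + 1) = l + 1 := by
    intro b hb
    simp only [hJ', Finset.mem_filter, Finset.mem_univ, true_and] at hb
    have hs := wD_spec hD ((b : ℕ) + 1) (by omega)
    by_cases h : ∃ l, (l, (b : ℕ) + 1) ∈ D
    · obtain ⟨l, h⟩ := h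
      have h1 := hs.1 l h
      have h2 := hD.1 _ h
      have h3 := h2.2.1
      have h4 := h2.2.2
      simp only at h3 h4
      refine ⟨⟨l - 1, by omega⟩, ?_, ?_, ?_, ?_⟩
      · convert h using 2
        simp only
        omega
      · rw [Fin.lt_def]
        simp only
        omega
      · rw [Fin.lt_def]
        omega
      · simp only
        omega
    · push Not at h
      have := hs.2 h
      have : (j : ℕ) < i := hlt
      omega
  have hmem' : ∀ b l : Fin n, ((l : ℕ) + 1, (b : ℕ) + 1) ∈ D → i < l → b < j →
      b ∈ J' ∧ wD n D ((b : ℕ) + 1) = l + 1 := by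
    intro b l h1 h2 h3
    have h4 := (wD_spec hD ((b : ℕ) + 1) (by omega)).1 _ h1
    refine ⟨?_, h4⟩
    simp only [hJ', Finset.mem_filter, Finset.mem_univ, true_and, h4]
    rw [Fin.lt_def] at h2 h3
    omega
  set JJ : Finset (Fin n) := J' ∪ Finset.univ.filter (fun b => (b : ℕ) + 1 = j + 1) with hJJ
  set II : Finset (Fin n) := Finset.univ.filter
    (fun a => (a : ℕ) + 1 = i + 1 ∨ ∃ b ∈ J', wD n D ((b : ℕ) + 1) = (a : ℕ) + 1) with hII
  have hI : ∀ a, a ∈ II ↔ ∃ t, r t = a := by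
    intro a
    simp only [hII, Finset.mem_filter, Finset.mem_univ, true_and]
    constructor
    · rintro (h | ⟨b, hb, h⟩)
      · exact ⟨Sum.inr (), Fin.ext (by simp only [r, Sum.elim_inr]; omega)⟩
      · obtain ⟨l, h1, h2, h3, h4⟩ := hmem b hb
        exact ⟨Sum.inl ⟨(l, b), h1, h2, h3⟩, Fin.ext (by simp only [r, Sum.elim_inl]; omega)⟩
    · rintro ⟨p | p, rfl⟩
      · have := hmem' p.1.2 p.1.1 p.2.1 p.2.2.1 p.2.2.2
        exact Or.inr ⟨_, this.1, this.2⟩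
      · exact Or.inl rfl
  have hJ : ∀ a, a ∈ JJ ↔ ∃ t, c t = a := by
    intro a
    simp only [hJJ, Finset.mem_union, Finset.mem_filter, Finset.mem_univ, true_and]
    constructor
    · rintro (h | h)
      · obtain ⟨l, h1, h2, h3, h4⟩ := hmem a h
        exact ⟨Sum.inl ⟨(l, a), h1, h2, h3⟩, rfl⟩
      · exact ⟨Sum.inr (), Fin.ext (by simp only [c, Sum.elim_inr]; omega)⟩
    · rintro ⟨p | p, rfl⟩
      · exact Or.inl (hmem' p.1.2 p.1.1 p.2.1 p.2.2.1 p.2.2.2).1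
      · exact Or.inr rfl
  have hcard : II.card = JJ.card := by
    have h1 : II = Finset.univ.image r := by
      ext a
      simp [hI a]
    have h2 : JJ = Finset.univ.image c := by
      ext a
      simp [hJ a]
    rw [h1, h2, Finset.card_image_of_injective _ hr, Finset.card_image_of_injective _ hc]
  obtain ⟨ε, hε, h⟩ := det_orderIso_eq X hr hc hI hJ hcard
  refine ⟨ε, hε, ?_⟩
  rw [minorW, dif_pos hcard]
  exact h

end MinorW

/-! ### Triangular families and algebraic independence -/

section Triangular

variable {K L ι : Type} [Field K] [Field L] [Algebra K L]

lemma Transcendental.of_le {E F : IntermediateField K L} (h : E ≤ F) {x : L}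
    (hx : Transcendental F x) : Transcendental E x := by
  intro hE
  apply hx
  let _ : Algebra E F := (IntermediateField.inclusion h).toRingHom.toAlgebra
  have : IsScalarTower E F L := IsScalarTower.of_algebraMap_eq' rfl
  exact hE.tower_top F

lemma Transcendental.mul_add {E : IntermediateField K L} {x a b : L} (hx : Transcendental E x)
    (ha : a ∈ E) (hb : b ∈ E) (ha0 : a ≠ 0) : Transcendental E (a * x + b) := by
  intro h
  apply hx
  have h1 : IsAlgebraic E a := isAlgebraic_algebraMap (⟨a, ha⟩ : E)
  have h2 : IsAlgebraic E b := isAlgebraic_algebraMap (⟨b, hb⟩ : E)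
  have h3 : x = a⁻¹ * (a * x + b - b) := by field_simp; ring
  rw [h3]
  exact h1.inv.mul (h.sub h2)

lemma Transcendental.not_mem {E : IntermediateField K L} {x : L} (hx : Transcendental E x) :
    x ∉ E := fun h => hx (isAlgebraic_algebraMap (⟨x, h⟩ : E))

/-- A finite family is algebraically independent if each member is transcendental over a field
containing all earlier members. -/
lemma algebraicIndependent_of_triangular [Finite ι] {key : ι → ℕ}
    (hkey : Function.Injective key)
    {F : ι → L} (E : ι → IntermediateField K L) (hE : ∀ i j, key j < key i → F j ∈ E i)
    (hF : ∀ i, Transcendental (E i) (F i)) : AlgebraicIndependent K F := by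
  have step : ∀ k, AlgebraicIndepOn K F {j | key j < k} := by
    intro k
    induction k with
    | zero =>
      simp only [not_lt_zero, Set.ofPred_false]
      exact algebraicIndependent_empty_type_iff.2 (algebraMap K L).injective
    | succ k ih =>
      by_cases hk : ∃ i, key i = k
      · obtain ⟨i, hi⟩ := hk
        have : {j | key j < k + 1} = insert i {j | key j < k} := by
          ext j
          simp only [Set.mem_ofPred_eq, Set.mem_insert_iff]
          constructor
          · intro h
            rcases Nat.lt_succ_iff_lt_or_eq.1 h with h | h
            · exact Or.inr h
            · exact Or.inl (hkey (h.trans hi.symm))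
          · rintro (rfl | h) <;> omega
        rw [this]
        refine AlgebraicIndepOn.insert ih ?_
        rw [← IntermediateField.transcendental_adjoin_iff]
        refine (hF i).of_le (IntermediateField.adjoin_le_iff.2 ?_)
        rintro _ ⟨j, hj, rfl⟩
        simp only [Set.mem_ofPred_eq] at hj
        exact hE i j (by omega)
      · have : {j | key j < k + 1} = {j | key j < k} := by
          ext j
          simp only [Set.mem_ofPred_eq]
          have : key j ≠ k := fun h => hk ⟨j, h⟩
          omega
        rw [this]
        exact ih
  obtain ⟨N, hN⟩ := (Set.finite_range key).bddAbove
  have h := step (N + 1)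
  have h2 : {j | key j < N + 1} = Set.univ := by
    ext j
    simp only [Set.mem_ofPred_eq, Set.mem_univ, iff_true]
    have := hN ⟨j, rfl⟩
    omega
  rw [h2] at h
  exact h.comp (fun i => ⟨i, trivial⟩) fun i j hij => Subtype.ext_iff.1 hij

end Triangular

/-! ### A triangular parametrization of the cell -/

section Param

variable {n : ℕ} {D : Set (ℕ × ℕ)} {R : Type} [CommRing R]

/-- Membership of a place of a matrix in `D`. -/
def Mem (D : Set (ℕ × ℕ)) (a b : Fin n) : Prop := ((a : ℕ) + 1, (b : ℕ) + 1) ∈ D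

/-- No root of `D` lies in column `b` strictly below row `a`. -/
def NoBelow (D : Set (ℕ × ℕ)) (a b : Fin n) : Prop := ∀ i > a, ¬ Mem D i b

/-- The position of a place in the order in which places are processed. -/
def placeKey (a b : Fin n) : ℕ := b * n + (n - 1 - a)

lemma placeKey_injective {a b a' b' : Fin n} (h : placeKey a b = placeKey a' b') :
    a = a' ∧ b = b' := by
  have hb : (b : ℕ) = b' := by
    by_contra hne
    unfold placeKey at h
    rcases lt_or_gt_of_ne hne with hlt | hlt
    · have : ((b : ℕ) + 1) * n ≤ b' * n := Nat.mul_le_mul_right n hlt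
      rw [add_mul] at this
      omega
    · have : ((b' : ℕ) + 1) * n ≤ b * n := Nat.mul_le_mul_right n hlt
      rw [add_mul] at this
      omega
  refine ⟨Fin.ext ?_, Fin.ext hb⟩
  unfold placeKey at h
  rw [hb] at h
  omega

lemma placeKey_lt_of_col {a b a' b' : Fin n} (h : b < b') : placeKey a b < placeKey a' b' := by
  unfold placeKey
  have : ((b : ℕ) + 1) * n ≤ b' * n := Nat.mul_le_mul_right n h
  rw [add_mul] at this
  omega

lemma placeKey_lt_of_row {a b a' : Fin n} (h : a' < a) : placeKey a b < placeKey a' b := by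
  unfold placeKey
  rw [Fin.lt_def] at h
  omega

lemma placeKey_lt_iff {a b a' b' : Fin n} :
    placeKey a b < placeKey a' b' ↔ b < b' ∨ b = b' ∧ a' < a := by
  constructor
  · intro h
    rcases lt_trichotomy b b' with h1 | h1 | h1
    · exact Or.inl h1
    · subst h1
      refine Or.inr ⟨rfl, ?_⟩
      unfold placeKey at h
      rw [Fin.lt_def]
      omega
    · have := placeKey_lt_of_col (a := a') (a' := a) h1
      omega
  · rintro (h | ⟨rfl, h⟩)
    · exact placeKey_lt_of_col h
    · exact placeKey_lt_of_row h

/-- The left factor of the parametrization. -/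
noncomputable def leftParam (D : Set (ℕ × ℕ)) (y : Matrix (Fin n) (Fin n) R) :
    Matrix (Fin n) (Fin n) R := fun a i =>
  if i = a then 1 else ∑ b, if Mem D i b ∧ a < i then y a b else 0

/-- The middle factor of the parametrization. -/
noncomputable def midParam (D : Set (ℕ × ℕ)) (y : Matrix (Fin n) (Fin n) R) :
    Matrix (Fin n) (Fin n) R := fun i j => if Mem D i j then y i j else 0

/-- The right factor of the parametrization. -/
noncomputable def rightParam (D : Set (ℕ × ℕ)) (y : Matrix (Fin n) (Fin n) R) :
    Matrix (Fin n) (Fin n) R := fun j b =>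
  if j = b then 1 else ∑ i, if Mem D i j ∧ j < b ∧ NoBelow D i b then y i b else 0

/-- The product of the three factors of the parametrization. -/
noncomputable def cellParam (D : Set (ℕ × ℕ)) (y : Matrix (Fin n) (Fin n) R) :
    Matrix (Fin n) (Fin n) R := leftParam D y * midParam D y * rightParam D y

lemma leftParam_upper (y : Matrix (Fin n) (Fin n) R) : (leftParam D y).BlockTriangular id := by
  intro a i (h : i < a)
  rw [leftParam, if_neg h.ne]
  exact Finset.sum_eq_zero fun b _ => if_neg fun h' => h'.2.asymm h

lemma rightParam_upper (y : Matrix (Fin n) (Fin n) R) : (rightParam D y).BlockTriangular id := by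
  intro j b (h : b < j)
  rw [rightParam, if_neg h.ne']
  exact Finset.sum_eq_zero fun b _ => if_neg fun h' => h'.2.1.asymm h

lemma leftParam_diag (y : Matrix (Fin n) (Fin n) R) (a : Fin n) : leftParam D y a a = 1 :=
  if_pos rfl

lemma rightParam_diag (y : Matrix (Fin n) (Fin n) R) (a : Fin n) :
    rightParam D y a a = 1 := if_pos rfl

lemma Mem.col_eq (hD : IsBasic n D) {i b b' : Fin n} (h : Mem D i b) (h' : Mem D i b') :
    b = b' := by
  have := hD.2.1 _ h _ h' rfl
  simp only [Prod.mk.injEq, true_and] at this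
  exact Fin.ext (by omega)

lemma Mem.row_eq (hD : IsBasic n D) {i i' b : Fin n} (h : Mem D i b) (h' : Mem D i' b) :
    i = i' := by
  have := hD.2.2 _ h _ h' rfl
  simp only [Prod.mk.injEq, and_true] at this
  exact Fin.ext (by omega)

lemma leftParam_eq (hD : IsBasic n D) (y : Matrix (Fin n) (Fin n) R) {a i j : Fin n}
    (h : Mem D i j) (hai : a < i) : leftParam D y a i = y a j := by
  rw [leftParam, if_neg hai.ne', Finset.sum_eq_single j]
  · rw [if_pos ⟨h, hai⟩]
  · exact fun b _ hb => if_neg fun h' => hb (h'.1.col_eq hD h)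
  · simp

lemma rightParam_eq (hD : IsBasic n D) (y : Matrix (Fin n) (Fin n) R) {i j b : Fin n}
    (h : Mem D i j) (hjb : j < b) :
    rightParam D y j b = if NoBelow D i b then y i b else 0 := by
  rw [rightParam, if_neg hjb.ne, Finset.sum_eq_single i]
  · simp [h, hjb]
  · exact fun i' _ hb => if_neg fun h' => hb (h'.1.row_eq hD h)
  · simp

/-- The contribution of `(i, j)` to the coefficient of `y a b` in `cellParam D y a b`. -/
noncomputable def leadTerm (D : Set (ℕ × ℕ)) (y : Matrix (Fin n) (Fin n) R) (a b : Fin n)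
    (p : Fin n × Fin n) : R :=
  if Mem D p.1 p.2 then
    if p.1 = a ∧ p.2 = b then 1
    else if a < p.1 ∧ p.2 = b then y p.1 b
    else if p.1 = a ∧ p.2 < b ∧ NoBelow D a b then y a p.2
    else 0
  else 0

/-- The contribution of `(i, j)` to the part of `cellParam D y a b` free of `y a b`. -/
noncomputable def restTerm (D : Set (ℕ × ℕ)) (y : Matrix (Fin n) (Fin n) R) (a b : Fin n)
    (p : Fin n × Fin n) : R :=
  if Mem D p.1 p.2 ∧ a < p.1 ∧ p.2 < b ∧ NoBelow D p.1 b then y a p.2 * y p.1 p.2 * y p.1 b else 0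

/-- The coefficient of `y a b` in `cellParam D y a b`. -/
noncomputable def leadCoef (D : Set (ℕ × ℕ)) (y : Matrix (Fin n) (Fin n) R) (a b : Fin n) : R :=
  ∑ p, leadTerm D y a b p

/-- The part of `cellParam D y a b` free of `y a b`. -/
noncomputable def restCoef (D : Set (ℕ × ℕ)) (y : Matrix (Fin n) (Fin n) R) (a b : Fin n) : R :=
  ∑ p, restTerm D y a b p

lemma cellParam_eq (hD : IsBasic n D) (y : Matrix (Fin n) (Fin n) R) (a b : Fin n) :
    cellParam D y a b = leadCoef D y a b * y a b + restCoef D y a b := by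
  rw [leadCoef, restCoef, Finset.sum_mul, ← Finset.sum_add_distrib, cellParam, Matrix.mul_apply,
    Fintype.sum_prod_type_right]
  refine Finset.sum_congr rfl fun j _ => ?_
  rw [Matrix.mul_apply, Finset.sum_mul]
  refine Finset.sum_congr rfl fun i _ => ?_
  by_cases h : Mem D i j
  · rw [midParam, if_pos h, leadTerm, restTerm]
    simp only [h, if_true, true_and]
    rcases lt_trichotomy a i with hai | hai | hai
    · rw [leftParam_eq hD y h hai]
      rcases lt_trichotomy j b with hjb | hjb | hjb
      · rw [rightParam_eq hD y h hjb]
        by_cases hb : NoBelow D i b <;> simp [hai.ne', hjb.ne, hai, hjb, hb]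
      · subst hjb
        simp [rightParam_diag, hai.ne', hai, mul_comm]
      · simp [rightParam_upper y hjb, hai.ne', hjb.ne', hjb.not_gt]
    · subst hai
      rw [leftParam_diag]
      rcases lt_trichotomy j b with hjb | hjb | hjb
      · rw [rightParam_eq hD y h hjb]
        by_cases hb : NoBelow D a b <;> simp [hjb.ne, hjb, hb]
      · subst hjb
        simp [rightParam_diag]
      · simp [rightParam_upper y hjb, hjb.ne', hjb.not_gt]
    · simp [leftParam_upper y hai, hai.ne, hai.not_gt]
  · simp [midParam, leadTerm, restTerm, h]

/-- `(a, b)` is a place whose column has no root of `D` weakly below and whose row has no root of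
`D` weakly to the left. -/
def Free (D : Set (ℕ × ℕ)) (a b : Fin n) : Prop :=
  (∀ m ≤ b, ¬ Mem D a m) ∧ ∀ l ≥ a, ¬ Mem D l b

lemma mem_MD_iff_free (hD : IsBasic n D) {a b : Fin n} (h : b < a) :
    ((a : ℕ) + 1, (b : ℕ) + 1) ∈ MD n D ↔ Free D a b := by
  rw [mem_MD_iff hD]
  constructor
  · rintro ⟨-, h2, h3⟩
    exact ⟨fun m hm => h2 _ (by rw [Fin.le_def] at hm; omega),
      fun l hl => h3 _ (by rw [ge_iff_le, Fin.le_def] at hl; omega)⟩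
  · rintro ⟨h2, h3⟩
    rw [Fin.lt_def] at h
    refine ⟨⟨by simp, by simpa using h, by simp⟩, fun m hm hmem => ?_, fun l hl hmem => ?_⟩
    · have := (hD.1 _ hmem).1
      simp only at this
      refine h2 ⟨m - 1, by omega⟩ (by rw [Fin.le_def]; simp only; omega) ?_
      unfold Mem
      convert hmem using 2
      simp only
      omega
    · have := (hD.1 _ hmem).2.2
      simp only at this
      refine h3 ⟨l - 1, by omega⟩ (by rw [ge_iff_le, Fin.le_def]; simp only; omega) ?_
      unfold Mem
      convert hmem using 2
      simp only
      omega

lemma Free.noHook {a b : Fin n} (h : Free D a b) : NoHook D a b :=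
  ⟨fun m hm => h.1 m hm.le, fun l hl => h.2 l (le_of_lt hl)⟩

lemma Mem.noHook (hD : IsBasic n D) {a b : Fin n} (h : Mem D a b) : NoHook D a b :=
  ⟨fun _ hm h' => hm.ne (Mem.col_eq hD h' h), fun _ hl h' => (ne_of_lt hl) (Mem.row_eq hD h h')⟩

lemma Mem.lt (hD : IsBasic n D) {a b : Fin n} (h : Mem D a b) : b < a := by
  have := (hD.1 _ h).2.1
  rw [Fin.lt_def]
  simpa using this

lemma leadCoef_cases (hD : IsBasic n D) (y : Matrix (Fin n) (Fin n) R) {a b : Fin n} (hab : b < a)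
    (h : ¬ Free D a b) :
    leadCoef D y a b = 1 ∨ ∃ i j, Mem D i j ∧ placeKey i j < placeKey a b ∧
      leadCoef D y a b = y i j := by
  by_cases h1 : Mem D a b
  · left
    rw [leadCoef, Finset.sum_eq_single (a, b)]
    · simp [leadTerm, h1]
    · rintro ⟨i, j⟩ - hne
      rw [leadTerm]
      split_ifs with h2 h3 h4 h5
      · exact absurd (Prod.ext h3.1 h3.2) hne
      · obtain ⟨h4, rfl⟩ := h4
        exact absurd (h2.row_eq hD h1) h4.ne'
      · obtain ⟨rfl, h5, -⟩ := h5
        exact absurd (h2.col_eq hD h1) h5.ne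
      · rfl
      · rfl
    · simp
  · right
    by_cases h2 : ∃ i > a, Mem D i b
    · obtain ⟨i, hi, hm⟩ := h2
      refine ⟨i, b, hm, placeKey_lt_of_row hi, ?_⟩
      rw [leadCoef, Finset.sum_eq_single (i, b)]
      · simp [leadTerm, hm, hi, hi.ne']
      · rintro ⟨i', j'⟩ - hne
        rw [leadTerm]
        split_ifs with h2 h3 h4 h5
        · exact absurd (h3.1 ▸ h3.2 ▸ h2) h1
        · obtain ⟨h4, rfl⟩ := h4
          exact (hne (Prod.ext (h2.row_eq hD hm) rfl)).elim
        · exact absurd hm (h5.2.2 i hi)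
        · rfl
        · rfl
      · simp
    · push Not at h2
      have h3 : ∃ j < b, Mem D a j := by
        by_contra! h3
        refine h ⟨fun m hm => ?_, fun l hl => ?_⟩
        · rcases hm.lt_or_eq with hm | rfl
          · exact h3 m hm
          · exact h1
        · rcases hl.lt_or_eq with hl | rfl
          · exact h2 l hl
          · exact h1
      obtain ⟨j, hj, hm⟩ := h3
      refine ⟨a, j, hm, placeKey_lt_of_col hj, ?_⟩
      rw [leadCoef, Finset.sum_eq_single (a, j)]
      · simp [leadTerm, hm, hj, hj.ne, show NoBelow D a b from h2]
      · rintro ⟨i', j'⟩ - hne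
        rw [leadTerm]
        split_ifs with h6 h3 h4 h5
        · exact absurd (h3.1 ▸ h3.2 ▸ h6) h1
        · obtain ⟨h4, rfl⟩ := h4
          exact absurd h6 (h2 _ h4)
        · obtain ⟨rfl, h5, -⟩ := h5
          exact (hne (Prod.ext rfl (h6.col_eq hD hm))).elim
        · rfl
        · rfl
      · simp

lemma leadCoef_congr {y z : Matrix (Fin n) (Fin n) R} {a b : Fin n}
    (h : ∀ i j, placeKey i j < placeKey a b → y i j = z i j) :
    leadCoef D y a b = leadCoef D z a b := by
  refine Finset.sum_congr rfl fun p _ => ?_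
  rw [leadTerm, leadTerm]
  split_ifs with h1 h2 h3 h4
  · rfl
  · exact h _ _ (placeKey_lt_of_row h3.1)
  · exact h _ _ (placeKey_lt_of_col h4.2.1)
  · rfl
  · rfl

lemma restCoef_congr {y z : Matrix (Fin n) (Fin n) R} {a b : Fin n}
    (h : ∀ i j, placeKey i j < placeKey a b → y i j = z i j) :
    restCoef D y a b = restCoef D z a b := by
  refine Finset.sum_congr rfl fun p _ => ?_
  rw [restTerm, restTerm]
  split_ifs with h1
  · rw [h _ _ (placeKey_lt_of_col h1.2.2.1), h _ _ (placeKey_lt_of_col h1.2.2.1),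
      h _ _ (placeKey_lt_of_row h1.2.1)]
  · rfl

end Param

/-! ### The generic point of the cell -/

section Generic

variable {n : ℕ} {D : Set (ℕ × ℕ)} {K L : Type} [Field K] [Field L] [Algebra K L]

/-- The row of a positive root as a matrix index. -/
def rootRow (γ : PRoot n) : Fin n := ⟨γ.1.1 - 1, by obtain ⟨h1, h2, h3⟩ := γ.2; omega⟩

/-- The column of a positive root as a matrix index. -/
def rootCol (γ : PRoot n) : Fin n := ⟨γ.1.2 - 1, by obtain ⟨h1, h2, h3⟩ := γ.2; omega⟩

/-- The positive root at a place below the diagonal. -/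
def mkRoot (a b : Fin n) (h : b < a) : PRoot n :=
  ⟨((a : ℕ) + 1, (b : ℕ) + 1), by simp, by simpa using h, by simp⟩

@[simp] lemma rootRow_mkRoot (a b : Fin n) (h : b < a) : rootRow (mkRoot a b h) = a := rfl

@[simp] lemma rootCol_mkRoot (a b : Fin n) (h : b < a) : rootCol (mkRoot a b h) = b := rfl

lemma rootCol_lt_rootRow (γ : PRoot n) : rootCol γ < rootRow γ := by
  obtain ⟨h1, h2, h3⟩ := γ.2
  rw [Fin.lt_def]
  simp only [rootCol, rootRow]
  omega

lemma mkRoot_rootRow_rootCol (γ : PRoot n) :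
    mkRoot (rootRow γ) (rootCol γ) (rootCol_lt_rootRow γ) = γ := by
  obtain ⟨h1, h2, h3⟩ := γ.2
  refine Subtype.ext (Prod.ext ?_ ?_) <;> simp only [mkRoot, rootRow, rootCol] <;> omega

lemma isPosRoot_iff_lt {a b : Fin n} : IsPosRoot n ((a : ℕ) + 1, (b : ℕ) + 1) ↔ b < a := by
  rw [Fin.lt_def]
  constructor
  · intro h
    have := h.2.1
    simp only at this
    omega
  · intro h
    exact ⟨by simp, by simpa using h, by simp⟩

lemma matOf_apply (v : PRoot n → K) {a b : Fin n} (h : b < a) :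
    matOf n K v a b = v (mkRoot a b h) := dif_pos (isPosRoot_iff_lt.2 h)

lemma matOf_apply_of_le (v : PRoot n → K) {a b : Fin n} (h : a ≤ b) : matOf n K v a b = 0 :=
  dif_neg fun h' => (isPosRoot_iff_lt.1 h').not_ge h

lemma matOf_root (v : PRoot n → K) (γ : PRoot n) : matOf n K v (rootRow γ) (rootCol γ) = v γ := by
  rw [matOf_apply v (rootCol_lt_rootRow γ), mkRoot_rootRow_rootCol]

lemma matOf_vecOf (A : Matrix (Fin n) (Fin n) K) {a b : Fin n} (h : b < a) :
    matOf n K (vecOf n K A) a b = A a b := matOf_apply _ h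

lemma genMat_map {R : Type} [CommRing R] [Algebra K R] (x : PRoot n → R) (a b : Fin n) :
    MvPolynomial.aeval x (genMat n K a b) = if h : b < a then x (mkRoot a b h) else 0 := by
  unfold genMat
  by_cases h : b < a
  · rw [dif_pos (isPosRoot_iff_lt.2 h), dif_pos h, MvPolynomial.aeval_X]
    rfl
  · rw [dif_neg (fun h' => h (isPosRoot_iff_lt.1 h')), dif_neg h, map_zero]

lemma aeval_genMat (x : PRoot n → L) (a b : Fin n) :
    MvPolynomial.aeval x (genMat n K a b) = matOf n L x a b := by
  rw [genMat_map]
  split_ifs with h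
  · rw [matOf_apply x h]
  · rw [matOf_apply_of_le x (not_lt.1 h)]

/-- Minors of the generic matrix specialize to minors. -/
lemma aeval_det_genMat {ι : Type} [Fintype ι] [DecidableEq ι] (x : PRoot n → L)
    (r c : ι → Fin n) :
    MvPolynomial.aeval x ((genMat n K).submatrix r c).det =
      ((matOf n L x).submatrix r c).det := by
  have h : (matOf n L x).submatrix r c =
      (MvPolynomial.aeval x : MvPolynomial (PRoot n) K →ₐ[K] L).mapMatrix
        ((genMat n K).submatrix r c) := by
    ext p q
    exact (aeval_genMat x _ _).symm
  rw [h, AlgHom.map_det]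

lemma inCell_of_mem_VDcell {v : PRoot n → K} (hv : v ∈ VDcell n K D) :
    InCell D (matOf n K v) := by
  obtain ⟨φ, hφ, g, h, hg, hh, rfl⟩ := hv
  refine ⟨φ, g, h, hφ, fun i j hij => hg.2 i j hij, fun i j hij => hh.2 i j hij,
    fun a => by simp [hg.1], fun a => by simp [hh.1], fun a b (hab : b < a) => ?_⟩
  rw [Matrix.sub_apply, matOf_vecOf _ hab, lowerPart, if_pos (by exact hab), sub_self]

lemma VDcell_nonempty (n : ℕ) (K : Type) [Field K] (D : Set (ℕ × ℕ)) :
    (VDcell n K D).Nonempty := by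
  have h1 : IsUni n K 1 := ⟨fun i => by simp, fun i j h => Matrix.one_apply_ne h.ne'⟩
  exact ⟨_, fun _ => 1, fun _ _ => one_ne_zero, 1, 1, h1, h1, rfl⟩

/-- `x` is a generic point of the cell: the polynomial relations among its coordinates are exactly
those of the cell. -/
def IsGenericOn (K : Type) {L : Type} [Field K] [Field L] [Algebra K L] (D : Set (ℕ × ℕ))
    (x : PRoot n → L) : Prop :=
  ∀ p : MvPolynomial (PRoot n) K,
    MvPolynomial.aeval x p = 0 ↔ p ∈ vanishing (PRoot n) K (VDcell n K D)

variable {x : PRoot n → L}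

lemma IsGenericOn.det_eq_zero (hx : IsGenericOn K D x) {ι : Type} [Fintype ι] [DecidableEq ι]
    {r c : ι → Fin n} (h : ∀ v ∈ VDcell n K D, ((matOf n K v).submatrix r c).det = 0) :
    ((matOf n L x).submatrix r c).det = 0 := by
  rw [← aeval_det_genMat (K := K), hx]
  intro v hv
  rw [← h v hv, ← aeval_det_genMat (K := K)]
  rfl

lemma IsGenericOn.det_ne_zero (hx : IsGenericOn K D x) {ι : Type} [Fintype ι] [DecidableEq ι]
    {r c : ι → Fin n} (h : ∀ v ∈ VDcell n K D, ((matOf n K v).submatrix r c).det ≠ 0) :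
    ((matOf n L x).submatrix r c).det ≠ 0 := by
  obtain ⟨v, hv⟩ := VDcell_nonempty n K D
  rw [← aeval_det_genMat (K := K), Ne, hx]
  intro h'
  apply h v hv
  rw [← h' v hv, ← aeval_det_genMat (K := K)]
  rfl

lemma IsGenericOn.det_swBlock_ne_zero (hx : IsGenericOn K D x) (hD : IsBasic n D)
    {i j : Fin n} (hij : j < i) : (swBlock D (matOf n L x) i j).det ≠ 0 :=
  hx.det_ne_zero fun _ hv => (inCell_of_mem_VDcell hv).det_swBlock_ne_zero hD hij

lemma IsGenericOn.det_borderedBlock_ne_zero (hx : IsGenericOn K D x) (hD : IsBasic n D)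
    {i j : Fin n} (h : Mem D i j) : (borderedBlock D (matOf n L x) i j).det ≠ 0 := by
  refine hx.det_ne_zero fun v hv => ?_
  have hc := inCell_of_mem_VDcell hv
  have h0 := hc.det_swBlock_ne_zero hD (h.lt hD)
  have := det_borderedBlock_eq h0
  rw [borderedBlock] at this
  rw [this]
  exact mul_ne_zero h0 (sub_ne_zero.2 (hc.ne_schurEntry hD (h.lt hD) (h.noHook hD) h))

lemma IsGenericOn.eq_schurEntry (hx : IsGenericOn K D x) (hD : IsBasic n D)
    {i j : Fin n} (hij : j < i) (h : Free D i j) :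
    matOf n L x i j = schurEntry D (matOf n L x) i j := by
  have h0 := hx.det_swBlock_ne_zero hD hij
  have h1 : (borderedBlock D (matOf n L x) i j).det = 0 := by
    refine hx.det_eq_zero fun v hv => ?_
    have hc := inCell_of_mem_VDcell hv
    have := det_borderedBlock_eq (hc.det_swBlock_ne_zero hD hij)
    rw [borderedBlock] at this
    rw [this, hc.eq_schurEntry hD hij h.noHook (h.1 j le_rfl), sub_self, mul_zero]
  rw [det_borderedBlock_eq h0] at h1
  exact sub_eq_zero.1 ((mul_eq_zero.1 h1).resolve_left h0)

lemma exists_XDphi_eq (y : Matrix (Fin n) (Fin n) L) :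
    ∃ φ : ℕ × ℕ → L, XDphi n L D φ = midParam D y := by
  refine ⟨fun γ => if h : γ.1 - 1 < n ∧ γ.2 - 1 < n then y ⟨γ.1 - 1, h.1⟩ ⟨γ.2 - 1, h.2⟩ else 1, ?_⟩
  ext a b
  by_cases h : ((a : ℕ) + 1, (b : ℕ) + 1) ∈ D
  · rw [XDphi, midParam, if_pos h, if_pos (by exact h)]
    simp
  · rw [XDphi, midParam, if_neg h, if_neg (by exact h)]

lemma cellParam_sub_upper (y X : Matrix (Fin n) (Fin n) L) {φ : ℕ × ℕ → L}
    (hφ : XDphi n L D φ = midParam D y) (hX : ∀ a b, b < a → X a b = cellParam D y a b) :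
    (X - leftParam D y * XDphi n L D φ * rightParam D y).BlockTriangular id := by
  intro a b hab
  rw [hφ, Matrix.sub_apply, hX a b hab, cellParam, sub_self]

lemma inCell_of_eq_cellParam (hD : IsBasic n D) {y X : Matrix (Fin n) (Fin n) L}
    (hy : ∀ i j, Mem D i j → y i j ≠ 0)
    (hX : ∀ a b, b < a → X a b = cellParam D y a b) : InCell D X := by
  obtain ⟨φ, hφ⟩ := exists_XDphi_eq (D := D) y
  refine ⟨φ, leftParam D y, rightParam D y, ?_, leftParam_upper y, rightParam_upper y,
    fun a => by simp [leftParam_diag], fun a => by simp [rightParam_diag],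
    cellParam_sub_upper y X hφ hX⟩
  rintro ⟨i, j⟩ hij
  have hpos := hD.1 _ hij
  obtain ⟨h1, h2, h3⟩ := hpos
  simp only at h1 h2 h3
  have hm : Mem D (⟨i - 1, by omega⟩ : Fin n) ⟨j - 1, by omega⟩ := by
    unfold Mem
    convert hij using 2 <;> simp only <;> omega
  have h4 := congrFun (congrFun hφ ⟨i - 1, by omega⟩) ⟨j - 1, by omega⟩
  rw [midParam, if_pos hm, XDphi, if_pos (by exact hm)] at h4
  have h5 := hy _ _ hm
  rw [← h4] at h5
  convert h5 using 3 <;> simp only <;> omega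

/-- Bordered minors at roots of `D` are invariant under unipotent conjugation. -/
lemma det_borderedBlock_conj (hD : IsBasic n D) {y X g : Matrix (Fin n) (Fin n) L}
    (hX : ∀ a b, b < a → X a b = cellParam D y a b) (hg : g.BlockTriangular id)
    (hd : ∀ a, g a a = 1) {i j : Fin n} (hij : Mem D i j) :
    (borderedBlock D (g * X * g⁻¹) i j).det = (borderedBlock D X i j).det := by
  obtain ⟨φ, hφ⟩ := exists_XDphi_eq (D := D) y
  have hu := isUnit_det_of_upper hg fun a => by simp [hd]
  have hi := upper_inv hg hu
  have h0 := cellParam_sub_upper y X hφ hX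
  have h1 : (g * X * g⁻¹ - (g * leftParam D y) * XDphi n L D φ *
      (rightParam D y * g⁻¹)).BlockTriangular id := by
    have := upper_conj hg hi h0
    convert this using 1
    noncomm_ring
  rw [det_borderedBlock hD (leftParam_upper y) (rightParam_upper y) h0 (hij.lt hD) (hij.noHook hD),
    det_borderedBlock hD (hg.mul (leftParam_upper y)) ((rightParam_upper y).mul hi) h1 (hij.lt hD)
      (hij.noHook hD)]
  simp [upper_mul_diag hg (leftParam_upper y), upper_mul_diag (rightParam_upper y) hi,
    upper_inv_diag hg (fun a => by simp [hd]), hd, leftParam_diag, rightParam_diag]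

lemma leadCoef_ne_zero (hD : IsBasic n D) {y : Matrix (Fin n) (Fin n) L}
    (hy : ∀ i j, Mem D i j → y i j ≠ 0) {a b : Fin n} (hab : b < a) (h : ¬ Free D a b) :
    leadCoef D y a b ≠ 0 := by
  rcases leadCoef_cases hD y hab h with h1 | ⟨i, j, hm, -, h1⟩
  · rw [h1]
    exact one_ne_zero
  · rw [h1]
    exact hy i j hm

/-- The generic point lies in the image of the parametrization. -/
lemma IsGenericOn.exists_cellParam_eq (hx : IsGenericOn K D x) (hD : IsBasic n D) :
    ∃ y : Matrix (Fin n) (Fin n) L, (∀ i j, Mem D i j → y i j ≠ 0) ∧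
      ∀ a b, b < a → matOf n L x a b = cellParam D y a b := by
  have step : ∀ k, ∃ y : Matrix (Fin n) (Fin n) L, (∀ i j, Mem D i j → y i j ≠ 0) ∧
      ∀ a b, b < a → placeKey a b < k → matOf n L x a b = cellParam D y a b := by
    intro k
    induction k with
    | zero => exact ⟨fun _ _ => 1, fun _ _ _ => one_ne_zero, fun _ _ _ h => absurd h (by omega)⟩
    | succ k ih =>
      obtain ⟨y, hy, hyk⟩ := ih
      by_cases hk : ∃ a b : Fin n, b < a ∧ placeKey a b = k
      swap
      · push Not at hk
        refine ⟨y, hy, fun a b hab h => hyk a b hab ?_⟩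
        have := hk a b hab
        omega
      obtain ⟨a, b, hab, rfl⟩ := hk
      have hearlier : ∀ a' b', a ≤ a' → b' ≤ b → (a', b') ≠ (a, b) →
          b' < a' ∧ placeKey a' b' < placeKey a b := by
        intro a' b' h1 h2 h3
        refine ⟨h2.trans_lt (hab.trans_le h1), placeKey_lt_iff.2 ?_⟩
        rcases h2.lt_or_eq with h2 | rfl
        · exact Or.inl h2
        · refine Or.inr ⟨rfl, h1.lt_of_ne fun h => h3 (by rw [h])⟩
      have hlast : ∀ z : Matrix (Fin n) (Fin n) L,
          (∀ a' b', b' < a' → placeKey a' b' < placeKey a b →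
            matOf n L x a' b' = cellParam D z a' b') →
          matOf n L x a b = cellParam D z a b →
          ∀ a' b', b' < a' → placeKey a' b' < placeKey a b + 1 →
            matOf n L x a' b' = cellParam D z a' b' := by
        intro z h1 h2 a' b' h3 h4
        rcases Nat.lt_succ_iff_lt_or_eq.1 h4 with h4 | h4
        · exact h1 a' b' h3 h4
        · obtain ⟨rfl, rfl⟩ := placeKey_injective h4
          exact h2
      by_cases hfree : Free D a b
      · refine ⟨y, hy, hlast y hyk ?_⟩
        have hc := inCell_of_eq_cellParam hD hy (X := cellParam D y) fun _ _ _ => rfl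
        rw [hx.eq_schurEntry hD hab hfree, hc.eq_schurEntry hD hab hfree.noHook (hfree.1 b le_rfl)]
        refine schurEntry_congr fun a' b' h1 h2 h3 => ?_
        have := hearlier a' b' h1 h2 h3
        exact hyk a' b' this.1 this.2
      · set t := (matOf n L x a b - restCoef D y a b) / leadCoef D y a b with ht
        let z : Matrix (Fin n) (Fin n) L := fun i j => if (i, j) = (a, b) then t else y i j
        have hz : ∀ i j, placeKey i j < placeKey a b → z i j = y i j := by
          intro i j h
          refine if_neg fun h' => ?_
          simp only [Prod.mk.injEq] at h'
          rw [h'.1, h'.2] at h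
          omega
        have hzab : z a b = t := if_pos rfl
        have h1 : ∀ a' b', b' < a' → placeKey a' b' < placeKey a b →
            matOf n L x a' b' = cellParam D z a' b' := by
          intro a' b' h1 h2
          rw [hyk a' b' h1 h2, cellParam_eq hD, cellParam_eq hD, hz a' b' h2,
            leadCoef_congr fun i j h => hz i j (h.trans h2),
            restCoef_congr fun i j h => hz i j (h.trans h2)]
        have h2 : matOf n L x a b = cellParam D z a b := by
          rw [cellParam_eq hD, leadCoef_congr hz, restCoef_congr hz, hzab, ht,
            mul_div_cancel₀ _ (leadCoef_ne_zero hD hy hab hfree)]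
          ring
        refine ⟨z, fun i j hm => ?_, hlast z h1 h2⟩
        by_cases hij : (i, j) = (a, b)
        · simp only [Prod.mk.injEq] at hij
          obtain ⟨rfl, rfl⟩ := hij
          intro h0
          apply hx.det_borderedBlock_ne_zero hD hm
          obtain ⟨φ, hφ⟩ := exists_XDphi_eq (D := D) z
          have h3 := det_borderedBlock hD (leftParam_upper z) (rightParam_upper z)
            (cellParam_sub_upper z (cellParam D z) hφ fun _ _ _ => rfl) hab (hm.noHook hD)
          rw [hφ, show midParam D z i j = 0 by rw [midParam, if_pos hm, h0], mul_zero, zero_mul,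
            mul_zero] at h3
          rw [← h3]
          congr 1
          have h4 : ∀ a' b', i ≤ a' → b' ≤ j → matOf n L x a' b' = cellParam D z a' b' := by
            intro a' b' h4 h5
            by_cases h6 : (a', b') = (i, j)
            · simp only [Prod.mk.injEq] at h6
              rw [h6.1, h6.2, h2]
            · have := hearlier a' b' h4 h5 h6
              exact h1 _ _ this.1 this.2
          ext p q
          refine h4 _ _ ?_ ?_
          · rcases p with p | p
            · exact p.2.2.1.le
            · exact le_rfl
          · rcases q with q | q
            · exact q.2.2.2.le
            · exact le_rfl
        · rw [show z i j = y i j from if_neg hij]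
          exact hy i j hm
  obtain ⟨y, hy, h⟩ := step (n * n)
  refine ⟨y, hy, fun a b hab => h a b hab ?_⟩
  unfold placeKey
  have : ((b : ℕ) + 1) * n ≤ n * n := Nat.mul_le_mul_right n b.2
  rw [add_mul] at this
  omega

lemma IsGenericOn.inCell (hx : IsGenericOn K D x) (hD : IsBasic n D) :
    InCell D (matOf n L x) := by
  obtain ⟨y, hy, h⟩ := hx.exists_cellParam_eq hD
  exact inCell_of_eq_cellParam hD hy h

end Generic

/-! ### Transcendence of the coordinates of the generic point -/

section Coordinates

variable {n : ℕ} {D : Set (ℕ × ℕ)} {K L : Type} [Field K] [Field L] [Algebra K L]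

lemma cellParam_map {R S : Type} [CommRing R] [CommRing S] (f : R →+* S)
    (y : Matrix (Fin n) (Fin n) R) : cellParam D (y.map f) = (cellParam D y).map f := by
  have h1 : leftParam D (y.map f) = (leftParam D y).map f := by
    ext a b
    simp only [leftParam, Matrix.map_apply, apply_ite f, map_one, map_sum, map_zero]
  have h2 : midParam D (y.map f) = (midParam D y).map f := by
    ext a b
    simp only [midParam, Matrix.map_apply, apply_ite f, map_zero]
  have h3 : rightParam D (y.map f) = (rightParam D y).map f := by
    ext a b
    simp only [rightParam, Matrix.map_apply, apply_ite f, map_one, map_sum, map_zero]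
  rw [cellParam, cellParam, h1, h2, h3, Matrix.map_mul, Matrix.map_mul]

lemma leadCoef_mem (E : IntermediateField K L) {y : Matrix (Fin n) (Fin n) L} {a b : Fin n}
    (h : ∀ i j, placeKey i j < placeKey a b → y i j ∈ E) : leadCoef D y a b ∈ E := by
  refine sum_mem fun p _ => ?_
  rw [leadTerm]
  split_ifs with h1 h2 h3 h4
  · exact one_mem E
  · exact h _ _ (placeKey_lt_of_row h3.1)
  · exact h _ _ (placeKey_lt_of_col h4.2.1)
  · exact zero_mem E
  · exact zero_mem E

lemma restCoef_mem (E : IntermediateField K L) {y : Matrix (Fin n) (Fin n) L} {a b : Fin n}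
    (h : ∀ i j, placeKey i j < placeKey a b → y i j ∈ E) : restCoef D y a b ∈ E := by
  refine sum_mem fun p _ => ?_
  rw [restTerm]
  split_ifs with h1
  · exact mul_mem (mul_mem (h _ _ (placeKey_lt_of_col h1.2.2.1))
      (h _ _ (placeKey_lt_of_col h1.2.2.1))) (h _ _ (placeKey_lt_of_row h1.2.1))
  · exact zero_mem E

/-- The field generated by the entries of `X` that come before position `k`. -/
noncomputable def earlierField (K : Type) [Field K] [Algebra K L] (X : Matrix (Fin n) (Fin n) L)
    (k : ℕ) : IntermediateField K L :=
  IntermediateField.adjoin K {z | ∃ a b, placeKey a b < k ∧ X a b = z}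

lemma mem_earlierField (X : Matrix (Fin n) (Fin n) L) {k : ℕ} {a b : Fin n}
    (h : placeKey a b < k) : X a b ∈ earlierField K X k :=
  IntermediateField.subset_adjoin K _ ⟨a, b, h, rfl⟩

lemma earlierField_le {X : Matrix (Fin n) (Fin n) L} {k : ℕ} {E : IntermediateField K L}
    (h : ∀ a b, placeKey a b < k → X a b ∈ E) : earlierField K X k ≤ E := by
  rw [earlierField, IntermediateField.adjoin_le_iff]
  rintro _ ⟨a, b, hk, rfl⟩
  exact h a b hk

lemma earlierField_mono (X : Matrix (Fin n) (Fin n) L) {k l : ℕ} (h : k ≤ l) :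
    earlierField K X k ≤ earlierField K X l :=
  earlierField_le fun _ _ hk => mem_earlierField X (hk.trans_le h)

/-- Entries of a matrix with algebraically independent entries are transcendental over the
earlier ones. -/
lemma transcendental_earlierField {y : Matrix (Fin n) (Fin n) L}
    (hy : AlgebraicIndependent K fun p : Fin n × Fin n => y p.1 p.2) (a b : Fin n) :
    Transcendental (earlierField K y (placeKey a b)) (y a b) := by
  have h := hy.transcendental_adjoin (s := {p | placeKey p.1 p.2 < placeKey a b}) (i := (a, b))
    (by simp)
  rw [← IntermediateField.transcendental_adjoin_iff] at h
  refine h.of_le (earlierField_le fun a' b' hk => ?_)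
  exact IntermediateField.subset_adjoin K _ ⟨(a', b'), hk, rfl⟩

/-- The non-free entries of the parametrization with algebraically independent parameters are
algebraically independent. -/
lemma algebraicIndependent_cellParam (hD : IsBasic n D) {y : Matrix (Fin n) (Fin n) L}
    (hy : AlgebraicIndependent K fun p : Fin n × Fin n => y p.1 p.2) :
    AlgebraicIndependent K fun γ : {γ : PRoot n // ¬ Free D (rootRow γ) (rootCol γ)} =>
      cellParam D y (rootRow γ.1) (rootCol γ.1) := by
  have : Finite {γ : PRoot n // ¬ Free D (rootRow γ) (rootCol γ)} := by
    refine Finite.of_injective (fun γ => (rootRow γ.1, rootCol γ.1)) fun γ γ' h => ?_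
    simp only [Prod.mk.injEq] at h
    refine Subtype.ext ?_
    rw [← mkRoot_rootRow_rootCol γ.1, ← mkRoot_rootRow_rootCol γ'.1]
    simp only [h.1, h.2]
  refine algebraicIndependent_of_triangular
    (key := fun γ => placeKey (rootRow γ.1) (rootCol γ.1)) ?_
    (fun γ => earlierField K y (placeKey (rootRow γ.1) (rootCol γ.1))) ?_ ?_
  · intro γ γ' h
    obtain ⟨h1, h2⟩ := placeKey_injective h
    refine Subtype.ext ?_
    rw [← mkRoot_rootRow_rootCol γ.1, ← mkRoot_rootRow_rootCol γ'.1]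
    simp only [h1, h2]
  · intro γ γ' h
    rw [cellParam_eq hD]
    exact add_mem (mul_mem (leadCoef_mem _ fun i j h' => mem_earlierField y (h'.trans h))
      (mem_earlierField y h)) (restCoef_mem _ fun i j h' => mem_earlierField y (h'.trans h))
  · intro γ
    rw [cellParam_eq hD]
    refine (transcendental_earlierField hy _ _).mul_add
      (leadCoef_mem _ fun i j h' => mem_earlierField y h')
      (restCoef_mem _ fun i j h' => mem_earlierField y h')
      (leadCoef_ne_zero hD (fun i j _ => ?_) (rootCol_lt_rootRow γ.1) γ.2)
    exact fun h0 => (hy.transcendental (i, j)) (by simp only [h0]; exact isAlgebraic_zero)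

lemma mem_VDcell_of_cellParam (hD : IsBasic n D) {y : Matrix (Fin n) (Fin n) K}
    (hy : ∀ i j, Mem D i j → y i j ≠ 0) :
    (fun γ => cellParam D y (rootRow γ) (rootCol γ)) ∈ VDcell n K D := by
  obtain ⟨φ, hφ⟩ := exists_XDphi_eq (D := D) y
  refine ⟨φ, ?_, leftParam D y, rightParam D y,
    ⟨leftParam_diag y, fun i j h => leftParam_upper y h⟩,
    ⟨rightParam_diag y, fun i j h => rightParam_upper y h⟩, ?_⟩
  · rintro ⟨i, j⟩ hij
    obtain ⟨h1, h2, h3⟩ := hD.1 _ hij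
    simp only at h1 h2 h3
    have hm : Mem D (⟨i - 1, by omega⟩ : Fin n) ⟨j - 1, by omega⟩ := by
      unfold Mem
      convert hij using 2 <;> simp only <;> omega
    have h4 := congrFun (congrFun hφ ⟨i - 1, by omega⟩) ⟨j - 1, by omega⟩
    rw [midParam, if_pos hm, XDphi, if_pos (by exact hm)] at h4
    have h5 := hy _ _ hm
    rw [← h4] at h5
    convert h5 using 3 <;> simp only <;> omega
  · funext γ
    have : (rootCol γ : ℕ) < (rootRow γ : ℕ) := rootCol_lt_rootRow γ
    change _ = lowerPart n K _ (rootRow γ) (rootCol γ)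
    rw [lowerPart, if_pos this, hφ]
    rfl

variable {x : PRoot n → L}

/-- The non-free coordinates of the generic point are algebraically independent. -/
lemma IsGenericOn.algebraicIndependent [CharZero K] (hx : IsGenericOn K D x) (hD : IsBasic n D) :
    AlgebraicIndependent K fun γ : {γ : PRoot n // ¬ Free D (rootRow γ) (rootCol γ)} => x γ.1 := by
  rw [algebraicIndependent_iff]
  intro p hp
  let P := MvPolynomial (Fin n × Fin n) K
  let yP : Matrix (Fin n) (Fin n) P := fun a b => MvPolynomial.X (a, b)
  let yF : Matrix (Fin n) (Fin n) (FractionRing P) := yP.map (algebraMap P (FractionRing P))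
  have hyF : AlgebraicIndependent K fun p : Fin n × Fin n => yF p.1 p.2 :=
    (MvPolynomial.algebraicIndependent_X (Fin n × Fin n) K).map'
      (f := IsScalarTower.toAlgHom K P (FractionRing P)) (IsFractionRing.injective P _)
  have hind := algebraicIndependent_cellParam hD hyF
  rw [algebraicIndependent_iff] at hind
  apply hind
  have hF : MvPolynomial.aeval (fun γ : {γ : PRoot n // ¬ Free D (rootRow γ) (rootCol γ)} =>
      cellParam D yF (rootRow γ.1) (rootCol γ.1)) p = algebraMap P (FractionRing P)
      (MvPolynomial.aeval (fun γ : {γ : PRoot n // ¬ Free D (rootRow γ) (rootCol γ)} =>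
      cellParam D yP (rootRow γ.1) (rootCol γ.1)) p) := by
    rw [← MvPolynomial.aeval_algebraMap_apply]
    congr 2
    funext γ
    rw [cellParam_map, Matrix.map_apply]
    rfl
  rw [hF]
  set q := MvPolynomial.aeval (fun γ : {γ : PRoot n // ¬ Free D (rootRow γ) (rootCol γ)} =>
      cellParam D yP (rootRow γ.1) (rootCol γ.1)) p with hq
  have hprod : q * ∏ r : Fin n × Fin n, (if Mem D r.1 r.2 then MvPolynomial.X r else 1) = 0 := by
    refine MvPolynomial.funext fun z => ?_
    rw [map_mul, map_prod, map_zero]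
    by_cases hz : ∀ i j, Mem D i j → z (i, j) ≠ 0
    · refine mul_eq_zero_of_left ?_ _
      have hv := mem_VDcell_of_cellParam hD (y := fun i j => z (i, j)) hz
      have hp' : MvPolynomial.rename Subtype.val p ∈
          vanishing (PRoot n) K (VDcell n K D) := by
        rw [← hx, MvPolynomial.aeval_rename]
        exact hp
      have h1 := hp' _ hv
      rw [MvPolynomial.eval_rename] at h1
      rw [hq, ← h1, ← MvPolynomial.coe_aeval_eq_eval, ← MvPolynomial.coe_aeval_eq_eval,
        RingHom.coe_coe, RingHom.coe_coe, ← AlgHom.comp_apply, MvPolynomial.comp_aeval]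
      congr 2
      funext γ
      have := cellParam_map (D := D) (MvPolynomial.eval z) yP
      have h2 := congrFun (congrFun this (rootRow γ.1)) (rootCol γ.1)
      rw [Matrix.map_apply] at h2
      refine h2.symm.trans ?_
      have h3 : yP.map (MvPolynomial.eval z) = fun i j => z (i, j) := by
        ext i j
        exact MvPolynomial.eval_X (i, j)
      rw [h3]
      rfl
    · push Not at hz
      obtain ⟨i, j, hm, hz⟩ := hz
      refine mul_eq_zero_of_right _ (Finset.prod_eq_zero (Finset.mem_univ (i, j)) ?_)
      rw [if_pos hm, MvPolynomial.eval_X, hz]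
  have h0 : (∏ r : Fin n × Fin n, (if Mem D r.1 r.2 then MvPolynomial.X r else 1) : P) ≠ 0 := by
    refine Finset.prod_ne_zero_iff.2 fun r _ => ?_
    split_ifs
    · exact MvPolynomial.X_ne_zero r
    · exact one_ne_zero
  rw [(mul_eq_zero.1 hprod).resolve_right h0, map_zero]

/-- A non-free entry of the generic matrix is transcendental over the earlier entries. -/
lemma IsGenericOn.transcendental [CharZero K] (hx : IsGenericOn K D x) (hD : IsBasic n D)
    {a b : Fin n} (hab : b < a) (h : ¬ Free D a b) :
    Transcendental (earlierField K (matOf n L x) (placeKey a b)) (matOf n L x a b) := by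
  have h1 := (hx.algebraicIndependent hD).transcendental_adjoin
    (s := {γ | placeKey (rootRow γ.1) (rootCol γ.1) < placeKey a b}) (i := ⟨mkRoot a b hab, h⟩)
    (by simp)
  rw [← IntermediateField.transcendental_adjoin_iff] at h1
  rw [matOf_apply x hab]
  refine h1.of_le ?_
  set E := IntermediateField.adjoin K
    ((fun γ : {γ : PRoot n // ¬ Free D (rootRow γ) (rootCol γ)} => x γ.1) ''
      {γ | placeKey (rootRow γ.1) (rootCol γ.1) < placeKey a b}) with hE
  have key : ∀ k ≤ placeKey a b, ∀ a' b', placeKey a' b' < k → matOf n L x a' b' ∈ E := by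
    intro k
    induction k with
    | zero => intro _ _ _ h; omega
    | succ k ih =>
      intro hk a' b' hk'
      by_cases hlt : b' < a'
      swap
      · rw [matOf_apply_of_le x (not_lt.1 hlt)]
        exact zero_mem E
      by_cases hf : Free D a' b'
      · rw [hx.eq_schurEntry hD hlt hf]
        refine schurEntry_mem E fun i j h2 h3 h4 => ih (by omega) i j ?_
        have : placeKey i j < placeKey a' b' := by
          rw [placeKey_lt_iff]
          rcases h3.lt_or_eq with h3 | rfl
          · exact Or.inl h3
          · exact Or.inr ⟨rfl, h2.lt_of_ne fun h => h4 (by rw [h])⟩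
        omega
      · rw [matOf_apply x hlt]
        exact IntermediateField.subset_adjoin K _ ⟨⟨mkRoot a' b' hlt, hf⟩,
          by simp only [Set.mem_ofPred_eq, rootRow_mkRoot, rootCol_mkRoot]; omega, rfl⟩
  exact earlierField_le fun a' b' hk => key _ le_rfl a' b' hk

end Coordinates

/-! ### The dimension of the stabilizer of the generic point -/

section Rank

variable {n : ℕ} {D : Set (ℕ × ℕ)} {K L : Type} [Field K] [Field L] [Algebra K L]

/-- Triangular conjugation changes an entry affinely, with coefficients in any field containing
the entries of the conjugating matrices and the entries to the lower left. -/
lemma triangular_mul_apply_mem (E : IntermediateField K L) {h X g : Matrix (Fin n) (Fin n) L}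
    (hh : h.BlockTriangular id) (hg : g.BlockTriangular id) (hhE : ∀ a b, h a b ∈ E)
    (hgE : ∀ a b, g a b ∈ E) {i j : Fin n}
    (hX : ∀ a b, i ≤ a → b ≤ j → (a, b) ≠ (i, j) → X a b ∈ E) :
    (h * X * g) i j - h i i * X i j * g j j ∈ E := by
  have h1 : (h * X * g) i j = ∑ p : Fin n × Fin n, h i p.1 * X p.1 p.2 * g p.2 j := by
    rw [Matrix.mul_apply, Fintype.sum_prod_type_right]
    refine Finset.sum_congr rfl fun b _ => ?_
    rw [Matrix.mul_apply, Finset.sum_mul]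
  rw [h1, ← Finset.sum_erase_add _ _ (Finset.mem_univ (i, j)), add_sub_cancel_right]
  refine sum_mem fun p hp => ?_
  rcases lt_or_ge p.1 i with h2 | h2
  · rw [hh (show id p.1 < id i from h2), zero_mul, zero_mul]
    exact zero_mem E
  rcases lt_or_ge j p.2 with h3 | h3
  · rw [hg (show id j < id p.2 from h3), mul_zero]
    exact zero_mem E
  · exact mul_mem (mul_mem (hhE _ _) (hX _ _ h2 h3 (Finset.ne_of_mem_erase hp))) (hgE _ _)

lemma placeKey_lt_mul_iff {a b : Fin n} {c : ℕ} : placeKey a b < c * n ↔ (b : ℕ) < c := by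
  unfold placeKey
  constructor
  · intro h
    by_contra hle
    have : c * n ≤ b * n := Nat.mul_le_mul_right n (not_lt.1 hle)
    omega
  · intro h
    have : ((b : ℕ) + 1) * n ≤ c * n := Nat.mul_le_mul_right n h
    rw [add_mul] at this
    omega

lemma mem_earlierField_of_lowerLeft (X : Matrix (Fin n) (Fin n) L) {i j a b : Fin n} (h1 : i ≤ a)
    (h2 : b ≤ j) (h3 : (a, b) ≠ (i, j)) : X a b ∈ earlierField K X (placeKey i j) := by
  refine mem_earlierField X (placeKey_lt_iff.2 ?_)
  rcases h2.lt_or_eq with h2 | rfl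
  · exact Or.inl h2
  · exact Or.inr ⟨rfl, h1.lt_of_ne fun h => h3 (by rw [h])⟩

/-- Row `k` of the inverse of `recordMat` for a row that does not meet `D` up to column `c`. -/
lemma recordMat_inv_row (hD : IsBasic n D) {c : Fin n} {y : Fin n → L}
    (hy : ∀ k : Fin n, IsRecord n (tauD n D (c + 1)) (c + 1) (topRow D (c + 1)) (k + 1) → y k ≠ 0)
    {k : Fin n} (hck : c < k) (hk : ∀ m ≤ c, ¬ Mem D k m) (Y : Fin n → L) :
    (∃ l : Fin n, Mem D l c ∧
      ∑ a, (recordMat (tauD n D (c + 1)) c (topRow D (c + 1)) y)⁻¹ k a * Y a =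
        Y k - y k / y l * Y l) ∨
    (Free D k c ∧
      ∑ a, (recordMat (tauD n D (c + 1)) c (topRow D (c + 1)) y)⁻¹ k a * Y a = Y k) := by
  set τ := tauD n D (c + 1) with hτ
  set T := topRow D (c + 1) with hT
  set g := recordMat τ c T y with hg
  have hu : IsUnit g.det := recordMat_isUnit hy
  have hsolve : ∀ r : Fin n → L, (∀ a, ∑ b, r b * g b a = if k = a then 1 else 0) →
      ∀ a, g⁻¹ k a = r a := by
    intro r hr a
    have h1 : Matrix.vecMul r g = fun a => (1 : Matrix (Fin n) (Fin n) L) k a := by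
      funext a
      rw [Matrix.one_apply]
      exact hr a
    have h2 : Matrix.vecMul (Matrix.vecMul r g) g⁻¹ = r := by
      rw [Matrix.vecMul_vecMul, Matrix.mul_nonsing_inv g hu, Matrix.vecMul_one]
    rw [h1] at h2
    rw [← h2]
    simp [Matrix.vecMul, dotProduct, Matrix.one_apply]
  have hmem : ∀ m ≤ (c : ℕ) + 1, ((k : ℕ) + 1, m) ∉ D := by
    intro m hm hmD
    have := (hD.1 _ hmD).1
    simp only at this
    refine hk ⟨m - 1, by omega⟩ (by rw [Fin.le_def]; simp only; omega) ?_
    unfold Mem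
    convert hmD using 2
    simp only
    omega
  rw [Fin.lt_def] at hck
  have hτk : τ (k + 1) = k + 1 := tauD_eq hD (by omega) (by omega) fun m hm => hmem m hm.le
  have hτc : τ (c + 1) ≤ c + 1 := tauD_le hD le_rfl (by omega)
  have hnr : ∀ a : Fin n, IsRecord n τ (c + 1) T (a + 1) → k ≠ a := by
    rintro a ha rfl
    obtain ⟨m, hm, hmD⟩ := exists_mem_of_isRecord hD (by omega) ha
    exact hmem m hm hmD
  by_cases hkT : T < k + 1
  · right
    constructor
    · rw [← mem_MD_iff_free hD (by rw [Fin.lt_def]; omega),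
        mem_MD_iff_lt_tauD hD (by omega) (by omega) (by omega)]
      change T < τ (k + 1)
      omega
    · have := hsolve (fun a => if k = a then 1 else 0) fun a => by
        simp only [ite_mul, one_mul, zero_mul, Finset.sum_ite_eq, Finset.mem_univ, if_true]
        rw [hg, recordMat]
        split_ifs with h1 h2 h2
        · exact absurd h2 (hnr a h1)
        · rw [windowVec, if_neg]
          rintro ⟨⟨-, -, h3⟩, -⟩
          omega
        · rfl
        · rfl
      simp [this]
  · left
    have hTc : T ≠ c + 1 := by omega
    have hTD := topRow_mem hTc
    have hTn := (hD.1 _ hTD).2.2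
    have hTk : T ≠ k + 1 := by
      intro h
      apply hmem (c + 1) le_rfl
      rw [← h]
      exact hTD
    simp only at hTn
    obtain ⟨l, hl⟩ : ∃ l : Fin n, (l : ℕ) + 1 = T := ⟨⟨T - 1, by omega⟩, by simp only; omega⟩
    have hlD : Mem D l c := by
      unfold Mem
      rw [hl]
      exact hTD
    refine ⟨l, hlD, ?_⟩
    have hlr : IsRecord n τ (c + 1) T (l + 1) := isRecord_of_mem hD hlD
    have hlb : recordBound n τ (c + 1) T (l + 1) ≤ c + 1 :=
      (tauD_spec hD (c + 1) (l + 1) (by omega) (by omega)).2.2 hlD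
    have hτl : τ (l + 1) = l + 1 := tauD_eq hD (by omega) (by omega) fun m hm hmD => by
      have := congrArg Prod.snd (hD.2.1 _ hmD _ hlD rfl)
      simp only at this
      omega
    have hbound : ∀ a : Fin n, IsRecord n τ (c + 1) T (a + 1) →
        recordBound n τ (c + 1) T (a + 1) < c + 2 := by
      intro a ha
      have hal : l ≤ a := by
        by_contra hlt
        have h1 := ha.lt (b := l + 1) (by rw [not_le, Fin.lt_def] at hlt; omega) (by omega) hlr.1
        have h2 := ha.1.2.2
        omega
      rw [Fin.le_def] at hal
      have h1 : recordBound n τ (c + 1) T (l + 1) < c + 2 := by omega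
      rw [recordBound_lt_iff] at h1 ⊢
      exact ⟨h1.1, fun d h2 h3 h4 => h1.2 d (by omega) h3 h4⟩
    have hrow : ∀ b a : Fin n, InWindow τ (c + 1) T (b + 1) → (c : ℕ) + 2 ≤ τ (b + 1) →
        g b a = if IsRecord n τ (c + 1) T (a + 1) then y b else if b = a then 1 else 0 := by
      intro b a hb1 hb2
      rw [hg, recordMat]
      split_ifs with h1
      · rw [windowVec, if_pos ⟨hb1, by have := hbound a h1; omega⟩]
      · rfl
      · rfl
    have := hsolve (fun a => (if k = a then 1 else 0) - y k / y l * if l = a then 1 else 0)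
      fun a => by
        simp only [sub_mul, ite_mul, one_mul, zero_mul, mul_assoc, Finset.sum_sub_distrib,
          Finset.sum_ite_eq, Finset.mem_univ, if_true, ← Finset.mul_sum]
        rw [hrow k a ⟨by omega, by omega, by omega⟩ (by omega),
          hrow l a hlr.1 (by omega)]
        split_ifs with h1 h2 h2 h3 h3
        · exact absurd h2 (hnr a h1)
        · rw [div_mul_cancel₀ _ (hy l hlr), sub_self]
        · rw [← h3] at h1
          exact absurd hlr h1
        · simp
        · rw [← h3] at h1
          exact absurd hlr h1
        · simp
    simp only [this, sub_mul, ite_mul, one_mul, zero_mul, mul_assoc, Finset.sum_sub_distrib,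
          Finset.sum_ite_eq, Finset.mem_univ, if_true, ← Finset.mul_sum]

lemma tauD_one (hD : IsBasic n D) {k : ℕ} (hk : 1 ≤ k) (hkn : k ≤ n) : tauD n D 1 k = k :=
  tauD_eq hD hk hkn fun m hm h => by
    have := (hD.1 _ h).1
    simp only at this
    omega

lemma card_filter_col_succ (S : Fin n → Fin n → Prop) (c : Fin n) :
    (Finset.univ.filter fun p : Fin n × Fin n => (p.2 : ℕ) < c + 1 ∧ S p.1 p.2).card =
      (Finset.univ.filter fun p : Fin n × Fin n => (p.2 : ℕ) < c ∧ S p.1 p.2).card +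
      (Finset.univ.filter fun k : Fin n => S k c).card := by
  have h1 : (Finset.univ.filter fun p : Fin n × Fin n => (p.2 : ℕ) < c + 1 ∧ S p.1 p.2) =
      (Finset.univ.filter fun p : Fin n × Fin n => (p.2 : ℕ) < c ∧ S p.1 p.2) ∪
      (Finset.univ.filter fun k : Fin n => S k c).image fun k => (k, c) := by
    ext ⟨a, b⟩
    simp only [Finset.mem_filter, Finset.mem_univ, true_and, Finset.mem_union, Finset.mem_image,
      Prod.mk.injEq]
    constructor
    · rintro ⟨h1, h2⟩
      rcases Nat.lt_succ_iff_lt_or_eq.1 h1 with h1 | h1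
      · exact Or.inl ⟨h1, h2⟩
      · have : b = c := Fin.ext h1
        subst this
        exact Or.inr ⟨a, h2, rfl, rfl⟩
    · rintro (⟨h1, h2⟩ | ⟨k, h1, rfl, rfl⟩)
      · exact ⟨by omega, h2⟩
      · exact ⟨by omega, h1⟩
  rw [h1, Finset.card_union_of_disjoint, Finset.card_image_of_injective]
  · intro a b h
    exact (Prod.ext_iff.1 h).1
  · rw [Finset.disjoint_left]
    intro p hp hp'
    simp only [Finset.mem_filter, Finset.mem_univ, true_and, Finset.mem_image] at hp hp'
    obtain ⟨k, -, rfl⟩ := hp'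
    exact lt_irrefl _ hp.1

variable {x : PRoot n → L}

/-- The state of the radical computation once the columns before `c` have been treated. -/
lemma IsGenericOn.exists_radical_stage [CharZero K] (hx : IsGenericOn K D x) (hD : IsBasic n D)
    (c : ℕ) (hc : c ≤ n) :
    ∃ g : Matrix (Fin n) (Fin n) L, g.BlockTriangular id ∧ (∀ a, g a a ≠ 0) ∧
      (∀ a b, g a b ∈ earlierField K (matOf n L x) (c * n)) ∧
      (∀ k : Fin n, c ≤ k → (∀ m : Fin n, (m : ℕ) < c → ¬ Mem D k m) →
        ∀ b : Fin n, (b : ℕ) < c → (g⁻¹ * matOf n L x * g) k b = 0) ∧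
      Module.finrank L (radOn (commForm (matOf n L x)) (supported L (IncPair (tauD n D 1) 1))) =
        Module.finrank L (radOn (commForm (g⁻¹ * matOf n L x * g))
          (supported L (IncPair (tauD n D (c + 1)) (c + 1)))) +
        (Finset.univ.filter fun p : Fin n × Fin n => (p.2 : ℕ) < c ∧
          ((p.1 : ℕ) + 1, (p.2 : ℕ) + 1) ∈ CD n D).card +
        (Finset.univ.filter fun p : Fin n × Fin n => (p.2 : ℕ) < c ∧
          ((p.1 : ℕ) + 1, (p.2 : ℕ) + 1) ∈ MD n D).card := by
  set 𝕏 := matOf n L x with h𝕏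
  induction c with
  | zero =>
    refine ⟨1, Matrix.blockTriangular_one, by simp, fun a b => ?_, by simp, ?_⟩
    · rw [Matrix.one_apply]
      split_ifs
      · exact one_mem _
      · exact zero_mem _
    · rw [inv_one, one_mul, mul_one]
      simp
  | succ c ih =>
    obtain ⟨g, hg, hgd, hgE, hZ, hrank⟩ := ih (by omega)
    obtain ⟨c, rfl⟩ : ∃ c' : Fin n, (c' : ℕ) = c := ⟨⟨c, hc⟩, rfl⟩
    have hu := isUnit_det_of_upper hg hgd
    have hgi := upper_inv hg hu
    set X := g⁻¹ * 𝕏 * g with hX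
    have hcell : InCell D X := (hx.inCell hD).conj hg hgd
    have hentry : ∀ k : Fin n, X k c - g⁻¹ k k * 𝕏 k c * g c c ∈
        earlierField K 𝕏 (placeKey k c) := by
      intro k
      have hle : earlierField K 𝕏 (c * n) ≤ earlierField K 𝕏 (placeKey k c) :=
        earlierField_mono _ (by unfold placeKey; omega)
      exact triangular_mul_apply_mem _ hgi hg (fun a b => hle (inv_mem_of_forall _ hgE a b))
        (fun a b => hle (hgE a b)) fun a b h1 h2 h3 => mem_earlierField_of_lowerLeft 𝕏 h1 h2 h3
    have hM : ∀ k : Fin n, c < k → (topRow D (c + 1) < tauD n D (c + 1) (k + 1) ↔ Free D k c) := by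
      intro k hk
      rw [← mem_MD_iff_free hD hk, mem_MD_iff_lt_tauD hD (by omega)
        (by rw [Fin.lt_def] at hk; omega) (by omega)]
    have hy : ∀ k : Fin n,
        IsRecord n (tauD n D (c + 1)) (c + 1) (topRow D (c + 1)) (k + 1) → X k c ≠ 0 := by
      intro k hk h0
      have hck : c < k := by
        have := hk.1.1
        rw [Fin.lt_def]
        omega
      have hnf : ¬ Free D k c := by
        rw [← hM k hck]
        exact hk.1.2.2.not_gt
      refine (hx.transcendental hD hck hnf).not_mem ?_
      have h1 := hentry k
      rw [h0, zero_sub, neg_mem_iff] at h1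
      have hle : earlierField K 𝕏 (c * n) ≤ earlierField K 𝕏 (placeKey k c) :=
        earlierField_mono _ (by unfold placeKey; omega)
      have h2 : g⁻¹ k k ≠ 0 := by
        rw [upper_inv_diag hg hgd]
        exact inv_ne_zero (hgd k)
      have h3 : 𝕏 k c = (g⁻¹ k k)⁻¹ * (g⁻¹ k k * 𝕏 k c * g c c) * (g c c)⁻¹ := by
        have := hgd c
        field_simp
      rw [← h𝕏, h3]
      exact mul_mem (mul_mem (inv_mem (hle (inv_mem_of_forall _ hgE k k))) h1)
        (inv_mem (hle (hgE c c)))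
    have hzero : ∀ k : Fin n, c < k → Free D k c → X k c = 0 := by
      intro k hk hf
      rw [hcell.eq_schurEntry hD hk hf.noHook (hf.1 c le_rfl)]
      exact schurEntry_eq_zero fun b hb =>
        hZ k (le_of_lt hk) (fun m hm => hf.1 m (le_of_lt hm)) b hb
    set g₀ := recordMat (tauD n D (c + 1)) c (topRow D (c + 1)) fun k => X k c with hg₀
    have hu₀ : IsUnit g₀.det := recordMat_isUnit hy
    have hconj : (g * g₀)⁻¹ * 𝕏 * (g * g₀) = g₀⁻¹ * X * g₀ := by
      rw [Matrix.mul_inv_rev, hX]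
      noncomm_ring
    have hstep := finrank_radOn_step X (tauD_injOn (n := n) (D := D) ((c : ℕ) + 1))
      ((tauD_le hD le_rfl (by omega)).trans (le_topRow hD _)) hy
      fun k hk hT => hzero k hk ((hM k hk).1 hT)
    have hle : earlierField K 𝕏 (c * n) ≤ earlierField K 𝕏 ((c + 1 : ℕ) * n) :=
      earlierField_mono _ (Nat.mul_le_mul_right n (by omega))
    have h𝕏E : ∀ a b : Fin n, (b : ℕ) < c + 1 → 𝕏 a b ∈ earlierField K 𝕏 ((c + 1 : ℕ) * n) :=
      fun a b hb => mem_earlierField 𝕏 (placeKey_lt_mul_iff.2 hb)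
    have hXE : ∀ k, X k c ∈ earlierField K 𝕏 ((c + 1 : ℕ) * n) := by
      intro k
      have h1 : X k c = (X k c - g⁻¹ k k * 𝕏 k c * g c c) + g⁻¹ k k * 𝕏 k c * g c c := by ring
      rw [h1]
      refine add_mem (earlierField_mono 𝕏 ?_ (hentry k)) (mul_mem (mul_mem
        (hle (inv_mem_of_forall _ hgE k k)) (h𝕏E k c (by omega))) (hle (hgE c c)))
      exact (placeKey_lt_mul_iff.2 (Nat.lt_succ_self _)).le
    have hg₀E : ∀ a b, g₀ a b ∈ earlierField K 𝕏 ((c + 1 : ℕ) * n) := by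
      intro a b
      rw [hg₀, recordMat]
      split_ifs
      · rw [windowVec]
        split_ifs
        · exact hXE a
        · exact zero_mem _
      · exact one_mem _
      · exact zero_mem _
    refine ⟨g * g₀, hg.mul recordMat_upper, fun a => ?_, fun a b => ?_, fun k hk hkD b hb => ?_, ?_⟩
    · rw [upper_mul_diag hg recordMat_upper]
      exact mul_ne_zero (hgd a) (recordMat_diag hy a)
    · rw [Matrix.mul_apply]
      exact sum_mem fun d _ => mul_mem (hle (hgE a d)) (hg₀E d b)
    · rw [hconj]
      have hcol : ∀ a, g₀ a b = if a = b then 1 else 0 := by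
        intro a
        rw [hg₀, recordMat, if_neg]
        intro hr
        have := hr.1.1
        omega
      have h1 : (g₀⁻¹ * X * g₀) k b = ∑ a, g₀⁻¹ k a * X a b := by
        rw [Matrix.mul_apply, Finset.sum_eq_single b]
        · rw [hcol, if_pos rfl, mul_one, Matrix.mul_apply]
        · intro a _ ha
          rw [hcol, if_neg ha, mul_zero]
        · simp
      have hck : c < k := by
        rw [Fin.lt_def]
        omega
      have hkb : ∀ b : Fin n, (b : ℕ) < c → X k b = 0 :=
        fun b hb => hZ k (by omega) (fun m hm => hkD m (by omega)) b hb
      rw [h1]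
      rcases recordMat_inv_row hD hy hck (fun m hm => hkD m (by rw [Fin.le_def] at hm; omega))
        (fun a => X a b) with ⟨l, hl, h2⟩ | ⟨hf, h2⟩
      · rw [h2]
        rcases Nat.lt_succ_iff_lt_or_eq.1 hb with hb | hb
        · have hlc := hl.lt hD
          rw [Fin.lt_def] at hlc
          change X k b - X k c / X l c * X l b = 0
          rw [hkb b hb, hZ l (by omega) (fun m hm hm' => ?_) b hb, mul_zero, sub_zero]
          have := hm'.col_eq hD hl
          rw [this] at hm
          omega
        · have : b = c := Fin.ext hb
          subst this
          have h3 := hy l (isRecord_of_mem hD hl)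
          change X k b - X k b / X l b * X l b = 0
          rw [div_mul_cancel₀ _ h3, sub_self]
      · rw [h2]
        rcases Nat.lt_succ_iff_lt_or_eq.1 hb with hb | hb
        · exact hkb b hb
        · have : b = c := Fin.ext hb
          subst this
          exact hzero k hck hf
    · rw [hrank, hconj, card_filter_col_succ (fun a b => ((a : ℕ) + 1, (b : ℕ) + 1) ∈ CD n D),
        card_filter_col_succ (fun a b => ((a : ℕ) + 1, (b : ℕ) + 1) ∈ MD n D)]
      have h1 : (Finset.univ.filter fun k : Fin n =>
          IsRecord n (tauD n D (c + 1)) (c + 1) (topRow D (c + 1)) (k + 1)) =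
          Finset.univ.filter fun k : Fin n => ((k : ℕ) + 1, (c : ℕ) + 1) ∈ CD n D := by
        ext k
        simp only [Finset.mem_filter, Finset.mem_univ, true_and]
        rw [mem_CD_iff hD]
        exact ⟨fun h => ⟨by omega, by omega, h⟩, fun h => h.2.2⟩
      have h2 : (Finset.univ.filter fun k : Fin n =>
          c < k ∧ topRow D (c + 1) < tauD n D (c + 1) (k + 1)) =
          Finset.univ.filter fun k : Fin n => ((k : ℕ) + 1, (c : ℕ) + 1) ∈ MD n D := by
        ext k
        simp only [Finset.mem_filter, Finset.mem_univ, true_and]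
        constructor
        · rintro ⟨h1, h2⟩
          exact (mem_MD_iff_free hD h1).2 ((hM k h1).1 h2)
        · intro h
          have h1 : c < k := isPosRoot_iff_lt.1 h.1
          exact ⟨h1, (hM k h1).2 ((mem_MD_iff_free hD h1).1 h)⟩
      rw [h1, h2, show (c : ℕ) + 2 = c + 1 + 1 from rfl, ← hg₀] at hstep
      have h3 : tauD n D (c + 1 + 1) =
          stepTau n (tauD n D (c + 1)) (c + 1) (topRow D (c + 1)) := rfl
      rw [h3, hstep]
      ring

/-- The dimension of the radical of the form of the generic point. -/
lemma IsGenericOn.finrank_radOn [CharZero K] (hx : IsGenericOn K D x) (hD : IsBasic n D) :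
    Module.finrank L (radOn (commForm (matOf n L x)) (supported L fun a b => b < a)) =
      (Finset.univ.filter fun p : Fin n × Fin n =>
          ((p.1 : ℕ) + 1, (p.2 : ℕ) + 1) ∈ CD n D).card +
        (Finset.univ.filter fun p : Fin n × Fin n =>
          ((p.1 : ℕ) + 1, (p.2 : ℕ) + 1) ∈ MD n D).card := by
  obtain ⟨g, -, -, -, -, h⟩ := hx.exists_radical_stage hD n le_rfl
  have h1 : supported (n := n) L (IncPair (tauD n D 1) 1) = supported L fun a b => b < a := by
    congr 1
    funext a b
    rw [IncPair, tauD_one hD (by omega) (by omega), tauD_one hD (by omega) (by omega)]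
    simp
  have h2 : supported (n := n) L (IncPair (tauD n D (n + 1)) (n + 1)) = ⊥ := by
    rw [eq_bot_iff]
    intro u hu
    rw [Submodule.mem_bot]
    ext b a
    by_contra hne
    have := (hu b a hne).1
    omega
  have h3 : radOn (commForm (g⁻¹ * matOf n L x * g))
      (⊥ : Submodule L (Matrix (Fin n) (Fin n) L)) = ⊥ := eq_bot_iff.2 fun u hu => hu.1
  rw [h1, h2, h3, finrank_bot] at h
  rw [h, zero_add]
  congr 2 <;> ext p <;> simp

end Rank

/-! ### The canonical form of a matrix under unipotent conjugation -/

section CanonicalForm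

variable {n : ℕ} {K L : Type} [Field K] [Field L] [Algebra K L]

/-- The commutator `uX - Xu`, linear in `u`. -/
noncomputable def bracketMap (X : Matrix (Fin n) (Fin n) L) :
    Matrix (Fin n) (Fin n) L →ₗ[L] Matrix (Fin n) (Fin n) L where
  toFun u := u * X - X * u
  map_add' u v := by noncomm_ring
  map_smul' r u := by simp [smul_sub]

lemma bracketMap_apply (X u : Matrix (Fin n) (Fin n) L) : bracketMap X u = u * X - X * u := rfl

/-- The strictly upper triangular matrices. -/
def strictUpper (n : ℕ) (L : Type) [Field L] : Submodule L (Matrix (Fin n) (Fin n) L) :=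
  supported L fun a b => b < a

lemma strictUpper_apply {u : Matrix (Fin n) (Fin n) L} (hu : u ∈ strictUpper n L) {a b : Fin n}
    (h : b ≤ a) : u a b = 0 := by
  by_contra h'
  exact (hu a b h').not_ge h

lemma strictUpper_upper {u : Matrix (Fin n) (Fin n) L} (hu : u ∈ strictUpper n L) :
    u.BlockTriangular id := fun _ _ h => strictUpper_apply hu (le_of_lt h)

lemma bracketMap_eq_sum {X u : Matrix (Fin n) (Fin n) L} (hu : u ∈ strictUpper n L) (a b : Fin n) :
    bracketMap X u a b =
      (∑ c, if a < c then u a c * X c b else 0) - ∑ c, if c < b then u c b * X a c else 0 := by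
  rw [bracketMap_apply, Matrix.sub_apply, Matrix.mul_apply, Matrix.mul_apply]
  congr 1
  · refine Finset.sum_congr rfl fun c _ => ?_
    split_ifs with h
    · rfl
    · rw [strictUpper_apply hu (not_lt.1 h), zero_mul]
  · refine Finset.sum_congr rfl fun c _ => ?_
    split_ifs with h
    · rw [mul_comm]
    · rw [strictUpper_apply hu (not_lt.1 h), mul_zero]

/-- Below the diagonal, the commutator only involves earlier entries below the diagonal. -/
lemma bracketMap_congr {X Y u : Matrix (Fin n) (Fin n) L} (hu : u ∈ strictUpper n L) {a b : Fin n}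
    (hab : b < a)
    (h : ∀ a' b', b' < a' → placeKey a' b' < placeKey a b → X a' b' = Y a' b') :
    bracketMap X u a b = bracketMap Y u a b := by
  rw [bracketMap_eq_sum hu, bracketMap_eq_sum hu]
  congr 1
  · refine Finset.sum_congr rfl fun c _ => ?_
    split_ifs with hc
    · rw [h c b (hab.trans hc) (placeKey_lt_of_row hc)]
    · rfl
  · refine Finset.sum_congr rfl fun c _ => ?_
    split_ifs with hc
    · rw [h a c (hc.trans hab) (placeKey_lt_of_col hc)]
    · rfl

/-- The place `(a, b)` is the leading place of some commutator `uX - Xu`. -/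
def IsJump (X : Matrix (Fin n) (Fin n) L) (a b : Fin n) : Prop :=
  ∃ u ∈ strictUpper n L,
    (∀ a' b', b' < a' → placeKey a' b' < placeKey a b → bracketMap X u a' b' = 0) ∧
      bracketMap X u a b ≠ 0

lemma IsJump.congr {X Y : Matrix (Fin n) (Fin n) L} {a b : Fin n} (hab : b < a)
    (hXY : ∀ a' b', b' < a' → placeKey a' b' < placeKey a b → X a' b' = Y a' b')
    (h : IsJump X a b) : IsJump Y a b := by
  obtain ⟨u, hu, h1, h2⟩ := h
  refine ⟨u, hu, fun a' b' h3 h4 => ?_, ?_⟩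
  · rw [← h1 a' b' h3 h4]
    exact (bracketMap_congr hu h3 fun _ _ h5 h6 => hXY _ _ h5 (h6.trans h4)).symm
  · rwa [← bracketMap_congr hu hab hXY]

/-- The leading commutator at a jump can be chosen over any field containing the earlier entries. -/
lemma IsJump.exists_mem (E : IntermediateField K L) {X : Matrix (Fin n) (Fin n) L} {a b : Fin n}
    (hab : b < a) (hX : ∀ a' b', b' < a' → placeKey a' b' < placeKey a b → X a' b' ∈ E)
    (h : IsJump X a b) :
    ∃ u ∈ strictUpper n L, (∀ i j, u i j ∈ E) ∧
      (∀ a' b', b' < a' → placeKey a' b' < placeKey a b → bracketMap X u a' b' = 0) ∧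
        bracketMap X u a b ≠ 0 := by
  obtain ⟨u, hu, h1, h2⟩ := h
  obtain ⟨ψ, hψ⟩ : ∃ ψ : Module.Dual E L, ψ (bracketMap X u a b) ≠ 0 := by
    by_contra! h
    exact h2 ((Module.forall_dual_apply_eq_zero_iff E _).1 h)
  have hv : (fun i j => ((ψ (u i j) : E) : L)) ∈ strictUpper n L := by
    intro i j hij
    refine hu i j fun h0 => hij ?_
    simp [h0]
  have hlin : ∀ z w : L, w ∈ E → ((ψ z : E) : L) * w = ψ (z * w) := by
    intro z w hw
    have : z * w = (⟨w, hw⟩ : E) • z := by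
      rw [IntermediateField.smul_def, smul_eq_mul, mul_comm]
    rw [this, map_smul, smul_eq_mul, mul_comm]
    rfl
  have hval : ∀ a' b', b' < a' → placeKey a' b' ≤ placeKey a b →
      bracketMap X (fun i j => ((ψ (u i j) : E) : L)) a' b' = ψ (bracketMap X u a' b') := by
    intro a' b' h3 h4
    rw [bracketMap_eq_sum hv, bracketMap_eq_sum hu, map_sub, map_sum, map_sum]
    push_cast
    congr 1
    · refine Finset.sum_congr rfl fun c _ => ?_
      split_ifs with hc
      · exact hlin _ _ (hX c b' (h3.trans hc) ((placeKey_lt_of_row hc).trans_le h4))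
      · simp
    · refine Finset.sum_congr rfl fun c _ => ?_
      split_ifs with hc
      · exact hlin _ _ (hX a' c (hc.trans h3) ((placeKey_lt_of_col hc).trans_le h4))
      · simp
  refine ⟨_, hv, fun i j => (ψ (u i j)).2, fun a' b' h3 h4 => ?_, ?_⟩
  · rw [hval a' b' h3 h4.le, h1 a' b' h3 h4, map_zero]
    rfl
  · rw [hval a b hab le_rfl]
    exact fun h0 => hψ (Subtype.ext h0)

/-- Unipotent upper triangular matrices. -/
def Unipotent (g : Matrix (Fin n) (Fin n) L) : Prop := g.BlockTriangular id ∧ ∀ a, g a a = 1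

lemma Unipotent.isUnit {g : Matrix (Fin n) (Fin n) L} (hg : Unipotent g) : IsUnit g.det :=
  isUnit_det_of_upper hg.1 fun a => by simp [hg.2]

lemma Unipotent.mul {g h : Matrix (Fin n) (Fin n) L} (hg : Unipotent g) (hh : Unipotent h) :
    Unipotent (g * h) :=
  ⟨hg.1.mul hh.1, fun a => by rw [upper_mul_diag hg.1 hh.1, hg.2, hh.2, one_mul]⟩

lemma Unipotent.inv {g : Matrix (Fin n) (Fin n) L} (hg : Unipotent g) : Unipotent g⁻¹ :=
  ⟨upper_inv hg.1 hg.isUnit, fun a => by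
    rw [upper_inv_diag hg.1 (fun a => by simp [hg.2]), hg.2, inv_one]⟩

lemma unipotent_one : Unipotent (1 : Matrix (Fin n) (Fin n) L) :=
  ⟨Matrix.blockTriangular_one, by simp⟩

lemma unipotent_one_add {u : Matrix (Fin n) (Fin n) L} (hu : u ∈ strictUpper n L) :
    Unipotent (1 + u) :=
  ⟨Matrix.blockTriangular_one.add (strictUpper_upper hu), fun a => by
    simp [strictUpper_apply hu le_rfl]⟩

lemma Unipotent.sub_one_mem {g : Matrix (Fin n) (Fin n) L} (hg : Unipotent g) :
    g - 1 ∈ strictUpper n L := by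
  intro b a h
  by_contra hle
  rcases (not_lt.1 hle).lt_or_eq with h1 | rfl
  · apply h
    rw [Matrix.sub_apply, hg.1 (show id a < id b from h1), Matrix.one_apply_ne h1.ne', sub_zero]
  · apply h
    rw [Matrix.sub_apply, hg.2, Matrix.one_apply_eq, sub_self]

/-- If a matrix vanishes at the lower places before `(a, b)`, multiplying it by a unipotent matrix
on the right does not change these entries nor the entry at `(a, b)`. -/
lemma mul_unipotent_apply {B g : Matrix (Fin n) (Fin n) L} (hg : Unipotent g) {a b : Fin n}
    (hab : b < a) (hB : ∀ a' b', b' < a' → placeKey a' b' < placeKey a b → B a' b' = 0) :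
    (B * g) a b = B a b := by
  rw [Matrix.mul_apply, Finset.sum_eq_single b]
  · rw [hg.2, mul_one]
  · intro c _ hc
    rcases lt_or_gt_of_ne hc with h | h
    · rw [hB a c (h.trans hab) (placeKey_lt_of_col h), zero_mul]
    · rw [hg.1 (show id b < id c from h), mul_zero]
  · simp

lemma conj_sub_eq {X g : Matrix (Fin n) (Fin n) L} (hg : Unipotent g) :
    g * X * g⁻¹ - X = bracketMap X (g - 1) * g⁻¹ := by
  have h : X * g * g⁻¹ = X := Matrix.mul_nonsing_inv_cancel_right _ _ hg.isUnit
  have h' : bracketMap X (g - 1) * g⁻¹ = g * X * g⁻¹ - X * g * g⁻¹ := by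
    rw [bracketMap_apply]
    noncomm_ring
  rw [h', h]

/-- Conjugation by `1 + u` shifts the first entry where the commutator with `u` is nonzero. -/
lemma conj_one_add_apply {X u : Matrix (Fin n) (Fin n) L} (hu : u ∈ strictUpper n L) {a b : Fin n}
    (hab : b < a)
    (hu0 : ∀ a' b', b' < a' → placeKey a' b' < placeKey a b → bracketMap X u a' b' = 0) :
    ((1 + u) * X * (1 + u)⁻¹) a b = X a b + bracketMap X u a b := by
  have h1 : ((1 + u) * X * (1 + u)⁻¹) a b - X a b = _ :=
    congrFun (congrFun (conj_sub_eq (X := X) (unipotent_one_add hu)) a) b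
  rw [add_sub_cancel_left] at h1
  have h2 := h1.trans (mul_unipotent_apply (unipotent_one_add hu).inv hab hu0)
  rw [← h2]
  ring

/-- Every entry is in canonical form: entries at jumps vanish. -/
def IsCanonical (X : Matrix (Fin n) (Fin n) L) : Prop :=
  ∀ a b, b < a → IsJump X a b → X a b = 0

/-- Canonical forms are unique. -/
lemma IsCanonical.unique {X Y g : Matrix (Fin n) (Fin n) L} (hX : IsCanonical X)
    (hY : IsCanonical Y) (hg : Unipotent g)
    (h : ∀ a b, b < a → Y a b = (g * X * g⁻¹) a b) : ∀ a b, b < a → Y a b = X a b := by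
  have key : ∀ k, ∀ a b, b < a → placeKey a b < k → Y a b = X a b := by
    intro k
    induction k with
    | zero => intro _ _ _ h; omega
    | succ k ih =>
      intro a b hab hk
      have ih' : ∀ a' b', b' < a' → placeKey a' b' < placeKey a b → Y a' b' = X a' b' :=
        fun a' b' h1 h2 => ih a' b' h1 (by omega)
      by_cases hJ : IsJump X a b
      · rw [hX a b hab hJ, hY a b hab (hJ.congr hab fun _ _ h1 h2 => (ih' _ _ h1 h2).symm)]
      · have hB : bracketMap X (g - 1) = (g * X * g⁻¹ - X) * g := by
          rw [conj_sub_eq hg, Matrix.nonsing_inv_mul_cancel_right _ _ hg.isUnit]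
        have hz : ∀ a' b', b' < a' → placeKey a' b' < placeKey a b →
            (g * X * g⁻¹ - X) a' b' = 0 := fun a' b' h1 h2 => by
          rw [Matrix.sub_apply, ← h a' b' h1, ih' a' b' h1 h2, sub_self]
        have h0 : bracketMap X (g - 1) a b = 0 := by
          by_contra hne
          refine hJ ⟨g - 1, hg.sub_one_mem, fun a' b' h1 h2 => ?_, hne⟩
          rw [hB, mul_unipotent_apply hg h1 fun _ _ h3 h4 => hz _ _ h3 (h4.trans h2)]
          exact hz a' b' h1 h2
        rw [hB, mul_unipotent_apply hg hab hz, Matrix.sub_apply, ← h a b hab] at h0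
        exact sub_eq_zero.1 h0
  exact fun a b hab => key _ a b hab (Nat.lt_succ_self _)

/-- Existence of canonical forms, with control of the fields of definition. -/
lemma exists_canonical_stage (X₀ : Matrix (Fin n) (Fin n) L) (k : ℕ) :
    ∃ g : Matrix (Fin n) (Fin n) L, Unipotent g ∧ (∀ i j, g i j ∈ earlierField K X₀ k) ∧
      ∀ a b, b < a → placeKey a b < k →
        (IsJump (g * X₀ * g⁻¹) a b → (g * X₀ * g⁻¹) a b = 0) ∧
        (¬ IsJump (g * X₀ * g⁻¹) a b →
          (g * X₀ * g⁻¹) a b - X₀ a b ∈ earlierField K X₀ (placeKey a b)) := by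
  induction k with
  | zero =>
    refine ⟨1, unipotent_one, fun i j => ?_, fun _ _ _ h => absurd h (by omega)⟩
    rw [Matrix.one_apply]
    split_ifs
    · exact one_mem _
    · exact zero_mem _
  | succ k ih =>
    obtain ⟨g, hg, hgE, hk⟩ := ih
    have hmono : earlierField K X₀ k ≤ earlierField K X₀ (k + 1) := earlierField_mono _ (by omega)
    by_cases hplace : ∃ a b : Fin n, b < a ∧ placeKey a b = k
    swap
    · push Not at hplace
      refine ⟨g, hg, fun i j => hmono (hgE i j), fun a b hab h => hk a b hab ?_⟩
      have := hplace a b hab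
      omega
    obtain ⟨a, b, hab, rfl⟩ := hplace
    set X := g * X₀ * g⁻¹ with hX
    have hXab : X a b - X₀ a b ∈ earlierField K X₀ (placeKey a b) := by
      have := triangular_mul_apply_mem (earlierField K X₀ (placeKey a b)) (X := X₀)
        hg.1 hg.inv.1 hgE
        (fun i j => inv_mem_of_forall _ hgE i j) (i := a) (j := b)
        fun a' b' h1 h2 h3 => mem_earlierField_of_lowerLeft X₀ h1 h2 h3
      rwa [hg.2, hg.inv.2, one_mul, mul_one] at this
    have hlast : ∀ P : Fin n → Fin n → Prop, (∀ a' b', b' < a' →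
        placeKey a' b' < placeKey a b → P a' b') → P a b →
        ∀ a' b', b' < a' → placeKey a' b' < placeKey a b + 1 → P a' b' := by
      intro P h1 h2 a' b' h3 h4
      rcases Nat.lt_succ_iff_lt_or_eq.1 h4 with h4 | h4
      · exact h1 a' b' h3 h4
      · obtain ⟨rfl, rfl⟩ := placeKey_injective h4
        exact h2
    by_cases hJ : IsJump X a b
    swap
    · exact ⟨g, hg, fun i j => hmono (hgE i j), hlast _ hk ⟨fun h => absurd h hJ, fun _ => hXab⟩⟩
    have hXE : ∀ a' b', b' < a' → placeKey a' b' < placeKey a b →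
        X a' b' ∈ earlierField K X₀ (placeKey a b) := by
      intro a' b' h1 h2
      by_cases hJ' : IsJump X a' b'
      · rw [(hk a' b' h1 h2).1 hJ']
        exact zero_mem _
      · have h3 := earlierField_mono X₀ h2.le ((hk a' b' h1 h2).2 hJ')
        have h4 := add_mem h3 (mem_earlierField (K := K) X₀ h2)
        rwa [sub_add_cancel] at h4
    obtain ⟨u, hu, huE, hu0, hd⟩ := hJ.exists_mem _ hab hXE
    set d := bracketMap X u a b with hdef
    have hdE : d ∈ earlierField K X₀ (placeKey a b) := by
      rw [hdef, bracketMap_eq_sum hu]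
      refine sub_mem (sum_mem fun c _ => ?_) (sum_mem fun c _ => ?_)
      · split_ifs with hc
        · exact mul_mem (huE _ _) (hXE _ _ (hab.trans hc) (placeKey_lt_of_row hc))
        · exact zero_mem _
      · split_ifs with hc
        · exact mul_mem (huE _ _) (hXE _ _ (hc.trans hab) (placeKey_lt_of_col hc))
        · exact zero_mem _
    have hXab' : X a b ∈ earlierField K X₀ (placeKey a b + 1) := by
      have := add_mem (hmono hXab) (mem_earlierField (K := K) X₀ (Nat.lt_succ_self (placeKey a b)))
      rwa [sub_add_cancel] at this
    set t := -(X a b / d) with ht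
    have htE : t ∈ earlierField K X₀ (placeKey a b + 1) :=
      neg_mem (div_mem hXab' (hmono hdE))
    have htu : t • u ∈ strictUpper n L := Submodule.smul_mem _ _ hu
    set h := 1 + t • u with hh
    have hhu : Unipotent h := unipotent_one_add htu
    have hconj : (h * g) * X₀ * (h * g)⁻¹ = h * X * h⁻¹ := by
      rw [Matrix.mul_inv_rev, hX]
      noncomm_ring
    have hdiff : ∀ a' b', b' < a' → placeKey a' b' ≤ placeKey a b →
        (h * X * h⁻¹) a' b' = X a' b' + t * bracketMap X u a' b' := by
      intro a' b' h1 h2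
      have h3 := conj_one_add_apply (X := X) htu h1 fun a'' b'' h4 h5 => by
        rw [map_smul, Matrix.smul_apply, hu0 _ _ h4 (h5.trans_le h2), smul_zero]
      rw [map_smul, Matrix.smul_apply, smul_eq_mul] at h3
      exact h3
    have hsame : ∀ a' b', b' < a' → placeKey a' b' < placeKey a b →
        (h * X * h⁻¹) a' b' = X a' b' := by
      intro a' b' h1 h2
      rw [hdiff a' b' h1 h2.le, hu0 a' b' h1 h2, mul_zero, add_zero]
    refine ⟨h * g, hhu.mul hg, fun i j => ?_, ?_⟩
    · rw [Matrix.mul_apply]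
      refine sum_mem fun c _ => mul_mem ?_ (hmono (hgE c j))
      rw [hh, Matrix.add_apply, Matrix.smul_apply, Matrix.one_apply]
      refine add_mem ?_ (mul_mem htE (hmono (huE i c)))
      split_ifs
      · exact one_mem _
      · exact zero_mem _
    · rw [hconj]
      refine hlast _ (fun a' b' h1 h2 => ?_) ⟨fun _ => ?_, fun hJ' => ?_⟩
      · have h3 : ∀ a'' b'', b'' < a'' → placeKey a'' b'' < placeKey a' b' →
            (h * X * h⁻¹) a'' b'' = X a'' b'' := fun a'' b'' h3 h4 => hsame a'' b'' h3 (h4.trans h2)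
        rw [hsame a' b' h1 h2]
        have := hk a' b' h1 h2
        exact ⟨fun hJ' => this.1 (hJ'.congr h1 h3),
          fun hJ' => this.2 fun hJ'' => hJ' (hJ''.congr h1 fun _ _ h4 h5 => (h3 _ _ h4 h5).symm)⟩
      · rw [hdiff a b hab le_rfl, ← hdef, ht, neg_mul, div_mul_cancel₀ _ hd, add_neg_cancel]
      · exact absurd (hJ.congr hab fun _ _ h1 h2 => (hsame _ _ h1 h2).symm) hJ'

lemma placeKey_lt_sq (a b : Fin n) : placeKey a b < n * n := placeKey_lt_mul_iff.2 b.2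

lemma exists_canonical (K : Type) [Field K] [Algebra K L] (X₀ : Matrix (Fin n) (Fin n) L) :
    ∃ g : Matrix (Fin n) (Fin n) L, Unipotent g ∧ IsCanonical (g * X₀ * g⁻¹) ∧
      ∀ a b, b < a → ¬ IsJump (g * X₀ * g⁻¹) a b →
        (g * X₀ * g⁻¹) a b - X₀ a b ∈ earlierField K X₀ (placeKey a b) := by
  obtain ⟨g, hg, -, h⟩ := exists_canonical_stage (K := K) X₀ (n * n)
  exact ⟨g, hg, fun a b hab => (h a b hab (placeKey_lt_sq a b)).1,
    fun a b hab => (h a b hab (placeKey_lt_sq a b)).2⟩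

/-! ### Counting the jumps -/

lemma finrank_inf_ker {V : Type} [AddCommGroup V] [Module L V] [FiniteDimensional L V]
    (W : Submodule L V) (f : V →ₗ[L] L) :
    Module.finrank L W = Module.finrank L (W ⊓ LinearMap.ker f : Submodule L V) +
      if ∃ u ∈ W, f u ≠ 0 then 1 else 0 := by
  have h1 := (f.domRestrict W).finrank_range_add_finrank_ker
  have h2 : (LinearMap.ker (f.domRestrict W)).map W.subtype = W ⊓ LinearMap.ker f := by
    ext v
    simp only [Submodule.mem_map, LinearMap.mem_ker, LinearMap.domRestrict_apply, Submodule.mem_inf,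
      Submodule.subtype_apply]
    exact ⟨by rintro ⟨w, h, rfl⟩; exact ⟨w.2, h⟩, fun h => ⟨⟨v, h.1⟩, h.2, rfl⟩⟩
  rw [← h2, Submodule.finrank_map_subtype_eq, ← h1, add_comm]
  congr 1
  split_ifs with h
  · obtain ⟨u, hu, hne⟩ := h
    have : LinearMap.range (f.domRestrict W) = ⊤ := by
      rw [LinearMap.range_eq_top]
      intro z
      refine ⟨(z / f u) • ⟨u, hu⟩, ?_⟩
      rw [map_smul, LinearMap.domRestrict_apply, smul_eq_mul, div_mul_cancel₀ _ hne]
    rw [this, finrank_top, Module.finrank_self]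
  · push Not at h
    have : f.domRestrict W = 0 := by
      ext u
      exact h u.1 u.2
    rw [this, LinearMap.range_zero, finrank_bot]

/-- The strictly upper triangular matrices whose commutator with `X` vanishes at the lower places
before position `k`. -/
noncomputable def bracketKer (X : Matrix (Fin n) (Fin n) L) (k : ℕ) :
    Submodule L (Matrix (Fin n) (Fin n) L) where
  carrier := {u | u ∈ strictUpper n L ∧
    ∀ a b, b < a → placeKey a b < k → bracketMap X u a b = 0}
  add_mem' := fun {u v} hu hv => ⟨add_mem hu.1 hv.1, fun a b h1 h2 => by
    rw [map_add, Matrix.add_apply, hu.2 a b h1 h2, hv.2 a b h1 h2, add_zero]⟩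
  zero_mem' := ⟨zero_mem _, fun a b _ _ => by rw [map_zero]; rfl⟩
  smul_mem' := fun r u hu => ⟨Submodule.smul_mem _ _ hu.1, fun a b h1 h2 => by
    rw [map_smul, Matrix.smul_apply, hu.2 a b h1 h2, smul_zero]⟩

lemma finrank_bracketKer (X : Matrix (Fin n) (Fin n) L) (k : ℕ) :
    Module.finrank L (strictUpper n L) = Module.finrank L (bracketKer X k) +
      (Finset.univ.filter fun p : Fin n × Fin n =>
        placeKey p.1 p.2 < k ∧ p.2 < p.1 ∧ IsJump X p.1 p.2).card := by
  induction k with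
  | zero =>
    have : bracketKer X 0 = strictUpper n L := by
      ext u
      exact ⟨fun h => h.1, fun h => ⟨h, fun _ _ _ h => absurd h (by omega)⟩⟩
    rw [this]
    simp
  | succ k ih =>
    rw [ih]
    by_cases hplace : ∃ a b : Fin n, b < a ∧ placeKey a b = k
    · obtain ⟨a, b, hab, rfl⟩ := hplace
      let f : Matrix (Fin n) (Fin n) L →ₗ[L] L := (Matrix.entryLinearMap L L a b) ∘ₗ bracketMap X
      have hf : ∀ u, f u = bracketMap X u a b := fun u => rfl
      have h1 : bracketKer X (placeKey a b) ⊓ LinearMap.ker f =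
          bracketKer X (placeKey a b + 1) := by
        ext u
        rw [Submodule.mem_inf, LinearMap.mem_ker, hf]
        constructor
        · rintro ⟨⟨h1, h2⟩, h3⟩
          refine ⟨h1, fun a' b' h4 h5 => ?_⟩
          rcases Nat.lt_succ_iff_lt_or_eq.1 h5 with h5 | h5
          · exact h2 a' b' h4 h5
          · obtain ⟨rfl, rfl⟩ := placeKey_injective h5
            exact h3
        · rintro ⟨h1, h2⟩
          exact ⟨⟨h1, fun a' b' h4 h5 => h2 a' b' h4 (by omega)⟩, h2 a b hab (by omega)⟩
      have h2 : (∃ u ∈ bracketKer X (placeKey a b), f u ≠ 0) ↔ IsJump X a b := by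
        constructor
        · rintro ⟨u, ⟨h2, h3⟩, h4⟩
          exact ⟨u, h2, h3, h4⟩
        · rintro ⟨u, h2, h3, h4⟩
          exact ⟨u, ⟨h2, h3⟩, h4⟩
      rw [finrank_inf_ker (bracketKer X (placeKey a b)) f, h1, add_assoc]
      congr 1
      by_cases hJ : IsJump X a b
      · rw [if_pos (h2.2 hJ)]
        have h3 : (Finset.univ.filter fun p : Fin n × Fin n =>
            placeKey p.1 p.2 < placeKey a b + 1 ∧ p.2 < p.1 ∧ IsJump X p.1 p.2) =
            insert (a, b) (Finset.univ.filter fun p : Fin n × Fin n =>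
              placeKey p.1 p.2 < placeKey a b ∧ p.2 < p.1 ∧ IsJump X p.1 p.2) := by
          ext p
          simp only [Finset.mem_filter, Finset.mem_univ, true_and, Finset.mem_insert]
          constructor
          · rintro ⟨h3, h4⟩
            rcases Nat.lt_succ_iff_lt_or_eq.1 h3 with h3 | h3
            · exact Or.inr ⟨h3, h4⟩
            · exact Or.inl (Prod.ext (placeKey_injective h3).1 (placeKey_injective h3).2)
          · rintro (rfl | ⟨h3, h4⟩)
            · exact ⟨by simp, hab, hJ⟩
            · exact ⟨by omega, h4⟩
        rw [h3, Finset.card_insert_of_notMem (by simp), add_comm]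
      · rw [if_neg fun h => hJ (h2.1 h), zero_add]
        congr 1
        ext p
        simp only [Finset.mem_filter, Finset.mem_univ, true_and]
        constructor
        · rintro ⟨h3, h4⟩
          exact ⟨by omega, h4⟩
        · rintro ⟨h3, h4⟩
          refine ⟨lt_of_le_of_ne (Nat.lt_succ_iff.1 h3) fun h => hJ ?_, h4⟩
          rw [← (placeKey_injective h).1, ← (placeKey_injective h).2]
          exact h4.2
    · push Not at hplace
      have h1 : ∀ a b : Fin n, b < a → (placeKey a b < k ↔ placeKey a b < k + 1) := by
        intro a b hab
        have := hplace a b hab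
        omega
      have h2 : bracketKer X k = bracketKer X (k + 1) := by
        ext u
        exact ⟨fun h => ⟨h.1, fun a b h3 h4 => h.2 a b h3 ((h1 a b h3).2 h4)⟩,
          fun h => ⟨h.1, fun a b h3 h4 => h.2 a b h3 ((h1 a b h3).1 h4)⟩⟩
      rw [h2]
      congr 2
      ext p
      simp only [Finset.mem_filter, Finset.mem_univ, true_and]
      exact ⟨fun h => ⟨(h1 _ _ h.2.1).1 h.1, h.2⟩, fun h => ⟨(h1 _ _ h.2.1).2 h.1, h.2⟩⟩

lemma commForm_eq_sum (X u v : Matrix (Fin n) (Fin n) L) :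
    commForm X u v = -∑ a, ∑ b, bracketMap X u a b * v b a := by
  have h1 : commForm X u v = -(bracketMap X u * v).trace := by
    rw [commForm_apply, bracketMap_apply, mul_sub, sub_mul, Matrix.trace_sub, Matrix.trace_sub,
      ← Matrix.mul_assoc X v u, Matrix.trace_mul_comm (X * v) u, Matrix.mul_assoc X u v,
      Matrix.mul_assoc u X v]
    ring
  rw [h1, Matrix.trace]
  simp only [Matrix.diag_apply, Matrix.mul_apply]

lemma radOn_commForm (X : Matrix (Fin n) (Fin n) L) :
    radOn (commForm X) (strictUpper n L) = bracketKer X (n * n) := by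
  ext u
  rw [mem_radOn]
  refine and_congr_right fun hu => ⟨fun h a b hab _ => ?_, fun h v hv => ?_⟩
  · have h1 := h (Matrix.single b a 1) fun i j hij => by
      rw [Matrix.single_apply] at hij
      split_ifs at hij with h2
      · rw [← h2.1, ← h2.2]
        exact hab
      · exact absurd rfl hij
    rw [commForm_eq_sum, neg_eq_zero, Finset.sum_eq_single a, Finset.sum_eq_single b] at h1
    · simpa using h1
    · intro c _ hc
      rw [Matrix.single_apply, if_neg (fun h => hc h.1.symm), mul_zero]
    · simp
    · intro c _ hc
      exact Finset.sum_eq_zero fun d _ => by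
        rw [Matrix.single_apply, if_neg (fun h => hc h.2.symm), mul_zero]
    · simp
  · rw [commForm_eq_sum, neg_eq_zero]
    refine Finset.sum_eq_zero fun a _ => Finset.sum_eq_zero fun b _ => ?_
    rcases lt_or_ge b a with hab | hab
    · rw [h a b hab (placeKey_lt_sq a b), zero_mul]
    · rw [strictUpper_apply hv hab, mul_zero]

lemma finrank_radOn_unipotent {X g : Matrix (Fin n) (Fin n) L} (hg : Unipotent g) :
    Module.finrank L (radOn (commForm (g * X * g⁻¹)) (strictUpper n L)) =
      Module.finrank L (radOn (commForm X) (strictUpper n L)) := by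
  have h1 := finrank_radOn_conj g⁻¹ X hg.inv.isUnit (strictUpper n L)
  rw [Matrix.nonsing_inv_nonsing_inv g hg.isUnit] at h1
  have hmap : (strictUpper n L).map (conjEquiv g⁻¹ hg.inv.isUnit).toLinearMap =
      strictUpper n L := by
    refine Submodule.eq_of_le_of_finrank_eq ?_
      (LinearEquiv.finrank_map_eq (conjEquiv g⁻¹ hg.inv.isUnit) (strictUpper n L))
    rintro _ ⟨u, hu, rfl⟩
    change g⁻¹ * u * g⁻¹⁻¹ ∈ _
    rw [Matrix.nonsing_inv_nonsing_inv g hg.isUnit]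
    have h2 : (1 + g⁻¹ * u * g) = g⁻¹ * (1 + u) * g := by
      rw [mul_add, add_mul, mul_one, Matrix.nonsing_inv_mul g hg.isUnit]
    have h3 := ((hg.inv.mul (unipotent_one_add hu)).mul hg).sub_one_mem
    rwa [← h2, add_sub_cancel_left] at h3
  rw [← h1]
  exact congrArg (fun W : Submodule L (Matrix (Fin n) (Fin n) L) =>
    Module.finrank L (radOn (commForm X) W)) hmap

/-- The number of jumps of a conjugate of `X` is the codimension of the radical. -/
lemma card_jump {X g : Matrix (Fin n) (Fin n) L} (hg : Unipotent g) :
    (Finset.univ.filter fun p : Fin n × Fin n =>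
      p.2 < p.1 ∧ IsJump (g * X * g⁻¹) p.1 p.2).card +
      Module.finrank L (radOn (commForm X) (strictUpper n L)) =
      (Finset.univ.filter fun p : Fin n × Fin n => p.2 < p.1).card := by
  have h1 := finrank_bracketKer (g * X * g⁻¹) (n * n)
  rw [← radOn_commForm, finrank_radOn_unipotent hg] at h1
  have h2 : Module.finrank L (strictUpper n L) =
      (Finset.univ.filter fun p : Fin n × Fin n => p.2 < p.1).card :=
    (finrank_supported _).trans (by congr)
  rw [← h2, h1, add_comm]
  congr 2
  ext p
  simp [placeKey_lt_sq]

end CanonicalForm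

/-! ### Generators of the field of invariants -/

section Generators

variable {n : ℕ} {D : Set (ℕ × ℕ)} {K L : Type} [Field K] [Field L] [Algebra K L]

lemma InCell.conj_unipotent {X g : Matrix (Fin n) (Fin n) L} (hX : InCell D X) (hg : Unipotent g) :
    InCell D (g * X * g⁻¹) := by
  have h := hX.conj hg.inv.1 fun i => by simp [hg.inv.2]
  rwa [Matrix.nonsing_inv_nonsing_inv g hg.isUnit] at h

lemma lowerLeft_earlier {a b a' b' : Fin n} (hab : b < a) (h1 : a ≤ a') (h2 : b' ≤ b)
    (h3 : (a', b') ≠ (a, b)) : b' < a' ∧ placeKey a' b' < placeKey a b := by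
  refine ⟨h2.trans_lt (hab.trans_le h1), placeKey_lt_iff.2 ?_⟩
  rcases h2.lt_or_eq with h2 | rfl
  · exact Or.inl h2
  · exact Or.inr ⟨rfl, h1.lt_of_ne fun h => h3 (by rw [h])⟩

/-- At a jump, conjugation changes the entry without changing the earlier ones. -/
lemma IsJump.exists_unipotent {X : Matrix (Fin n) (Fin n) L} {a b : Fin n} (hab : b < a)
    (h : IsJump X a b) : ∃ g : Matrix (Fin n) (Fin n) L, Unipotent g ∧
      (∀ a' b', a ≤ a' → b' ≤ b → (a', b') ≠ (a, b) → (g * X * g⁻¹) a' b' = X a' b') ∧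
      (g * X * g⁻¹) a b ≠ X a b := by
  obtain ⟨u, hu, h0, hne⟩ := h
  refine ⟨1 + u, unipotent_one_add hu, fun a' b' h1 h2 h3 => ?_, fun h => ?_⟩
  · have h4 := lowerLeft_earlier hab h1 h2 h3
    rw [conj_one_add_apply hu h4.1 fun _ _ h5 h6 => h0 _ _ h5 (h6.trans h4.2), h0 _ _ h4.1 h4.2,
      add_zero]
  · rw [conj_one_add_apply hu hab h0] at h
    exact hne (by simpa using h)

lemma InCell.not_isJump_of_free (hD : IsBasic n D) {X : Matrix (Fin n) (Fin n) L}
    (hX : InCell D X) {a b : Fin n} (hab : b < a) (hf : Free D a b) : ¬ IsJump X a b := by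
  intro h
  obtain ⟨g, hg, h1, h2⟩ := h.exists_unipotent hab
  apply h2
  rw [(hX.conj_unipotent hg).eq_schurEntry hD hab hf.noHook (hf.1 b le_rfl), schurEntry_congr h1,
    ← hX.eq_schurEntry hD hab hf.noHook (hf.1 b le_rfl)]

lemma swBlock_congr {R : Type} {X Y : Matrix (Fin n) (Fin n) R} {i j : Fin n}
    (h : ∀ a b, i ≤ a → b ≤ j → (a, b) ≠ (i, j) → X a b = Y a b) :
    swBlock D X i j = swBlock D Y i j := by
  ext p q
  exact h _ _ p.2.2.1.le q.2.2.2.le fun e => p.2.2.1.ne' (Prod.ext_iff.1 e).1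

lemma not_isJump_of_mem (hD : IsBasic n D) {y X g : Matrix (Fin n) (Fin n) L} (hc : InCell D X)
    (hX : ∀ a b, b < a → X a b = cellParam D y a b) (hg : Unipotent g) {a b : Fin n}
    (hm : Mem D a b) : ¬ IsJump (g * X * g⁻¹) a b := by
  intro h
  have hab := hm.lt hD
  obtain ⟨k, hk, h1, h2⟩ := h.exists_unipotent hab
  have h3 : k * (g * X * g⁻¹) * k⁻¹ = (k * g) * X * (k * g)⁻¹ := by
    rw [Matrix.mul_inv_rev]
    noncomm_ring
  have h4 : (borderedBlock D (k * (g * X * g⁻¹) * k⁻¹) a b).det =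
      (borderedBlock D (g * X * g⁻¹) a b).det := by
    rw [h3, det_borderedBlock_conj hD hX (hk.mul hg).1 (hk.mul hg).2 hm,
      det_borderedBlock_conj hD hX hg.1 hg.2 hm]
  have hc' := hc.conj_unipotent hg
  have h5 := hc'.det_swBlock_ne_zero hD hab
  rw [det_borderedBlock_eq ((hc'.conj_unipotent hk).det_swBlock_ne_zero hD hab),
    det_borderedBlock_eq h5, swBlock_congr h1, schurEntry_congr h1] at h4
  exact h2 (by simpa using mul_left_cancel₀ h5 h4)

/-- The places carrying a generator: neither jumps of `S` nor determined by earlier entries. -/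
def IsGenPlace (D : Set (ℕ × ℕ)) (S : Matrix (Fin n) (Fin n) L) (p : Fin n × Fin n) : Prop :=
  p.2 < p.1 ∧ ¬ IsJump S p.1 p.2 ∧ ¬ Free D p.1 p.2

/-- The generator attached to a place: a bordered minor of `X` at the roots of `D`, an entry of the
canonical form `S` elsewhere. -/
noncomputable def placeGen (D : Set (ℕ × ℕ)) (X S : Matrix (Fin n) (Fin n) L)
    (p : Fin n × Fin n) : L :=
  if Mem D p.1 p.2 then minorW n L (wD n D) X (p.1 + 1) (p.2 + 1) else S p.1 p.2

variable {x : PRoot n → L}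

lemma IsGenericOn.card_genPlace [CharZero K] (hx : IsGenericOn K D x) (hD : IsBasic n D)
    {g : Matrix (Fin n) (Fin n) L} (hg : Unipotent g) :
    (Finset.univ.filter fun p : Fin n × Fin n =>
        IsGenPlace D (g * matOf n L x * g⁻¹) p).card =
      (Finset.univ.filter fun p : Fin n × Fin n =>
          ((p.1 : ℕ) + 1, (p.2 : ℕ) + 1) ∈ CD n D).card := by
  set S := g * matOf n L x * g⁻¹ with hS
  have h1 := card_jump (X := matOf n L x) hg
  have h2 := hx.finrank_radOn hD
  rw [strictUpper, h2, ← hS] at h1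
  have hc : InCell D S := (hx.inCell hD).conj_unipotent hg
  have h3 : (Finset.univ.filter fun p : Fin n × Fin n => p.2 < p.1) =
      ((Finset.univ.filter fun p : Fin n × Fin n => p.2 < p.1 ∧ IsJump S p.1 p.2).disjUnion
        (Finset.univ.filter fun p : Fin n × Fin n => ((p.1 : ℕ) + 1, (p.2 : ℕ) + 1) ∈ MD n D)
        (by
          rw [Finset.disjoint_filter]
          rintro p - ⟨h3, h4⟩ h5
          exact hc.not_isJump_of_free hD h3 ((mem_MD_iff_free hD h3).1 h5) h4)).disjUnion
        (Finset.univ.filter fun p : Fin n × Fin n => IsGenPlace D S p) (by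
          rw [Finset.disjoint_left]
          intro p h3 h4
          rw [Finset.mem_disjUnion, Finset.mem_filter, Finset.mem_filter] at h3
          obtain ⟨-, h4, h5, h6⟩ := Finset.mem_filter.1 h4
          rcases h3 with h3 | h3
          · exact h5 h3.2.2
          · exact h6 ((mem_MD_iff_free hD h4).1 h3.2)) := by
    ext p
    simp only [Finset.mem_disjUnion, Finset.mem_filter, Finset.mem_univ, true_and]
    constructor
    · intro h3
      by_cases h4 : IsJump S p.1 p.2
      · exact Or.inl (Or.inl ⟨h3, h4⟩)
      by_cases h5 : Free D p.1 p.2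
      · exact Or.inl (Or.inr ((mem_MD_iff_free hD h3).2 h5))
      · exact Or.inr ⟨h3, h4, h5⟩
    · rintro ((h3 | h3) | h3)
      · exact h3.1
      · exact isPosRoot_iff_lt.1 h3.1
      · exact h3.1
  have h4 := congrArg Finset.card h3
  rw [Finset.card_disjUnion, Finset.card_disjUnion] at h4
  have h5 : (Finset.univ.filter fun p : Fin n × Fin n => p.2 < p.1 ∧ IsJump S p.1 p.2).card +
    ((Finset.univ.filter fun p : Fin n × Fin n => ((p.1 : ℕ) + 1, (p.2 : ℕ) + 1) ∈ CD n D).card +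
    (Finset.univ.filter fun p : Fin n × Fin n => ((p.1 : ℕ) + 1, (p.2 : ℕ) + 1) ∈ MD n D).card) =
    (Finset.univ.filter fun p : Fin n × Fin n => p.2 < p.1).card := by
    convert h1
  omega

/-- Each generator is an affine function of the entry of `X` at its place, with coefficients in the
field of earlier entries. -/
lemma IsGenericOn.placeGen_eq (hx : IsGenericOn K D x) (hD : IsBasic n D)
    {S : Matrix (Fin n) (Fin n) L}
    (hS : ∀ a b, b < a → ¬ IsJump S a b →
      S a b - matOf n L x a b ∈ earlierField K (matOf n L x) (placeKey a b))
    {p : Fin n × Fin n} (hp : IsGenPlace D S p) :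
    ∃ α ∈ earlierField K (matOf n L x) (placeKey p.1 p.2),
      ∃ β ∈ earlierField K (matOf n L x) (placeKey p.1 p.2),
        α ≠ 0 ∧ placeGen D (matOf n L x) S p = α * matOf n L x p.1 p.2 + β := by
  set X := matOf n L x with hX
  set E := earlierField K X (placeKey p.1 p.2) with hE
  by_cases hm : Mem D p.1 p.2
  · obtain ⟨ε, hε, h1⟩ := minorW_eq hD X hm
    have hεE : ε ∈ E := by
      rcases hε with rfl | rfl
      · exact one_mem _
      · exact neg_mem (one_mem _)
    have h0 := (hx.inCell hD).det_swBlock_ne_zero hD hp.1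
    have h2 : (swBlock D X p.1 p.2).det ∈ E := by
      refine det_mem_of_forall E fun q r => mem_earlierField_of_lowerLeft X q.2.2.1.le r.2.2.2.le ?_
      exact fun e => q.2.2.1.ne' (Prod.ext_iff.1 e).1
    have h3 : schurEntry D X p.1 p.2 ∈ E :=
      schurEntry_mem E fun a b h4 h5 h6 => mem_earlierField_of_lowerLeft X h4 h5 h6
    refine ⟨ε * (swBlock D X p.1 p.2).det, mul_mem hεE h2,
      -(ε * (swBlock D X p.1 p.2).det * schurEntry D X p.1 p.2),
      neg_mem (mul_mem (mul_mem hεE h2) h3), mul_ne_zero ?_ h0, ?_⟩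
    · rcases hε with rfl | rfl <;> simp
    · rw [placeGen, if_pos hm, h1, det_borderedBlock_eq h0]
      ring
  · refine ⟨1, one_mem _, _, hS _ _ hp.1 hp.2.1, one_ne_zero, ?_⟩
    rw [placeGen, if_neg hm]
    ring

lemma IsGenericOn.algebraicIndependent_placeGen [CharZero K] (hx : IsGenericOn K D x)
    (hD : IsBasic n D) {S : Matrix (Fin n) (Fin n) L}
    (hS : ∀ a b, b < a → ¬ IsJump S a b →
      S a b - matOf n L x a b ∈ earlierField K (matOf n L x) (placeKey a b)) :
    AlgebraicIndependent K fun p : {p : Fin n × Fin n // IsGenPlace D S p} =>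
      placeGen D (matOf n L x) S p.1 := by
  refine algebraicIndependent_of_triangular (key := fun p => placeKey p.1.1 p.1.2) ?_
    (fun p => earlierField K (matOf n L x) (placeKey p.1.1 p.1.2)) ?_ ?_
  · intro p q h
    have := placeKey_injective h
    exact Subtype.ext (Prod.ext this.1 this.2)
  · intro p q h
    obtain ⟨α, hα, β, hβ, -, h1⟩ := hx.placeGen_eq hD hS q.2
    rw [h1]
    have hle := earlierField_mono (K := K) (matOf n L x) (le_of_lt h)
    exact add_mem (mul_mem (hle hα) (mem_earlierField _ h)) (hle hβ)
  · intro p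
    obtain ⟨α, hα, β, hβ, h0, h1⟩ := hx.placeGen_eq hD hS p.2
    rw [h1]
    exact (hx.transcendental hD p.2.1 p.2.2.2).mul_add hα hβ h0

/-- The field generated by the entries of a matrix below the diagonal. -/
noncomputable def lowerField (K : Type) [Field K] [Algebra K L] (S : Matrix (Fin n) (Fin n) L) :
    IntermediateField K L :=
  IntermediateField.adjoin K {z | ∃ a b, b < a ∧ S a b = z}

lemma mem_lowerField {S : Matrix (Fin n) (Fin n) L} {a b : Fin n} (h : b < a) :
    S a b ∈ lowerField K S := IntermediateField.subset_adjoin K _ ⟨a, b, h, rfl⟩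

/-- The generators generate the field of entries of the canonical form. -/
lemma IsGenericOn.adjoin_placeGen (hx : IsGenericOn K D x) (hD : IsBasic n D)
    {g : Matrix (Fin n) (Fin n) L} (hg : Unipotent g) (hcan : IsCanonical (g * matOf n L x * g⁻¹)) :
    IntermediateField.adjoin K (Set.range
      fun p : {p : Fin n × Fin n // IsGenPlace D (g * matOf n L x * g⁻¹) p} =>
        placeGen D (matOf n L x) (g * matOf n L x * g⁻¹) p.1) =
      lowerField K (g * matOf n L x * g⁻¹) := by
  obtain ⟨y, hy, hyx⟩ := hx.exists_cellParam_eq hD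
  set X := matOf n L x with hX
  set S := g * X * g⁻¹ with hS
  have hXc : InCell D X := hx.inCell hD
  have hc : InCell D S := hXc.conj_unipotent hg
  have hmin : ∀ a b, Mem D a b → ∃ ε : L, (ε = 1 ∨ ε = -1) ∧
      minorW n L (wD n D) X (a + 1) (b + 1) = ε * (borderedBlock D S a b).det := by
    intro a b hm
    obtain ⟨ε, hε, h1⟩ := minorW_eq hD X hm
    exact ⟨ε, hε, by rw [h1, hS, det_borderedBlock_conj hD hyx hg.1 hg.2 hm]⟩
  apply le_antisymm
  · rw [IntermediateField.adjoin_le_iff]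
    rintro _ ⟨p, rfl⟩
    change placeGen D X S p.1 ∈ lowerField K S
    rw [placeGen]
    split_ifs with hm
    · obtain ⟨ε, hε, h1⟩ := hmin _ _ hm
      rw [h1]
      refine mul_mem ?_ (det_mem_of_forall _ fun q r => mem_lowerField ?_)
      · rcases hε with rfl | rfl
        · exact one_mem _
        · exact neg_mem (one_mem _)
      · have hq : p.1.1 ≤
            Sum.elim (fun p : SouthWest D p.1.1 p.1.2 => p.1.1) (fun _ => p.1.1) q := by
          rcases q with q | q
          · exact q.2.2.1.le
          · exact le_rfl
        have hr : Sum.elim (fun p : SouthWest D p.1.1 p.1.2 => p.1.2) (fun _ => p.1.2) r ≤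
            p.1.2 := by
          rcases r with r | r
          · exact r.2.2.2.le
          · exact le_rfl
        exact hr.trans_lt (p.2.1.trans_le hq)
    · exact mem_lowerField p.2.1
  · set A := IntermediateField.adjoin K (Set.range
      fun p : {p : Fin n × Fin n // IsGenPlace D S p} => placeGen D X S p.1) with hA
    have key : ∀ k, ∀ a b, b < a → placeKey a b < k → S a b ∈ A := by
      intro k
      induction k with
      | zero => intro _ _ _ h; omega
      | succ k ih =>
        intro a b hab hk
        have ih' : ∀ a' b', a ≤ a' → b' ≤ b → (a', b') ≠ (a, b) → S a' b' ∈ A := by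
          intro a' b' h1 h2 h3
          have h4 := lowerLeft_earlier hab h1 h2 h3
          exact ih a' b' h4.1 (by omega)
        by_cases hJ : IsJump S a b
        · rw [hcan a b hab hJ]
          exact zero_mem _
        by_cases hf : Free D a b
        · rw [hc.eq_schurEntry hD hab hf.noHook (hf.1 b le_rfl)]
          exact schurEntry_mem A ih'
        have hmem : placeGen D X S (a, b) ∈ A :=
          IntermediateField.subset_adjoin K _ ⟨⟨(a, b), hab, hJ, hf⟩, rfl⟩
        by_cases hm : Mem D a b
        · rw [placeGen, if_pos hm] at hmem
          obtain ⟨ε, hε, h1⟩ := hmin a b hm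
          have h0 := hc.det_swBlock_ne_zero hD hab
          have hεA : ε ∈ A := by
            rcases hε with rfl | rfl
            · exact one_mem _
            · exact neg_mem (one_mem _)
          have hε2 : ε * ε = 1 := by rcases hε with rfl | rfl <;> ring
          rw [h1, det_borderedBlock_eq h0] at hmem
          have h2 : (swBlock D S a b).det ∈ A := by
            refine det_mem_of_forall A fun q r => ih' _ _ q.2.2.1.le r.2.2.2.le ?_
            exact fun e => q.2.2.1.ne' (Prod.ext_iff.1 e).1
          have h3 : S a b = (swBlock D S a b).det⁻¹ *
              (ε * (ε * ((swBlock D S a b).det * (S a b - schurEntry D S a b)))) +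
                schurEntry D S a b := by
            rw [← mul_assoc ε, hε2, one_mul, inv_mul_cancel_left₀ h0]
            ring
          rw [h3]
          exact add_mem (mul_mem (inv_mem h2) (mul_mem hεA hmem)) (schurEntry_mem A ih')
        · rwa [placeGen, if_neg hm] at hmem
    rw [lowerField, IntermediateField.adjoin_le_iff]
    rintro _ ⟨a, b, hab, rfl⟩
    exact key _ a b hab (Nat.lt_succ_self _)

end Generators

section Transfer

variable {n : ℕ} {D : Set (ℕ × ℕ)} {K L : Type} [Field K] [Field L] [Algebra K L]

lemma isPosRoot_of_mem_CD (hD : IsBasic n D) {γ : ℕ × ℕ} (h : γ ∈ CD n D) : IsPosRoot n γ := by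
  obtain ⟨h1, h2, h3⟩ := (mem_CD_iff hD (k := γ.1) (c := γ.2)).1 h
  exact ⟨h1, h3.1.1, h2⟩

/-- The generating system of the field of entries of the canonical form, indexed by `C(D)`. -/
lemma IsGenericOn.exists_generators [CharZero K] {x : PRoot n → L} (hx : IsGenericOn K D x)
    (hD : IsBasic n D) :
    ∃ (g : Matrix (Fin n) (Fin n) L) (F : {γ : ℕ × ℕ // γ ∈ CD n D} → L),
      Unipotent g ∧ IsCanonical (g * matOf n L x * g⁻¹) ∧ AlgebraicIndependent K F ∧
      IntermediateField.adjoin K (Set.range F) = lowerField K (g * matOf n L x * g⁻¹) ∧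
      ∀ ξ, ξ.1 ∈ D → F ξ = minorW n L (wD n D) (matOf n L x) ξ.1.1 ξ.1.2 := by
  obtain ⟨g, hg, hcan, hgE⟩ := exists_canonical K (matOf n L x)
  have hind := hx.algebraicIndependent_placeGen hD hgE
  have hgen := hx.adjoin_placeGen hD hg hcan
  have hcard := hx.card_genPlace hD hg
  set S := g * matOf n L x * g⁻¹ with hS
  let place : {γ : ℕ × ℕ // γ ∈ CD n D} → Fin n × Fin n := fun ξ =>
    (rootRow ⟨ξ.1, isPosRoot_of_mem_CD hD ξ.2⟩, rootCol ⟨ξ.1, isPosRoot_of_mem_CD hD ξ.2⟩)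
  have hplace : ∀ ξ, ((place ξ).1.1 + 1, (place ξ).2.1 + 1) = ξ.1 := fun ξ =>
    congrArg Subtype.val (mkRoot_rootRow_rootCol ⟨ξ.1, isPosRoot_of_mem_CD hD ξ.2⟩)
  have hinj : Function.Injective place := by
    intro ξ η h
    have h1 := hplace ξ
    rw [h, hplace η] at h1
    exact Subtype.ext h1.symm
  have : Finite {γ : ℕ × ℕ // γ ∈ CD n D} := Finite.of_injective place hinj
  have : Fintype {γ : ℕ × ℕ // γ ∈ CD n D} := Fintype.ofFinite _
  have hC : Fintype.card {γ : ℕ × ℕ // γ ∈ CD n D} =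
      (Finset.univ.filter fun p : Fin n × Fin n => IsGenPlace D S p).card := by
    rw [hcard, ← Finset.card_univ, ← Finset.card_image_of_injective _ hinj]
    congr 1
    ext p
    simp only [Finset.mem_image, Finset.mem_univ, true_and, Finset.mem_filter]
    constructor
    · rintro ⟨ξ, rfl⟩
      rw [hplace]
      exact ξ.2
    · intro h
      refine ⟨⟨_, h⟩, ?_⟩
      have h1 := hplace ⟨_, h⟩
      simp only [Prod.mk.injEq] at h1
      exact Prod.ext (Fin.ext (by omega)) (Fin.ext (by omega))
  obtain ⟨e, he⟩ := Finset.exists_equiv_extend_of_card_eq hC (f := place)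
    (s := Finset.univ.filter fun ξ => ξ.1 ∈ D) (by
      intro p hp
      simp only [Finset.mem_image, Finset.mem_filter, Finset.mem_univ, true_and] at hp ⊢
      obtain ⟨ξ, hξ, rfl⟩ := hp
      have hm : Mem D (place ξ).1 (place ξ).2 := by
        unfold Mem
        rw [hplace]
        exact hξ
      obtain ⟨y, -, hyx⟩ := hx.exists_cellParam_eq hD
      exact ⟨hm.lt hD, not_isJump_of_mem hD (hx.inCell hD) hyx hg hm,
        fun hf => hf.1 _ le_rfl hm⟩) hinj.injOn
  let e' : {γ : ℕ × ℕ // γ ∈ CD n D} ≃ {p : Fin n × Fin n // IsGenPlace D S p} :=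
    e.trans (Equiv.subtypeEquivRight fun p => by simp)
  have he' : ∀ ξ, (e' ξ).1 = (e ξ).1 := fun _ => rfl
  refine ⟨g, fun ξ => placeGen D (matOf n L x) S (e' ξ).1, hg, hcan,
    hind.comp e' e'.injective, ?_, fun ξ hξ => ?_⟩
  · rw [← hgen, ← e'.surjective.range_comp]
    rfl
  · have h1 : (e' ξ).1 = place ξ := (he' ξ).trans (he ξ (by simpa using hξ))
    have h2 := hplace ξ
    have hm : Mem D (place ξ).1 (place ξ).2 := by
      unfold Mem
      rw [h2]
      exact hξ
    change placeGen D (matOf n L x) S (e' ξ).1 = _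
    rw [h1, placeGen, if_pos hm, ← h2]

end Transfer

/-! ### The coadjoint action on points and functions -/

section Coadjoint

variable {n : ℕ} {D : Set (ℕ × ℕ)} {K L : Type} [Field K] [Field L]

lemma vecOf_apply (A : Matrix (Fin n) (Fin n) K) (γ : PRoot n) :
    vecOf n K A γ = A (rootRow γ) (rootCol γ) := rfl

lemma vecOf_congr {A B : Matrix (Fin n) (Fin n) K} (h : ∀ a b, b < a → A a b = B a b) :
    vecOf n K A = vecOf n K B := funext fun γ => h _ _ (rootCol_lt_rootRow γ)

lemma vecOf_lowerPart (A : Matrix (Fin n) (Fin n) K) :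
    vecOf n K (lowerPart n K A) = vecOf n K A :=
  vecOf_congr fun _ _ h => if_pos h

lemma coadjPt_eq (g : Matrix (Fin n) (Fin n) K) (v : PRoot n → K) :
    coadjPt n K g v = vecOf n K (g * matOf n K v * g⁻¹) := vecOf_lowerPart _

lemma vecOf_matOf (v : PRoot n → K) : vecOf n K (matOf n K v) = v := funext (matOf_root v)

lemma isUni_iff {g : Matrix (Fin n) (Fin n) K} : IsUni n K g ↔ Unipotent g :=
  ⟨fun h => ⟨fun _ _ hij => h.2 _ _ hij, h.1⟩, fun h => ⟨h.2, fun _ _ hij => h.1 hij⟩⟩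

/-- Entries of `gAh` below the diagonal only depend on the entries of `A` below the diagonal. -/
lemma triangular_mul_congr {g h A B : Matrix (Fin n) (Fin n) K} (hg : g.BlockTriangular id)
    (hh : h.BlockTriangular id) (hAB : ∀ a b, b < a → A a b = B a b) {a b : Fin n} (hab : b < a) :
    (g * A * h) a b = (g * B * h) a b := by
  have h1 : (A - B).BlockTriangular id := fun i j hij => by
    rw [Matrix.sub_apply, hAB i j hij, sub_self]
  have h2 := upper_conj hg hh h1 (show id b < id a from hab)
  rw [mul_sub, sub_mul, Matrix.sub_apply] at h2
  exact sub_eq_zero.1 h2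

lemma vecOf_conj_matOf {g A : Matrix (Fin n) (Fin n) K} (hg : Unipotent g) :
    vecOf n K (g * A * g⁻¹) = coadjPt n K g (vecOf n K A) := by
  rw [coadjPt_eq]
  exact vecOf_congr fun a b hab =>
    triangular_mul_congr hg.1 hg.inv.1 (fun a b h => (matOf_vecOf A h).symm) hab

lemma coadjPt_mul {g h : Matrix (Fin n) (Fin n) K} (hg : Unipotent g) (v : PRoot n → K) :
    coadjPt n K (g * h) v = coadjPt n K g (coadjPt n K h v) := by
  rw [coadjPt_eq h, ← vecOf_conj_matOf hg, coadjPt_eq, Matrix.mul_inv_rev]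
  simp only [mul_assoc]

lemma coadjPt_one (v : PRoot n → K) : coadjPt n K 1 v = v := by
  rw [coadjPt_eq, inv_one, one_mul, mul_one, vecOf_matOf]

lemma coadjPt_mem_VDcell {g : Matrix (Fin n) (Fin n) K} (hg : Unipotent g) {v : PRoot n → K}
    (hv : v ∈ VDcell n K D) : coadjPt n K g v ∈ VDcell n K D := by
  obtain ⟨φ, hφ, g₁, h₁, hg₁, hh₁, rfl⟩ := hv
  refine ⟨φ, hφ, g * g₁, h₁ * g⁻¹, isUni_iff.2 (hg.mul (isUni_iff.1 hg₁)),
    isUni_iff.2 ((isUni_iff.1 hh₁).mul hg.inv), ?_⟩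
  rw [vecOf_lowerPart, vecOf_lowerPart, ← vecOf_conj_matOf hg]
  simp only [mul_assoc]

lemma Unipotent.map {g : Matrix (Fin n) (Fin n) K} (hg : Unipotent g) (f : K →+* L) :
    Unipotent (f.mapMatrix g) := by
  refine ⟨fun i j hij => ?_, fun a => ?_⟩
  · rw [RingHom.mapMatrix_apply, Matrix.map_apply, hg.1 hij, map_zero]
  · rw [RingHom.mapMatrix_apply, Matrix.map_apply, hg.2, map_one]

lemma Unipotent.map_inv {g : Matrix (Fin n) (Fin n) K} (hg : Unipotent g) (f : K →+* L) :
    f.mapMatrix g⁻¹ = (f.mapMatrix g)⁻¹ := by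
  refine (Matrix.inv_eq_right_inv ?_).symm
  rw [← map_mul, Matrix.mul_nonsing_inv g hg.isUnit, map_one]

variable [Algebra K L]

/-- The pullback of a polynomial function under the coadjoint action of `g`. -/
noncomputable def coadjPoly (g : Matrix (Fin n) (Fin n) K) (p : MvPolynomial (PRoot n) K) :
    MvPolynomial (PRoot n) K :=
  MvPolynomial.aeval (fun γ => (MvPolynomial.C.mapMatrix g * genMat n K *
    MvPolynomial.C.mapMatrix g⁻¹ : Matrix (Fin n) (Fin n) (MvPolynomial (PRoot n) K))
      (rootRow γ) (rootCol γ)) p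

lemma aeval_coadjPoly {g : Matrix (Fin n) (Fin n) K} (hg : Unipotent g) (v : PRoot n → L)
    (p : MvPolynomial (PRoot n) K) :
    MvPolynomial.aeval v (coadjPoly g p) =
      MvPolynomial.aeval (coadjPt n L ((algebraMap K L).mapMatrix g) v) p := by
  rw [coadjPoly, ← AlgHom.comp_apply, MvPolynomial.comp_aeval, coadjPt_eq, ← hg.map_inv]
  congr 1
  congr 1
  funext γ
  have hC : ∀ k : Matrix (Fin n) (Fin n) K,
      (MvPolynomial.aeval v : MvPolynomial (PRoot n) K →ₐ[K] L).toRingHom.mapMatrix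
        (MvPolynomial.C.mapMatrix k) = (algebraMap K L).mapMatrix k := by
    intro k
    ext a b
    exact MvPolynomial.aeval_C v _
  have hG : (MvPolynomial.aeval v : MvPolynomial (PRoot n) K →ₐ[K] L).toRingHom.mapMatrix
      (genMat n K) = matOf n L v := by
    ext a b
    exact aeval_genMat v a b
  rw [vecOf_apply, ← hC, ← hC, ← hG, ← map_mul, ← map_mul]
  rfl

lemma eval_coadjPoly {g : Matrix (Fin n) (Fin n) K} (hg : Unipotent g) (v : PRoot n → K)
    (p : MvPolynomial (PRoot n) K) :
    MvPolynomial.eval v (coadjPoly g p) = MvPolynomial.eval (coadjPt n K g v) p := by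
  have h := aeval_coadjPoly hg v p
  simpa [MvPolynomial.aeval_eq_eval] using h

/-- The coadjoint action moves generic points to generic points. -/
lemma IsGenericOn.coadjPt {x : PRoot n → L} (hx : IsGenericOn K D x)
    {g : Matrix (Fin n) (Fin n) K} (hg : Unipotent g) :
    IsGenericOn K D (coadjPt n L ((algebraMap K L).mapMatrix g) x) := by
  intro p
  rw [← aeval_coadjPoly hg, hx]
  constructor
  · intro h v hv
    have h1 := h _ (coadjPt_mem_VDcell hg.inv hv)
    rwa [eval_coadjPoly hg, ← coadjPt_mul hg, Matrix.mul_nonsing_inv g hg.isUnit,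
      coadjPt_one] at h1
  · intro h v hv
    rw [eval_coadjPoly hg]
    exact h _ (coadjPt_mem_VDcell hg hv)

/-- The invariance relation of a pair of polynomials, at the generic point. -/
lemma IsGenericOn.forall_eval_iff {x : PRoot n → L} (hx : IsGenericOn K D x)
    {g : Matrix (Fin n) (Fin n) K} (hg : Unipotent g) (f h : MvPolynomial (PRoot n) K) :
    (∀ v ∈ VDcell n K D, MvPolynomial.eval (_root_.coadjPt n K g v) f * MvPolynomial.eval v h =
      MvPolynomial.eval v f * MvPolynomial.eval (_root_.coadjPt n K g v) h) ↔
    MvPolynomial.aeval (_root_.coadjPt n L ((algebraMap K L).mapMatrix g) x) f *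
        MvPolynomial.aeval x h =
      MvPolynomial.aeval x f *
        MvPolynomial.aeval (_root_.coadjPt n L ((algebraMap K L).mapMatrix g) x) h := by
  rw [← aeval_coadjPoly hg, ← aeval_coadjPoly hg, ← map_mul, ← map_mul, ← sub_eq_zero, ← map_sub,
    hx]
  refine forall₂_congr fun v _ => ?_
  rw [map_sub, sub_eq_zero, map_mul, map_mul, eval_coadjPoly hg, eval_coadjPoly hg]

/-- Matrices with ones on the diagonal and prescribed entries above it. -/
def uniMat {R : Type} [CommRing R] (t : Fin n × Fin n → R) : Matrix (Fin n) (Fin n) R :=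
  fun a b => if a = b then 1 else if a < b then t (a, b) else 0

lemma unipotent_uniMat (t : Fin n × Fin n → L) : Unipotent (uniMat t) := by
  refine ⟨fun i j (hij : j < i) => ?_, fun a => if_pos rfl⟩
  rw [uniMat, if_neg hij.ne', if_neg hij.not_gt]

lemma Unipotent.eq_uniMat {g : Matrix (Fin n) (Fin n) L} (hg : Unipotent g) :
    g = uniMat fun p => g p.1 p.2 := by
  ext a b
  unfold uniMat
  split_ifs with h1 h2
  · rw [h1, hg.2]
  · rfl
  · exact hg.1 (lt_of_le_of_ne (not_lt.1 h2) (Ne.symm h1))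

lemma map_uniMat {R S : Type} [CommRing R] [CommRing S] (f : R →+* S) (t : Fin n × Fin n → R) :
    f.mapMatrix (uniMat t) = uniMat (f ∘ t) := by
  ext a b
  simp only [uniMat, RingHom.mapMatrix_apply, Matrix.map_apply, apply_ite f, map_one, map_zero,
    Function.comp]

/-- The value of `p` at the conjugates of `Y`, as a polynomial in the conjugating matrix. -/
noncomputable def orbitPoly (Y : Matrix (Fin n) (Fin n) L) (p : MvPolynomial (PRoot n) K) :
    MvPolynomial (Fin n × Fin n) L :=
  MvPolynomial.aeval (fun γ => (uniMat MvPolynomial.X * MvPolynomial.C.mapMatrix Y *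
    (uniMat MvPolynomial.X).adjugate : Matrix (Fin n) (Fin n) (MvPolynomial (Fin n × Fin n) L))
      (rootRow γ) (rootCol γ)) p

lemma eval_orbitPoly (Y : Matrix (Fin n) (Fin n) L) (p : MvPolynomial (PRoot n) K)
    (t : Fin n × Fin n → L) :
    MvPolynomial.eval t (orbitPoly Y p) =
      MvPolynomial.aeval (vecOf n L (uniMat t * Y * (uniMat t)⁻¹)) p := by
  let ψ : MvPolynomial (Fin n × Fin n) L →ₐ[K] L := (MvPolynomial.aeval t).restrictScalars K
  change ψ (orbitPoly Y p) = _
  rw [orbitPoly, ← AlgHom.comp_apply, MvPolynomial.comp_aeval]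
  congr 1
  congr 1
  funext γ
  have h1 : ψ.toRingHom.mapMatrix (uniMat MvPolynomial.X) = uniMat t := by
    rw [map_uniMat]
    congr 1
    funext q
    exact MvPolynomial.aeval_X t q
  have h2 : ψ.toRingHom.mapMatrix (MvPolynomial.C.mapMatrix Y) = Y := by
    ext a b
    exact MvPolynomial.aeval_C t _
  have h3 : (uniMat t)⁻¹ = ψ.toRingHom.mapMatrix (uniMat MvPolynomial.X).adjugate := by
    have hd : (uniMat t).det = 1 := by
      rw [Matrix.det_of_isUpperTriangular (unipotent_uniMat t).1]
      exact Finset.prod_eq_one fun a _ => (unipotent_uniMat t).2 a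
    rw [RingHom.map_adjugate, h1, Matrix.inv_def, hd, Ring.inverse_one, one_smul]
  rw [vecOf_apply, h3]
  conv_rhs => rw [← h1, ← h2, ← map_mul, ← map_mul]
  rfl

lemma eq_of_eval_algebraMap [CharZero K] {σ : Type} {p q : MvPolynomial σ L}
    (h : ∀ t : σ → K, MvPolynomial.eval (algebraMap K L ∘ t) p =
      MvPolynomial.eval (algebraMap K L ∘ t) q) : p = q := by
  refine MvPolynomial.funext_set (fun _ => Set.range (algebraMap K L))
    (fun _ => Set.infinite_range_of_injective (algebraMap K L).injective) fun y hy => ?_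
  choose t ht using fun i => hy i (Set.mem_univ i)
  rw [← show algebraMap K L ∘ t = y from funext ht]
  exact h t

end Coadjoint

/-! ### Invariants -/

section Invariants

variable {n : ℕ} {D : Set (ℕ × ℕ)} {K L : Type} [Field K] [Field L] [Algebra K L]

lemma bracketMap_map (τ : L →+* L) (X u : Matrix (Fin n) (Fin n) L) :
    bracketMap (τ.mapMatrix X) (τ.mapMatrix u) = τ.mapMatrix (bracketMap X u) := by
  rw [bracketMap_apply, bracketMap_apply, map_sub, map_mul, map_mul]

/-- Field endomorphisms preserve canonical forms. -/
lemma IsCanonical.map {S : Matrix (Fin n) (Fin n) L} (hS : IsCanonical S) (τ : L →ₐ[K] L) :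
    IsCanonical ((τ : L →+* L).mapMatrix S) := by
  intro a b hab hJ
  have hSE : ∀ a' b', b' < a' → placeKey a' b' < placeKey a b →
      (τ : L →+* L).mapMatrix S a' b' ∈ τ.fieldRange := fun a' b' _ _ => ⟨S a' b', rfl⟩
  obtain ⟨u, hu, huE, h0, h1⟩ := hJ.exists_mem τ.fieldRange hab hSE
  obtain ⟨v, hv⟩ : ∃ v : Matrix (Fin n) (Fin n) L, ∀ i j, τ (v i j) = u i j := by
    choose v hv using huE
    exact ⟨Matrix.of v, hv⟩
  obtain rfl : (τ : L →+* L).mapMatrix v = u := by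
    ext i j
    exact hv i j
  have hz : ∀ z : L, (τ : L →+* L) z = 0 ↔ z = 0 := fun z =>
    map_eq_zero_iff _ (τ : L →+* L).injective
  have hS0 : S a b = 0 := by
    refine hS a b hab ⟨v, fun i j hij => hu i j ?_, fun a' b' h2 h3 => ?_, ?_⟩
    · rwa [RingHom.mapMatrix_apply, Matrix.map_apply, ne_eq, hz]
    · have h4 := h0 a' b' h2 h3
      rwa [bracketMap_map, RingHom.mapMatrix_apply, Matrix.map_apply, hz] at h4
    · rwa [bracketMap_map, RingHom.mapMatrix_apply, Matrix.map_apply, ne_eq, hz] at h1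
  rw [RingHom.mapMatrix_apply, Matrix.map_apply, hS0, map_zero]

lemma map_matOf (τ : L →+* L) (x : PRoot n → L) :
    τ.mapMatrix (matOf n L x) = matOf n L (τ ∘ x) := by
  ext a b
  rw [RingHom.mapMatrix_apply, Matrix.map_apply, matOf, matOf]
  split_ifs
  · rfl
  · exact map_zero τ

/-- The entries of the canonical form are fixed by the endomorphisms which act on the coordinates
through the coadjoint action. -/
lemma IsCanonical.apply_eq {x : PRoot n → L} {g k : Matrix (Fin n) (Fin n) L} (hg : Unipotent g)
    (hk : Unipotent k) (hS : IsCanonical (g * matOf n L x * g⁻¹)) (τ : L →ₐ[K] L)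
    (hτ : τ ∘ x = coadjPt n L k x) {z : L} (hz : z ∈ lowerField K (g * matOf n L x * g⁻¹)) :
    τ z = z := by
  set S := g * matOf n L x * g⁻¹ with hSdef
  have hτg := hg.map (τ : L →+* L)
  have hent : ∀ a b, b < a → ((τ : L →+* L).mapMatrix S) a b = S a b := by
    refine hS.unique (hS.map τ) ((hτg.mul hk).mul hg.inv) fun a b hab => ?_
    rw [hSdef, map_mul, map_mul, hg.map_inv, map_matOf,
      show ((τ : L →+* L) : L → L) ∘ x = coadjPt n L k x from hτ, coadjPt_eq,
      triangular_mul_congr (B := k * matOf n L x * k⁻¹) hτg.1 hτg.inv.1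
        (fun a b h => matOf_vecOf _ h) hab]
    simp only [Matrix.mul_inv_rev, Matrix.nonsing_inv_nonsing_inv g hg.isUnit, mul_assoc,
      Matrix.nonsing_inv_mul_cancel_left g _ hg.isUnit]
  induction hz using IntermediateField.adjoin_induction with
  | mem z hz =>
    obtain ⟨a, b, hab, rfl⟩ := hz
    exact hent a b hab
  | algebraMap r => exact τ.commutes r
  | add y z _ _ hy hz => rw [map_add, hy, hz]
  | inv z _ hz => rw [map_inv₀, hz]
  | mul y z _ _ hy hz => rw [map_mul, hy, hz]

lemma aeval_mem_of_forall (E : IntermediateField K L) {σ : Type} (v : σ → L) (hv : ∀ i, v i ∈ E)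
    (p : MvPolynomial σ K) : MvPolynomial.aeval v p ∈ E := by
  have h := MvPolynomial.aeval_algebraMap_apply L (fun i => (⟨v i, hv i⟩ : E)) p
  have hv' : (algebraMap E L ∘ fun i => (⟨v i, hv i⟩ : E)) = v := rfl
  rw [hv'] at h
  rw [h]
  exact (MvPolynomial.aeval (fun i => (⟨v i, hv i⟩ : E)) p).2

/-- Quotients of polynomials satisfying the invariance relation at the point `x` lie in the field
generated by the entries of any conjugate of `matOf x`. -/
lemma mem_lowerField_of_invariant [CharZero K] {x : PRoot n → L} {g : Matrix (Fin n) (Fin n) L}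
    (hg : Unipotent g) {f h : MvPolynomial (PRoot n) K} (hh : MvPolynomial.aeval x h ≠ 0)
    (hinv : ∀ k : Matrix (Fin n) (Fin n) K, Unipotent k →
      MvPolynomial.aeval (coadjPt n L ((algebraMap K L).mapMatrix k) x) f *
          MvPolynomial.aeval x h =
        MvPolynomial.aeval x f *
          MvPolynomial.aeval (coadjPt n L ((algebraMap K L).mapMatrix k) x) h) :
    MvPolynomial.aeval x f / MvPolynomial.aeval x h ∈ lowerField K (g * matOf n L x * g⁻¹) := by
  set S := g * matOf n L x * g⁻¹ with hS
  have hpoly : orbitPoly (matOf n L x) f * MvPolynomial.C (MvPolynomial.aeval x h) =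
      MvPolynomial.C (MvPolynomial.aeval x f) * orbitPoly (matOf n L x) h := by
    refine eq_of_eval_algebraMap (K := K) fun t => ?_
    rw [map_mul, map_mul, MvPolynomial.eval_C, MvPolynomial.eval_C, eval_orbitPoly,
      eval_orbitPoly, ← map_uniMat (algebraMap K L) t, ← coadjPt_eq]
    exact hinv _ (unipotent_uniMat t)
  have hext : ∀ k : Matrix (Fin n) (Fin n) L, Unipotent k →
      MvPolynomial.aeval (vecOf n L (k * matOf n L x * k⁻¹)) f * MvPolynomial.aeval x h =
        MvPolynomial.aeval x f *
          MvPolynomial.aeval (vecOf n L (k * matOf n L x * k⁻¹)) h := by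
    intro k hk
    have h1 := congrArg (MvPolynomial.eval fun p => k p.1 p.2) hpoly
    rwa [map_mul, map_mul, MvPolynomial.eval_C, MvPolynomial.eval_C, eval_orbitPoly,
      eval_orbitPoly, ← hk.eq_uniMat] at h1
  obtain ⟨t, ht⟩ : ∃ t : Fin n × Fin n → K,
      MvPolynomial.eval (algebraMap K L ∘ t) (orbitPoly S h) ≠ 0 := by
    by_contra! h0
    have h1 : orbitPoly S h = 0 := eq_of_eval_algebraMap (K := K) fun t => by rw [h0 t, map_zero]
    refine hh ?_
    have h2 := eval_orbitPoly S h fun p => g⁻¹ p.1 p.2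
    rw [← hg.inv.eq_uniMat, h1, map_zero, hS] at h2
    rw [h2]
    simp only [Matrix.nonsing_inv_nonsing_inv g hg.isUnit, mul_assoc,
      Matrix.nonsing_inv_mul_cancel_left g _ hg.isUnit, Matrix.nonsing_inv_mul g hg.isUnit,
      mul_one, vecOf_matOf]
  have hk := unipotent_uniMat t
  have hkL := hk.map (algebraMap K L)
  rw [eval_orbitPoly, ← map_uniMat (algebraMap K L) t] at ht
  have hrel := hext _ (hkL.mul hg)
  rw [show (algebraMap K L).mapMatrix (uniMat t) * g * matOf n L x *
      ((algebraMap K L).mapMatrix (uniMat t) * g)⁻¹ =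
      (algebraMap K L).mapMatrix (uniMat t) * S * ((algebraMap K L).mapMatrix (uniMat t))⁻¹ by
    rw [hS, Matrix.mul_inv_rev]; simp only [mul_assoc]] at hrel
  rw [(div_eq_div_iff hh ht).2 hrel.symm]
  have hmem : ∀ p : MvPolynomial (PRoot n) K, MvPolynomial.aeval (vecOf n L
      ((algebraMap K L).mapMatrix (uniMat t) * S * ((algebraMap K L).mapMatrix (uniMat t))⁻¹)) p ∈
        lowerField K S := by
    intro p
    rw [vecOf_conj_matOf hkL, ← aeval_coadjPoly hk]
    exact aeval_mem_of_forall _ _ (fun γ => mem_lowerField (rootCol_lt_rootRow γ)) _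
  exact div_mem (hmem f) (hmem h)

lemma aeval_minorW (x : PRoot n → L) (w : ℕ → ℕ) (i j : ℕ) :
    MvPolynomial.aeval x (minorW n (MvPolynomial (PRoot n) K) w (genMat n K) i j) =
      minorW n L w (matOf n L x) i j := by
  unfold minorW
  dsimp only
  split_ifs with h
  · rw [AlgHom.map_det]
    congr 1
    ext a b
    exact aeval_genMat x _ _
  · exact map_zero _

end Invariants

section RationalFunctions

variable {n : ℕ} {D : Set (ℕ × ℕ)} {K : Type} [Field K]

/-- The coordinate functions in the field of rational functions. -/
noncomputable def coordFn (S : Set (PRoot n → K)) (γ : PRoot n) : RatFld n K S :=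
  algebraMap (MvPolynomial (PRoot n) K ⧸ vanishing (PRoot n) K S) (RatFld n K S)
    (Ideal.Quotient.mk _ (MvPolynomial.X γ))

lemma aeval_coordFn (p : MvPolynomial (PRoot n) K) :
    MvPolynomial.aeval (coordFn (VDcell n K D)) p =
      algebraMap (MvPolynomial (PRoot n) K ⧸ vanishing (PRoot n) K (VDcell n K D))
        (RatFld n K (VDcell n K D)) (Ideal.Quotient.mk _ p) := by
  have h : MvPolynomial.aeval (coordFn (VDcell n K D)) =
      (IsScalarTower.toAlgHom K
        (MvPolynomial (PRoot n) K ⧸ vanishing (PRoot n) K (VDcell n K D))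
        (RatFld n K (VDcell n K D))).comp (Ideal.Quotient.mkₐ K _) := by
    ext γ
    rw [MvPolynomial.aeval_X]
    rfl
  rw [h]
  rfl

variable [hI : (vanishing (PRoot n) K (VDcell n K D)).IsPrime]

lemma isGenericOn_coordFn : IsGenericOn K D (coordFn (VDcell n K D)) := by
  intro p
  rw [aeval_coordFn, map_eq_zero_iff _ (IsFractionRing.injective
    (MvPolynomial (PRoot n) K ⧸ vanishing (PRoot n) K (VDcell n K D)) _),
    Ideal.Quotient.eq_zero_iff_mem]

lemma exists_algHom_coordFn {y : PRoot n → RatFld n K (VDcell n K D)} (hy : IsGenericOn K D y) :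
    ∃ τ : RatFld n K (VDcell n K D) →ₐ[K] RatFld n K (VDcell n K D),
      τ ∘ coordFn (VDcell n K D) = y := by
  let ψ : (MvPolynomial (PRoot n) K ⧸ vanishing (PRoot n) K (VDcell n K D)) →ₐ[K]
      RatFld n K (VDcell n K D) :=
    Ideal.Quotient.liftₐ _ (MvPolynomial.aeval y) fun p hp => (hy p).2 hp
  have hψ : ∀ p, ψ (Ideal.Quotient.mk _ p) = MvPolynomial.aeval y p := fun p =>
    Ideal.Quotient.liftₐ_apply _ _ _ _
  have hinj : Function.Injective ψ := by
    refine (injective_iff_map_eq_zero ψ).2 fun q hq => ?_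
    obtain ⟨p, rfl⟩ := Ideal.Quotient.mk_surjective q
    rw [hψ, hy] at hq
    exact Ideal.Quotient.eq_zero_iff_mem.2 hq
  refine ⟨IsFractionRing.liftAlgHom hinj, funext fun γ => ?_⟩
  rw [Function.comp_apply, coordFn, IsFractionRing.liftAlgHom_apply]
  refine (IsFractionRing.lift_algebraMap _ _).trans ?_
  refine (hψ _).trans (MvPolynomial.aeval_X _ _)

lemma exists_div_coordFn (G : RatFld n K (VDcell n K D)) :
    ∃ f h : MvPolynomial (PRoot n) K, MvPolynomial.aeval (coordFn (VDcell n K D)) h ≠ 0 ∧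
      MvPolynomial.aeval (coordFn (VDcell n K D)) h * G =
        MvPolynomial.aeval (coordFn (VDcell n K D)) f := by
  obtain ⟨a, b, hb, rfl⟩ := IsFractionRing.div_surjective
    (A := MvPolynomial (PRoot n) K ⧸ vanishing (PRoot n) K (VDcell n K D)) G
  obtain ⟨f, rfl⟩ := Ideal.Quotient.mk_surjective a
  obtain ⟨h, rfl⟩ := Ideal.Quotient.mk_surjective b
  have hne : algebraMap (MvPolynomial (PRoot n) K ⧸ vanishing (PRoot n) K (VDcell n K D))
      (RatFld n K (VDcell n K D)) (Ideal.Quotient.mk _ h) ≠ 0 :=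
    IsFractionRing.to_map_ne_zero_of_mem_nonZeroDivisors hb
  refine ⟨f, h, ?_, ?_⟩
  · rwa [aeval_coordFn]
  · rw [aeval_coordFn, aeval_coordFn, mul_div_cancel₀ _ hne]

/-- An element fixed by the coadjoint action is an invariant. -/
lemma isInvariantRat_of_forall {G : RatFld n K (VDcell n K D)}
    (hG : ∀ (g : Matrix (Fin n) (Fin n) K), Unipotent g →
      ∀ τ : RatFld n K (VDcell n K D) →ₐ[K] RatFld n K (VDcell n K D),
        τ ∘ coordFn (VDcell n K D) = coadjPt n _
          ((algebraMap K (RatFld n K (VDcell n K D))).mapMatrix g) (coordFn (VDcell n K D)) →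
        τ G = G) :
    IsInvariantRat n K (VDcell n K D) G := by
  have hx := isGenericOn_coordFn (n := n) (D := D) (K := K)
  obtain ⟨f, h, hh, hfh⟩ := exists_div_coordFn G
  refine ⟨f, h, fun hmem => hh ((hx h).2 hmem), ?_, fun g hg => ?_⟩
  · rwa [← aeval_coordFn, ← aeval_coordFn]
  · rw [hx.forall_eval_iff (isUni_iff.1 hg)]
    obtain ⟨τ, hτ⟩ := exists_algHom_coordFn (hx.coadjPt (isUni_iff.1 hg))
    have hval : ∀ p : MvPolynomial (PRoot n) K,
        τ (MvPolynomial.aeval (coordFn (VDcell n K D)) p) = MvPolynomial.aeval (coadjPt n _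
          ((algebraMap K (RatFld n K (VDcell n K D))).mapMatrix g) (coordFn (VDcell n K D))) p := by
      intro p
      rw [← hτ, ← AlgHom.comp_apply, MvPolynomial.comp_aeval]
      rfl
    have h1 := congrArg τ hfh
    rw [map_mul, hG g (isUni_iff.1 hg) τ hτ, hval, hval] at h1
    rw [← h1, ← hfh]
    ring

lemma IsInvariantRat.exists_div {G : RatFld n K (VDcell n K D)}
    (hG : IsInvariantRat n K (VDcell n K D) G) :
    ∃ f h : MvPolynomial (PRoot n) K, MvPolynomial.aeval (coordFn (VDcell n K D)) h ≠ 0 ∧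
      G = MvPolynomial.aeval (coordFn (VDcell n K D)) f /
        MvPolynomial.aeval (coordFn (VDcell n K D)) h ∧
      ∀ k : Matrix (Fin n) (Fin n) K, Unipotent k →
        MvPolynomial.aeval (coadjPt n _ ((algebraMap K (RatFld n K (VDcell n K D))).mapMatrix k)
            (coordFn (VDcell n K D))) f * MvPolynomial.aeval (coordFn (VDcell n K D)) h =
          MvPolynomial.aeval (coordFn (VDcell n K D)) f * MvPolynomial.aeval (coadjPt n _
            ((algebraMap K (RatFld n K (VDcell n K D))).mapMatrix k)
              (coordFn (VDcell n K D))) h := by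
  have hx := isGenericOn_coordFn (n := n) (D := D) (K := K)
  obtain ⟨f, h, hh, hfh, hinv⟩ := hG
  have hne : MvPolynomial.aeval (coordFn (VDcell n K D)) h ≠ 0 := fun h0 => hh ((hx h).1 h0)
  refine ⟨f, h, hne, ?_, fun k hk => (hx.forall_eval_iff hk f h).1 (hinv k (isUni_iff.2 hk))⟩
  rw [eq_div_iff hne, mul_comm, aeval_coordFn, aeval_coordFn]
  exact hfh

end RationalFunctions

/-- the field of invariants `K(V_D^∘)^N` of the coadjoint action
of `N = UT(n,K)` on the basic cell is a purely transcendental extension of `K`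
of transcendence degree `|C(D)|`: there is a family `{F_ξ : ξ ∈ C(D)}` of
invariants, algebraically independent over `K`, whose `K`-extension inside
`K(V_D^∘)` is exactly the field of invariants; moreover it can be chosen so
that for `ξ = (i,j) ∈ D`, `F_ξ` is the image of the minor `P^{w_D}_{ij}(X)`. -/
theorem stmt14 (n : ℕ) (hn : 2 ≤ n) (K : Type) [Field K] [CharZero K]
    (D : Set (ℕ × ℕ)) (hD : IsBasic n D)
    [hI : (vanishing (PRoot n) K (VDcell n K D)).IsPrime] :
    ∃ F : {γ : ℕ × ℕ // γ ∈ CD n D} → RatFld n K (VDcell n K D),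
      (∀ ξ, IsInvariantRat n K (VDcell n K D) (F ξ)) ∧
      AlgebraicIndependent K F ∧
      (∀ G ∈ IntermediateField.adjoin K (Set.range F),
        IsInvariantRat n K (VDcell n K D) G) ∧
      (∀ G, IsInvariantRat n K (VDcell n K D) G →
        G ∈ IntermediateField.adjoin K (Set.range F)) ∧
      (∀ ξ : {γ : ℕ × ℕ // γ ∈ CD n D}, ξ.1 ∈ D →
        F ξ = algebraMap (MvPolynomial (PRoot n) K ⧸ vanishing (PRoot n) K (VDcell n K D))
          (RatFld n K (VDcell n K D))
          (Ideal.Quotient.mk (vanishing (PRoot n) K (VDcell n K D))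
            (minorW n (MvPolynomial (PRoot n) K) (wD n D) (genMat n K) ξ.1.1 ξ.1.2))) := by
  have hx := isGenericOn_coordFn (n := n) (D := D) (K := K)
  obtain ⟨g, F, hg, hcan, hind, hadj, hminor⟩ := hx.exists_generators hD
  have hinv : ∀ G ∈ IntermediateField.adjoin K (Set.range F),
      IsInvariantRat n K (VDcell n K D) G := by
    intro G hG
    rw [hadj] at hG
    exact isInvariantRat_of_forall fun k hk τ hτ => hcan.apply_eq hg (hk.map _) τ hτ hG
  refine ⟨F, fun ξ => hinv _ (IntermediateField.subset_adjoin K _ ⟨ξ, rfl⟩), hind, hinv,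
    fun G hG => ?_, fun ξ hξ => ?_⟩
  · obtain ⟨f, h, hh, rfl, hrel⟩ := hG.exists_div
    rw [hadj]
    exact mem_lowerField_of_invariant hg hh hrel
  · rw [hminor ξ hξ, ← aeval_coordFn, aeval_minorW]
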